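/- arXiv:1707.02508 — 2 statements merged into one kernel-verified Lean document; each statement's English description precedes it below -/
import Mathlib

section
/- Let K be an infinite finitely generated field of characteristic p > 0, let R ⊆ K be a finitely generated subring, let L/K be a finite Galois extension with Galois group 𝒢 = Gal(L/K), and fix a conjugacy class 𝒞 of 𝒢. Then there exist infinitely many pairwise inequivalent nontrivial discrete valuations v on K such that the completion K_v is locally compact, R is contained in the valuation ring 𝒪_v of v, and for any extension w of v to L, the extension of completions L_w/K_v is unramified and its Frobenius automorphism, viewed as an element of Gal(L/K) via the decomposition group at w, belongs to 𝒞. -/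
/-- The ring of `p`-adic integers `ℤ_p` considered as a valuation subring of `ℚ_p`. -/
noncomputable def padicValuationSubring (p : ℕ) [Fact p.Prime] : ValuationSubring ℚ_[p] where
  toSubring := PadicInt.subring p
  mem_or_inv_mem' := by
    intro x
    rcases le_or_gt ‖x‖ 1 with h | h
    · exact Or.inl h
    · refine Or.inr ?_
      show ‖x⁻¹‖ ≤ 1
      rw [norm_inv]
      exact inv_le_one_of_one_le₀ h.le

variable {K L : Type*} [Field K] [Field L] [Algebra K L]

/-- If `w` is a valuation subring of `L` lying over the valuation subring `v` of `K`, this is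
the induced ring homomorphism `v →+* w`. -/
def ValuationSubring.extensionHom (v : ValuationSubring K) (w : ValuationSubring L)
    (h : w.comap (algebraMap K L) = v) : v →+* w where
  toFun x := ⟨algebraMap K L x, by
    have hx : (x : K) ∈ w.comap (algebraMap K L) := by rw [h]; exact x.2
    exact ValuationSubring.mem_comap.mp hx⟩
  map_one' := by ext; simp
  map_mul' x y := by ext; simp
  map_zero' := by ext; simp
  map_add' x y := by ext; simp

instance ValuationSubring.isLocalHom_extensionHom (v : ValuationSubring K)
    (w : ValuationSubring L) (h : w.comap (algebraMap K L) = v) :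
    IsLocalHom (ValuationSubring.extensionHom v w h) := by
  subst h
  constructor
  intro x hx
  rcases hx with ⟨u, hu⟩
  have hval : ((u : w) : L) = algebraMap K L x := congrArg Subtype.val hu
  have hx0 : (x : K) ≠ 0 := by
    intro h0
    apply u.ne_zero
    have : ((u : w) : L) = 0 := by rw [hval, h0, map_zero]
    exact Subtype.ext this
  have hmul : ((u⁻¹ : wˣ) : w) * (u : w) = 1 := u.inv_mul
  have hmulL : (((u⁻¹ : wˣ) : w) : L) * algebraMap K L x = 1 := by
    rw [← hval]
    exact_mod_cast congrArg Subtype.val hmul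
  have hinvL : (((u⁻¹ : wˣ) : w) : L) = algebraMap K L ((x : K)⁻¹) := by
    rw [map_inv₀]
    exact eq_inv_of_mul_eq_one_left hmulL
  have hmem : (x : K)⁻¹ ∈ w.comap (algebraMap K L) :=
    ValuationSubring.mem_comap.mpr (by rw [← hinvL]; exact ((u⁻¹ : wˣ) : w).2)
  refine IsUnit.of_mul_eq_one ⟨(x : K)⁻¹, hmem⟩ (Subtype.ext ?_)
  simp [mul_inv_cancel₀ hx0]

/-- The extension `L_w / K_v` of completions is unramified: the value group is unchanged and
the residue field extension is separable. -/
def ValuationSubring.IsUnramifiedExtension (v : ValuationSubring K) (w : ValuationSubring L)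
    (h : w.comap (algebraMap K L) = v) : Prop :=
  (∀ x : L, x ≠ 0 → ∃ y : K, y ≠ 0 ∧ w.valuation x = w.valuation (algebraMap K L y)) ∧
  (letI := (IsLocalRing.ResidueField.map (ValuationSubring.extensionHom v w h)).toAlgebra
   Algebra.IsSeparable (IsLocalRing.ResidueField ↥v) (IsLocalRing.ResidueField ↥w))

/-- `σ` is the Frobenius automorphism of `L_w/K_v`: it belongs to the decomposition group of `w`
and induces `x ↦ x^q` on the residue field of `w`, where `q` is the cardinality of the residue
field of `v`. -/
def ValuationSubring.IsFrobeniusAt (v : ValuationSubring K) (w : ValuationSubring L)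
    (σ : L ≃ₐ[K] L) : Prop :=
  (∀ x : L, x ∈ w ↔ σ x ∈ w) ∧
  (∀ x : L, x ∈ w →
    w.valuation (σ x - x ^ Nat.card (IsLocalRing.ResidueField ↥v)) < 1)

namespace ChebotarevFG
open Module

/-- The set of orders of the nonzero elements of a finite-dimensional space of power series is
finite, of cardinality the dimension of the space. -/
theorem exists_finset_orders {k : Type*} [Field k] (V : Submodule k (PowerSeries k))
    [FiniteDimensional k V] :
    ∃ s : Finset ℕ, s.card = finrank k V ∧ (∀ i ∈ s, ∃ b ∈ V, b.order = (i : ℕ∞)) ∧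
      ∀ x ∈ V, x ≠ 0 → ∃ i ∈ s, x.order = (i : ℕ∞) := by
  induction hn : finrank k V generalizing V with
  | zero =>
    rw [Submodule.finrank_eq_zero] at hn
    subst hn
    exact ⟨∅, rfl, by simp, fun x hx hx0 => absurd ((Submodule.mem_bot k).1 hx) hx0⟩
  | succ n ih =>
    have hV : V ≠ ⊥ := by
      rintro rfl
      simp at hn
    obtain ⟨x₀, hx₀, hx₀0⟩ := Submodule.exists_mem_ne_zero_of_ne_bot hV
    have hex : ∃ m : ℕ, ∃ x ∈ V, PowerSeries.coeff m x ≠ 0 := by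
      by_contra! h
      exact hx₀0 (PowerSeries.ext fun m => by simpa using h m x₀ hx₀)
    classical
    set m := Nat.find hex with hm
    obtain ⟨b, hb, hbm⟩ := Nat.find_spec hex
    rw [← hm] at hbm
    have hlt : ∀ i < m, ∀ x ∈ V, PowerSeries.coeff i x = 0 := by
      intro i hi x hx
      by_contra h
      exact Nat.find_min hex hi ⟨x, hx, h⟩
    have hord : ∀ x ∈ V, PowerSeries.coeff m x ≠ 0 → x.order = (m : ℕ∞) := by
      intro x hx hxm
      rw [PowerSeries.order_eq_nat]
      exact ⟨hxm, fun i hi => hlt i hi x hx⟩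
    set f : V →ₗ[k] k := (PowerSeries.coeff (R := k) m).comp V.subtype with hf
    set V' : Submodule k (PowerSeries k) := (LinearMap.ker f).map V.subtype with hV'
    have hfsurj : LinearMap.range f = ⊤ := by
      apply LinearMap.range_eq_top.2
      apply LinearMap.surjective
      intro h
      exact hbm (by simpa [hf] using LinearMap.congr_fun h ⟨b, hb⟩)
    have hfr : finrank k V' = n := by
      have h1 := LinearMap.finrank_range_add_finrank_ker f
      rw [hfsurj, finrank_top, finrank_self, hn] at h1
      rw [hV', Submodule.finrank_map_subtype_eq]
      omega
    have hmem : ∀ x, x ∈ V' ↔ x ∈ V ∧ PowerSeries.coeff m x = 0 := by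
      intro x
      simp [hV', hf, and_comm]
    obtain ⟨s, hs, hs1, hs2⟩ := ih V' hfr
    have hms : m ∉ s := by
      intro h
      obtain ⟨y, hy, hyo⟩ := hs1 m h
      exact (PowerSeries.order_eq_nat.1 hyo).1 ((hmem y).1 hy).2
    refine ⟨insert m s, by rw [Finset.card_insert_of_notMem hms, hs], ?_, ?_⟩
    · intro i hi
      rcases Finset.mem_insert.1 hi with rfl | hi
      · exact ⟨b, hb, hord b hb hbm⟩
      · obtain ⟨y, hy, hyo⟩ := hs1 i hi
        exact ⟨y, ((hmem y).1 hy).1, hyo⟩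
    · intro x hx hx0
      by_cases h : PowerSeries.coeff m x = 0
      · obtain ⟨i, hi, hio⟩ := hs2 x ((hmem x).2 ⟨hx, h⟩) hx0
        exact ⟨i, Finset.mem_insert_of_mem hi, hio⟩
      · exact ⟨m, Finset.mem_insert_self _ _, hord x hx h⟩

/-- A finite sum of power series with pairwise distinct finite orders is nonzero. -/
theorem sum_ne_zero_of_order_injOn {k ι : Type*} [Field k] (s : Finset ι)
    (x : ι → PowerSeries k) (hs : ∃ i ∈ s, x i ≠ 0)
    (hx : ∀ i ∈ s, ∀ j ∈ s, x i ≠ 0 → x j ≠ 0 → (x i).order = (x j).order → i = j) :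
    ∑ i ∈ s, x i ≠ 0 := by
  classical
  obtain ⟨i, hi, hi0⟩ := hs
  obtain ⟨j, hj, hjmin⟩ := Finset.exists_min_image (s.filter fun i => x i ≠ 0)
    (fun i => (x i).order) ⟨i, Finset.mem_filter.2 ⟨hi, hi0⟩⟩
  rw [Finset.mem_filter] at hj
  intro h
  have hlift : ∃ m : ℕ, (x j).order = m := by
    have := (PowerSeries.order_finite_iff_ne_zero (φ := x j)).2 hj.2
    exact ⟨_, (ENat.natCast_toNat this.ne).symm⟩
  obtain ⟨m, hm⟩ := hlift
  have h1 : PowerSeries.coeff m (∑ i ∈ s, x i) = PowerSeries.coeff m (x j) := by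
    rw [map_sum]
    apply Finset.sum_eq_single_of_mem j hj.1
    intro b hb hbj
    by_cases hb0 : x b = 0
    · simp [hb0]
    · apply PowerSeries.coeff_of_lt_order
      rw [← hm]
      refine lt_of_le_of_ne (hjmin b (Finset.mem_filter.2 ⟨hb, hb0⟩)) ?_
      intro heq
      exact hbj (hx b hb j hj.1 hb0 hj.2 heq.symm)
  rw [h, map_zero] at h1
  exact (PowerSeries.order_eq_nat.1 hm).1 h1.symm

section Filtration

variable {k R : Type*} [Field k] [CommRing R] [IsDomain R] [Algebra k R]

/-- A nonzero element of degree `e` of a filtered `k`-algebra of linear growth has boundedly many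
`k`-rational zeros. -/
theorem card_zeros_le (W : ℕ → Submodule k R) (hmono : Monotone W)
    (hfin : ∀ m, FiniteDimensional k (W m))
    (hmul : ∀ l m x y, x ∈ W l → y ∈ W m → x * y ∈ W (l + m))
    (hex : ∀ x, ∃ m, x ∈ W m) (n c : ℕ)
    (hle : ∀ m, finrank k (W m) ≤ n * m + n) (hge : ∀ m, n * m ≤ finrank k (W m) + n * c)
    {e : ℕ} {g : R} (hg : g ∈ W e) (hg0 : g ≠ 0) (S : Finset (R →ₐ[k] k))
    (hS : ∀ φ ∈ S, φ g = 0) : S.card ≤ n * (e + c + 1) := by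
  classical
  have hsep : ∀ φ ∈ S, ∃ r : R, φ r ≠ 0 ∧ ∀ ψ ∈ S, ψ ≠ φ → ψ r = 0 := by
    intro φ _
    have hx : ∀ ψ : R →ₐ[k] k, ψ ≠ φ → ∃ x : R, φ x ≠ ψ x := by
      intro ψ h
      by_contra! h'
      exact h (AlgHom.ext fun x => (h' x).symm)
    choose! x hx using hx
    refine ⟨∏ ψ ∈ S.erase φ, (x ψ - algebraMap k R (ψ (x ψ))), ?_, ?_⟩
    · rw [map_prod, Finset.prod_ne_zero_iff]
      intro ψ hψ
      rw [map_sub, AlgHom.commutes, sub_ne_zero]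
      exact hx ψ (Finset.ne_of_mem_erase hψ)
    · intro ψ hψ hne
      rw [map_prod]
      exact Finset.prod_eq_zero (Finset.mem_erase.2 ⟨hne, hψ⟩) (by simp)
  choose! r hr1 hr2 using hsep
  choose d hd using hex
  set T := e + S.sup (fun φ => d (r φ)) with hT
  have hrT : ∀ φ ∈ S, r φ ∈ W T := fun φ hφ =>
    hmono ((Finset.le_sup (f := fun φ => d (r φ)) hφ).trans (Nat.le_add_left _ _)) (hd (r φ))
  set ev : W T →ₗ[k] (S → k) :=
    (LinearMap.pi fun φ : S => φ.1.toLinearMap).comp (W T).subtype with hev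
  have hsurj : Function.Surjective ev := by
    intro y
    refine ⟨∑ φ : S, (y φ / φ.1 (r φ.1)) • ⟨r φ.1, hrT φ.1 φ.2⟩, ?_⟩
    funext ψ
    simp only [hev, LinearMap.comp_apply, LinearMap.pi_apply, map_sum, map_smul,
      Submodule.subtype_apply, AlgHom.toLinearMap_apply, Finset.sum_apply, Pi.smul_apply,
      smul_eq_mul]
    rw [Finset.sum_eq_single ψ]
    · exact div_mul_cancel₀ _ (hr1 ψ.1 ψ.2)
    · intro φ _ hne
      rw [hr2 φ.1 φ.2 ψ.1 ψ.2 (fun h => hne (Subtype.ext h.symm)), mul_zero]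
    · simp
  have hker : finrank k (W (T - e)) ≤ finrank k (LinearMap.ker ev) := by
    have hTe : e + (T - e) = T := by omega
    let mg : W (T - e) →ₗ[k] LinearMap.ker ev :=
      { toFun := fun x => ⟨⟨g * x.1, hTe.subst (motive := fun t => g * x.1 ∈ W t)
          (hmul _ _ _ _ hg x.2)⟩, by
          rw [LinearMap.mem_ker]
          funext φ
          simp [hev, hS φ.1 φ.2]⟩
        map_add' := fun x y => by ext; simp [mul_add]
        map_smul' := fun a x => by ext; simp }
    apply LinearMap.finrank_le_finrank_of_injective (f := mg)
    intro x y hxy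
    have : g * x.1 = g * y.1 := congrArg (fun z => z.1.1) hxy
    exact Subtype.ext (mul_left_cancel₀ hg0 this)
  have h1 := LinearMap.finrank_range_add_finrank_ker ev
  rw [LinearMap.range_eq_top.2 hsurj, finrank_top, finrank_fintype_fun_eq_card,
    Fintype.card_coe] at h1
  have h2 := hle T
  have h3 := hge (T - e)
  have h4 : n * T = n * (T - e) + n * e := by rw [← mul_add]; congr 1; omega
  have : n * (e + c + 1) = n * e + n * c + n := by ring
  omega

/-- The Stepanov–Bombieri bound: the number of `k`-points of a filtered `k`-algebra of linear
growth of rank `n` on which the `p ^ e`-power map is induced by a fixed twist is at most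
`(1 + 1 / n) p ^ e + O(1)`. -/
theorem stepanov_bound (p : ℕ) [Fact p.Prime] [CharP k p] [PerfectRing k p]
    (θ : R →ₐ[k] PowerSeries k) (hθ : Function.Injective θ)
    (W : ℕ → Submodule k R) (hmono : Monotone W)
    (hfin : ∀ m, FiniteDimensional k (W m))
    (hmul : ∀ l m x y, x ∈ W l → y ∈ W m → x * y ∈ W (l + m))
    (hex : ∀ x, ∃ m, x ∈ W m) (n c c' : ℕ) (hn : 0 < n)
    (hle : ∀ m, finrank k (W m) ≤ n * m + n) (hge : ∀ m, n * m ≤ finrank k (W m) + n * c) :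
    ∃ A B : ℕ, ∀ e ≥ A, ∀ S : Finset (R →ₐ[k] k),
      (∃ D : R, (∀ φ ∈ S, φ D ≠ 0) ∧
        ∀ m, ∀ r ∈ W m, ∃ r' ∈ W (m + c'), ∀ φ ∈ S, φ D * φ r ^ p ^ e = φ r') →
      n * S.card ≤ (n + 1) * p ^ e + B := by
  classical
  have hp : p.Prime := Fact.out
  have : CharP R p := charP_of_injective_algebraMap (algebraMap k R).injective p
  have : CharP (PowerSeries k) p :=
    charP_of_injective_algebraMap (algebraMap k (PowerSeries k)).injective p
  have := hfin
  set l : ℕ := (n + 1) * c + n * (c + c' + 4) with hl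
  have hspace : ∀ m, ∃ s : Finset ℕ, s.card = finrank k (W m) ∧
      (∀ i ∈ s, ∃ b ∈ W m, (θ b).order = (i : ℕ∞)) ∧
      ∀ x ∈ W m, x ≠ 0 → ∃ i ∈ s, (θ x).order = (i : ℕ∞) := by
    intro m
    obtain ⟨s, hs, hs1, hs2⟩ := exists_finset_orders ((W m).map θ.toLinearMap)
    refine ⟨s, ?_, ?_, ?_⟩
    · rw [hs]
      exact (LinearEquiv.finrank_eq (Submodule.equivMapOfInjective θ.toLinearMap hθ (W m))).symm
    · intro i hi
      obtain ⟨_, ⟨b, hb, rfl⟩, hbo⟩ := hs1 i hi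
      exact ⟨b, hb, hbo⟩
    · intro x hx hx0
      exact hs2 _ ⟨x, hx, rfl⟩ fun h => hx0 (hθ (by simpa using h))
  obtain ⟨s₀, -, -, hs₀⟩ := hspace l
  set A : ℕ := s₀.sup id + 1 with hA
  have hPA : ∀ x ∈ W l, x ≠ 0 → ∃ i < p ^ A, (θ x).order = (i : ℕ∞) := by
    intro x hx hx0
    obtain ⟨i, hi, hio⟩ := hs₀ x hx hx0
    refine ⟨i, lt_of_le_of_lt (Finset.le_sup (f := id) hi) ?_, hio⟩
    exact (Nat.lt_succ_self _).trans (Nat.lt_pow_self hp.one_lt)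
  refine ⟨A, n * n * (l + c + 1) + p ^ A * (n * n + n * n * c), ?_⟩
  intro e he S ⟨D, hD, hS⟩
  set P : ℕ := p ^ (e - A) with hP
  have hPpos : 0 < P := pow_pos hp.pos _
  have hQ : p ^ A * P = p ^ e := by rw [hP, ← pow_add]; congr 1; omega
  set m : ℕ := (n + 1) * P / (n * n) + 1 + c with hm
  have hnn : 0 < n * n := Nat.mul_pos hn hn
  have hm1 : (n + 1) * P < n * n * (m - c) := by
    rw [hm, Nat.add_sub_cancel]
    exact Nat.lt_mul_div_succ _ hnn
  have hm2 : n * n * (m - c) ≤ (n + 1) * P + n * n := by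
    rw [hm, Nat.add_sub_cancel, mul_add, mul_one]
    exact Nat.add_le_add_right (Nat.mul_div_le _ _) _
  obtain ⟨s, hs, hs1, -⟩ := hspace m
  choose! b hb hbo using hs1
  have hbr : ∀ i ∈ s, ∃ r' ∈ W (m + c'), ∀ φ ∈ S, φ D * φ (b i) ^ p ^ e = φ r' :=
    fun i hi => hS m (b i) (hb i hi)
  choose! r hr hrS using hbr
  let bas := Module.finBasis k (W l)
  have hpowmem : ∀ (j : ℕ) (t : ℕ) (x : R), 0 < t → x ∈ W j → x ^ t ∈ W (j * t) := by
    intro j t x ht hx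
    induction t, ht using Nat.le_induction with
    | base => simpa using hx
    | succ t _ ih => rw [pow_succ, mul_add, mul_one]; exact hmul _ _ _ _ ih hx
  let v : s × Fin (finrank k (W l)) → W (l * P + (m + c')) :=
    fun ij => ⟨(bas ij.2).1 ^ P * r ij.1.1,
      hmul _ _ _ _ (hpowmem _ _ _ hPpos (bas ij.2).2) (hr _ ij.1.2)⟩
  have hdep : ¬ LinearIndependent k v := by
    intro h
    have h1 := h.fintype_card_le_finrank
    rw [Fintype.card_prod, Fintype.card_coe, Fintype.card_fin, hs] at h1
    have h2 := hle (l * P + (m + c'))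
    have h3 := hge m
    have h4 := hge l
    have hlc : l = n * (2 * c + c' + 4) + c := by rw [hl]; ring
    have hmc : m = (m - c) + c := (Nat.sub_add_cancel (Nat.le_add_left _ _)).symm
    generalize m - c = M at *
    have hM : M ≤ 2 * P + 1 := by
      refine Nat.le_of_mul_le_mul_left (hm2.trans ?_) hnn
      have h5 : n + 1 ≤ n * n * 2 := by nlinarith
      have h6 := Nat.mul_le_mul_right P h5
      linarith
    have h3' : n * M ≤ finrank k (W m) := by rw [hmc] at h3 ⊢; linarith [mul_add n M c]
    have h4' : n * (n * (2 * c + c' + 4)) ≤ finrank k (W l) := by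
      rw [hlc] at h4 ⊢
      linarith [mul_add n (n * (2 * c + c' + 4)) c]
    have h5 := (Nat.mul_le_mul h3' h4').trans (h1.trans h2)
    have h6 : n * n * M * (n * (2 * c + c' + 4)) ≤
        n * ((n * (2 * c + c' + 4) + c) * P + ((2 * P + 1 + c) + c')) + n := by
      calc _ = n * M * (n * (n * (2 * c + c' + 4))) := by ring
        _ ≤ n * (l * P + (m + c')) + n := h5
        _ ≤ _ := by rw [← hlc, hmc]; gcongr
    have h7 := Nat.mul_le_mul_right (n * (2 * c + c' + 4)) (Nat.succ_le_of_lt hm1)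
    have h8 : n * (c + c' + 2) ≤ n * (c + c' + 2) * P := Nat.le_mul_of_pos_right _ hPpos
    rw [Nat.succ_eq_add_one] at h7
    nlinarith
  rw [Fintype.not_linearIndependent_iff] at hdep
  obtain ⟨lam, hlam, ⟨i₀, j₀⟩, hij₀⟩ := hdep
  choose μ hμ using fun ij => (bijective_iterateFrobenius k p (e - A)).2 (lam ij)
  simp only [iterateFrobenius_def] at hμ
  let x : s → R := fun i => ∑ j, μ (i, j) • (bas j).1
  have hxmem : ∀ i, x i ∈ W l := fun i =>
    Submodule.sum_mem _ fun j _ => Submodule.smul_mem _ _ (bas j).2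
  have hx0 : x i₀ ≠ 0 := by
    intro h
    have h1 : ∑ j, μ (i₀, j) • bas j = 0 := by
      apply Subtype.ext
      simpa [x] using h
    have h2 := Fintype.linearIndependent_iff.1 bas.linearIndependent _ h1 j₀
    apply hij₀
    rw [← hμ, h2, zero_pow (pow_pos hp.pos _).ne']
  have hrel : ∑ i, x i ^ P * r i.1 = 0 := by
    have h1 := congrArg Subtype.val hlam
    rw [Fintype.sum_prod_type] at h1
    simp only [Submodule.coe_sum, Submodule.coe_smul, Submodule.coe_zero] at h1
    rw [← h1]
    apply Finset.sum_congr rfl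
    intro i _
    have h2 : x i ^ P = ∑ j, (μ (i, j) • (bas j).1) ^ P := sum_pow_char_pow p _ _ _
    rw [h2, Finset.sum_mul]
    apply Finset.sum_congr rfl
    intro j _
    rw [smul_pow, hμ, smul_mul_assoc]
  set g : R := ∑ i, x i * b i.1 ^ p ^ A with hg
  have hg0 : g ≠ 0 := by
    intro h
    have h1 : ∑ i, θ (x i * b i.1 ^ p ^ A) = 0 := by rw [← map_sum, ← hg, h, map_zero]
    refine sum_ne_zero_of_order_injOn Finset.univ _ ?_ ?_ h1
    · refine ⟨i₀, Finset.mem_univ _, fun h => ?_⟩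
      have h2 : x i₀ * b i₀.1 ^ p ^ A = 0 := hθ (by simpa using h)
      rcases mul_eq_zero.1 h2 with h3 | h3
      · exact hx0 h3
      · have := hbo i₀.1 i₀.2
        rw [eq_zero_of_pow_eq_zero h3, map_zero, PowerSeries.order_zero] at this
        exact ENat.top_ne_natCast _ this
    · intro i _ j _ hi hj hord
      have key : ∀ i : s, θ (x i * b i.1 ^ p ^ A) ≠ 0 →
          ∃ t < p ^ A, (θ (x i * b i.1 ^ p ^ A)).order = ((t + p ^ A * i.1 : ℕ) : ℕ∞) := by
        intro i hi
        have hxi : x i ≠ 0 := by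
          rintro h
          simp [h] at hi
        obtain ⟨t, ht, hto⟩ := hPA _ (hxmem i) hxi
        refine ⟨t, ht, ?_⟩
        rw [map_mul, map_pow, PowerSeries.order_mul, PowerSeries.order_pow, hto, hbo _ i.2]
        simp
      obtain ⟨t, ht, hto⟩ := key i hi
      obtain ⟨t', ht', hto'⟩ := key j hj
      rw [hto, hto'] at hord
      have hord' : t + p ^ A * i.1 = t' + p ^ A * j.1 := by exact_mod_cast hord
      have h5 := congrArg (· / p ^ A) hord'
      beta_reduce at h5
      rw [Nat.add_mul_div_left _ _ (pow_pos hp.pos _), Nat.add_mul_div_left _ _ (pow_pos hp.pos _),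
        Nat.div_eq_of_lt ht, Nat.div_eq_of_lt ht'] at h5
      exact Subtype.ext (by omega)
  have hgmem : g ∈ W (l + m * p ^ A) :=
    Submodule.sum_mem _ fun i _ => hmul _ _ _ _ (hxmem i)
      (hpowmem _ _ _ (pow_pos hp.pos _) (hb _ i.2))
  have hgS : ∀ φ ∈ S, φ g = 0 := by
    intro φ hφ
    have h1 : φ D * φ g ^ P = 0 := by
      have h2 : g ^ P = ∑ i, (x i * b i.1 ^ p ^ A) ^ P := sum_pow_char_pow p _ _ _
      rw [← map_pow, h2, map_sum, Finset.mul_sum, ← map_zero φ, ← hrel,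
        map_sum]
      apply Finset.sum_congr rfl
      intro i _
      rw [mul_pow, ← pow_mul, hQ, map_mul, map_mul, ← hrS _ i.2 φ hφ, map_pow, map_pow]
      ring
    exact eq_zero_of_pow_eq_zero ((mul_eq_zero.1 h1).resolve_left (hD φ hφ))
  have hcard := card_zeros_le W hmono hfin hmul hex n c hle hge hgmem hg0 S hgS
  calc n * S.card ≤ n * (n * (l + m * p ^ A + c + 1)) := Nat.mul_le_mul_left _ hcard
    _ = n * n * (l + c + 1) + p ^ A * (n * n * (m - c) + n * n * c) := by
      have : m = (m - c) + c := (Nat.sub_add_cancel (Nat.le_add_left _ _)).symm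
      nth_rewrite 1 [this]
      ring
    _ ≤ n * n * (l + c + 1) + p ^ A * ((n + 1) * P + n * n + n * n * c) := by gcongr
    _ = (n + 1) * p ^ e + (n * n * (l + c + 1) + p ^ A * (n * n + n * n * c)) := by
      rw [← hQ]; ring

end Filtration
end ChebotarevFG

namespace ChebotarevFG
open Module Polynomial

section BoxFiltration

variable {k : Type*} [Field k] (f : k[X][X])

/-- The span of the monomials `u ^ i * y ^ j` with `i ≤ m` and `j < deg f` in `k[u, y] / (f)`. -/
noncomputable def boxSpan (m : ℕ) : Submodule k (AdjoinRoot f) :=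
  Submodule.span k (Set.range fun ij : Fin (m + 1) × Fin f.natDegree =>
    AdjoinRoot.of f (X ^ (ij.1 : ℕ)) * AdjoinRoot.root f ^ (ij.2 : ℕ))

variable {f}

theorem of_pow_mul_root_pow_mem_boxSpan {m i j : ℕ} (hi : i ≤ m) (hj : j < f.natDegree) :
    AdjoinRoot.of f (X ^ i) * AdjoinRoot.root f ^ j ∈ boxSpan f m :=
  Submodule.subset_span ⟨(⟨i, Nat.lt_succ_of_le hi⟩, ⟨j, hj⟩), rfl⟩

theorem boxSpan_mono : Monotone (boxSpan f) := by
  intro l m hlm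
  refine Submodule.span_le.2 ?_
  rintro _ ⟨⟨i, j⟩, rfl⟩
  exact of_pow_mul_root_pow_mem_boxSpan ((Nat.le_of_lt_succ i.2).trans hlm) j.2

instance finiteDimensional_boxSpan (m : ℕ) : FiniteDimensional k (boxSpan f m) :=
  FiniteDimensional.span_of_finite k (Set.finite_range _)

theorem exists_basis_adjoinRoot (hf : f.Monic) :
    ∃ b : Basis (Fin f.natDegree) k[X] (AdjoinRoot f),
      ∀ j, b j = AdjoinRoot.root f ^ (j : ℕ) := by
  refine ⟨(AdjoinRoot.powerBasis' hf).basis.reindex (finCongr (AdjoinRoot.powerBasis'_dim hf)),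
    fun j => ?_⟩
  rw [Basis.reindex_apply, PowerBasis.basis_eq_pow, AdjoinRoot.powerBasis'_gen]
  rfl

theorem finrank_boxSpan (hf : f.Monic) (m : ℕ) :
    finrank k (boxSpan f m) = (m + 1) * f.natDegree := by
  obtain ⟨b₀, hb₀⟩ := exists_basis_adjoinRoot hf
  let b := (Polynomial.basisMonomials k).smulTower b₀
  have hb : ∀ ij : Fin (m + 1) × Fin f.natDegree,
      b ((ij.1 : ℕ), ij.2) =
        AdjoinRoot.of f (X ^ (ij.1 : ℕ)) * AdjoinRoot.root f ^ (ij.2 : ℕ) := by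
    intro ij
    rw [Basis.smulTower_apply, hb₀, Polynomial.coe_basisMonomials, Algebra.smul_def,
      AdjoinRoot.algebraMap_eq]
    dsimp only
    rw [Polynomial.monomial_one_right_eq_X_pow]
  have hli : LinearIndependent k fun ij : Fin (m + 1) × Fin f.natDegree =>
      AdjoinRoot.of f (X ^ (ij.1 : ℕ)) * AdjoinRoot.root f ^ (ij.2 : ℕ) := by
    have := b.linearIndependent.comp
      (fun ij : Fin (m + 1) × Fin f.natDegree => ((ij.1 : ℕ), ij.2)) (by
        rintro ⟨i, j⟩ ⟨i', j'⟩ h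
        have h' := Prod.ext_iff.1 h
        exact Prod.ext (Fin.ext h'.1) h'.2)
    convert this using 1
    funext ij
    exact (hb ij).symm
  rw [boxSpan, finrank_span_eq_card hli, Fintype.card_prod, Fintype.card_fin, Fintype.card_fin]

theorem of_X_pow_mul_mem_boxSpan {i m : ℕ} {x : AdjoinRoot f} (hx : x ∈ boxSpan f m) :
    AdjoinRoot.of f (X ^ i) * x ∈ boxSpan f (i + m) := by
  induction hx using Submodule.span_induction with
  | mem x hx =>
    obtain ⟨⟨i', j⟩, rfl⟩ := hx
    rw [← mul_assoc, ← map_mul, ← pow_add]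
    exact of_pow_mul_root_pow_mem_boxSpan (Nat.add_le_add_left (Nat.le_of_lt_succ i'.2) _) j.2
  | zero => rw [mul_zero]; exact zero_mem _
  | add x y _ _ hx hy => rw [mul_add]; exact add_mem hx hy
  | smul a x _ hx => rw [mul_smul_comm]; exact Submodule.smul_mem _ _ hx

theorem exists_mem_boxSpan (hf : f.Monic) (x : AdjoinRoot f) : ∃ m, x ∈ boxSpan f m := by
  obtain ⟨b, hb⟩ := exists_basis_adjoinRoot hf
  rw [← b.sum_repr x]
  have hterm : ∀ j, ∃ m, (b.repr x j) • b j ∈ boxSpan f m := by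
    intro j
    generalize b.repr x j = q
    rw [hb, Algebra.smul_def, AdjoinRoot.algebraMap_eq]
    refine ⟨q.natDegree, ?_⟩
    have hq := congrArg (AdjoinRoot.of f) q.as_sum_range_C_mul_X_pow
    rw [hq, map_sum, Finset.sum_mul]
    refine Submodule.sum_mem _ fun i hi => ?_
    rw [map_mul, mul_assoc]
    have : AdjoinRoot.of f (C (q.coeff i)) = algebraMap k (AdjoinRoot f) (q.coeff i) := rfl
    rw [this, ← Algebra.smul_def]
    exact Submodule.smul_mem _ _ (of_pow_mul_root_pow_mem_boxSpan
      (Nat.le_of_lt_succ (Finset.mem_range.1 hi)) j.2)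
  choose d hd using hterm
  exact ⟨Finset.univ.sup d, Submodule.sum_mem _ fun j _ =>
    boxSpan_mono (Finset.le_sup (Finset.mem_univ j)) (hd j)⟩

theorem exists_forall_mem_boxSpan (hf : f.Monic) (g : ℕ → AdjoinRoot f) (N : ℕ) :
    ∃ m, ∀ j < N, g j ∈ boxSpan f m := by
  choose d hd using fun j => exists_mem_boxSpan hf (g j)
  exact ⟨(Finset.range N).sup d, fun j hj =>
    boxSpan_mono (Finset.le_sup (Finset.mem_range.2 hj)) (hd j)⟩

theorem mul_mem_boxSpan {c : ℕ} (hc : ∀ j < 2 * f.natDegree, AdjoinRoot.root f ^ j ∈ boxSpan f c)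
    {l m : ℕ} {x y : AdjoinRoot f} (hx : x ∈ boxSpan f l) (hy : y ∈ boxSpan f m) :
    x * y ∈ boxSpan f (l + m + c) := by
  induction hx using Submodule.span_induction with
  | mem x hx =>
    obtain ⟨⟨i, j⟩, rfl⟩ := hx
    induction hy using Submodule.span_induction with
    | mem y hy =>
      obtain ⟨⟨i', j'⟩, rfl⟩ := hy
      rw [mul_mul_mul_comm, ← map_mul, ← pow_add, ← pow_add]
      refine boxSpan_mono ?_ (of_X_pow_mul_mem_boxSpan (hc _ ?_))
      · have := Nat.le_of_lt_succ i.2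
        have := Nat.le_of_lt_succ i'.2
        dsimp only
        omega
      · have := j.2
        have := j'.2
        dsimp only
        omega
    | zero => rw [mul_zero]; exact zero_mem _
    | add x y _ _ hx hy => rw [mul_add]; exact add_mem hx hy
    | smul a x _ hx => rw [mul_smul_comm]; exact Submodule.smul_mem _ _ hx
  | zero => rw [zero_mul]; exact zero_mem _
  | add x y _ _ hx hy => rw [add_mul]; exact add_mem hx hy
  | smul a x _ hx => rw [smul_mul_assoc]; exact Submodule.smul_mem _ _ hx

end BoxFiltration

/-- The number of points `(a, b)` of a plane curve of degree `n` in `y` whose Frobenius twist is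
`(a, Σ (a, b) / d a)` is at most `(1 + 1 / n) p ^ e + O(1)`. -/
theorem card_twisted_points_le {k : Type*} [Field k] (p : ℕ) [Fact p.Prime] [CharP k p]
    [PerfectRing k p] {f : k[X][X]} (hf : f.Monic) (hfn : 0 < f.natDegree)
    (θ : AdjoinRoot f →ₐ[k] PowerSeries k) (hθ : Function.Injective θ) (d : k[X]) (s : k[X][X]) :
    ∃ A B : ℕ, ∀ e ≥ A, ∀ S : Finset (k × k),
      (∀ x ∈ S, x.1 ^ p ^ e = x.1 ∧ f.evalEval x.1 x.2 = 0 ∧ d.eval x.1 ≠ 0 ∧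
        d.eval x.1 * x.2 ^ p ^ e = s.evalEval x.1 x.2) →
      f.natDegree * S.card ≤ (f.natDegree + 1) * p ^ e + B := by
  classical
  have : IsDomain (AdjoinRoot f) := hθ.isDomain θ.toRingHom
  have : CharP (AdjoinRoot f) p :=
    charP_of_injective_algebraMap (algebraMap k (AdjoinRoot f)).injective p
  set n := f.natDegree with hn
  obtain ⟨c, hc⟩ := exists_forall_mem_boxSpan hf (fun j => AdjoinRoot.root f ^ j) (2 * n)
  obtain ⟨c', hc'⟩ := exists_forall_mem_boxSpan hf
    (fun j => AdjoinRoot.mk f s ^ j * AdjoinRoot.of f d ^ (n - 1 - j)) n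
  let W : ℕ → Submodule k (AdjoinRoot f) := fun m => if m < c then ⊥ else boxSpan f (m - c)
  have hWlt : ∀ m, m < c → W m = ⊥ := fun m h => if_pos h
  have hWge : ∀ m, c ≤ m → W m = boxSpan f (m - c) := fun m h => if_neg (not_lt.2 h)
  have hmono : Monotone W := by
    intro l m hlm
    rcases lt_or_ge l c with h | h
    · rw [hWlt l h]; exact bot_le
    · rw [hWge l h, hWge m (h.trans hlm)]
      exact boxSpan_mono (Nat.sub_le_sub_right hlm _)
  have hfin : ∀ m, FiniteDimensional k (W m) := by
    intro m
    rcases lt_or_ge m c with h | h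
    · rw [hWlt m h]; infer_instance
    · rw [hWge m h]; infer_instance
  have hmul : ∀ l m x y, x ∈ W l → y ∈ W m → x * y ∈ W (l + m) := by
    intro l m x y hx hy
    rcases lt_or_ge l c with h | h
    · rw [hWlt l h, Submodule.mem_bot] at hx
      rw [hx, zero_mul]; exact zero_mem _
    rcases lt_or_ge m c with h' | h'
    · rw [hWlt m h', Submodule.mem_bot] at hy
      rw [hy, mul_zero]; exact zero_mem _
    rw [hWge l h] at hx
    rw [hWge m h'] at hy
    rw [hWge _ (h.trans (Nat.le_add_right _ _))]
    refine boxSpan_mono ?_ (mul_mem_boxSpan hc hx hy)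
    omega
  have hex : ∀ x, ∃ m, x ∈ W m := by
    intro x
    obtain ⟨m, hm⟩ := exists_mem_boxSpan hf x
    refine ⟨m + c, ?_⟩
    rw [hWge _ (Nat.le_add_left _ _), Nat.add_sub_cancel]
    exact hm
  have hle : ∀ m, finrank k (W m) ≤ n * m + n := by
    intro m
    rcases lt_or_ge m c with h | h
    · rw [hWlt m h, finrank_bot]; exact Nat.zero_le _
    · rw [hWge m h, finrank_boxSpan hf, mul_comm, ← mul_add_one]
      exact Nat.mul_le_mul_left _ (by omega)
  have hge : ∀ m, n * m ≤ finrank k (W m) + n * c := by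
    intro m
    rcases lt_or_ge m c with h | h
    · exact (Nat.mul_le_mul_left _ h.le).trans (Nat.le_add_left _ _)
    · rw [hWge m h, finrank_boxSpan hf, mul_comm _ f.natDegree, ← mul_add]
      exact Nat.mul_le_mul_left _ (by omega)
  obtain ⟨A, B, hAB⟩ := stepanov_bound p θ hθ W hmono hfin hmul hex n c c' hfn hle hge
  refine ⟨A, B, fun e he S hS => ?_⟩
  have hev : ∀ x : S, f.eval₂ (aeval (R := k) x.1.1 : k[X] →ₐ[k] k) x.1.2 = 0 := by
    intro x
    have := (hS x.1 x.2).2.1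
    rw [← eval₂_evalRingHom] at this
    exact this
  let pt : S → (AdjoinRoot f →ₐ[k] k) := fun x =>
    AdjoinRoot.liftAlgHom f (aeval x.1.1) x.1.2 (hev x)
  have hpt_of : ∀ x q, pt x (AdjoinRoot.of f q) = q.eval x.1.1 := by
    intro x q
    simp [pt, AdjoinRoot.liftAlgHom_of]
  have hpt_root : ∀ x, pt x (AdjoinRoot.root f) = x.1.2 := by
    intro x
    simp [pt]
  have hpt_mk : ∀ x q, pt x (AdjoinRoot.mk f q) = q.evalEval x.1.1 x.1.2 := by
    intro x q
    rw [← eval₂_evalRingHom]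
    exact AdjoinRoot.lift_mk (hev x) q
  have hpt : Function.Injective pt := by
    intro x y h
    apply Subtype.ext
    apply Prod.ext
    · have := congrArg (fun φ => φ (AdjoinRoot.of f X)) h
      simpa [hpt_of] using this
    · have := congrArg (fun φ => φ (AdjoinRoot.root f)) h
      simpa [hpt_root] using this
  have hcard : (Finset.univ.map ⟨pt, hpt⟩).card = S.card := by simp
  rw [← hcard]
  refine hAB e he _ ⟨AdjoinRoot.of f d ^ (n - 1), ?_, ?_⟩
  · intro φ hφ
    obtain ⟨x, -, rfl⟩ := Finset.mem_map.1 hφ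
    change pt x _ ≠ 0
    rw [map_pow, hpt_of]
    exact pow_ne_zero _ (hS x.1 x.2).2.2.1
  · intro m r hr
    suffices h : ∃ r' ∈ W (m + c'), ∀ x : S,
        pt x (AdjoinRoot.of f d ^ (n - 1)) * pt x r ^ p ^ e = pt x r' by
      obtain ⟨r', hr', h⟩ := h
      refine ⟨r', hr', fun φ hφ => ?_⟩
      obtain ⟨x, -, rfl⟩ := Finset.mem_map.1 hφ
      exact h x
    rcases lt_or_ge m c with h | h
    · rw [hWlt m h, Submodule.mem_bot] at hr
      refine ⟨0, zero_mem _, fun x => ?_⟩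
      rw [hr, map_zero, zero_pow (pow_pos (Fact.out : p.Prime).pos _).ne', mul_zero]
    rw [hWge m h] at hr
    rw [hWge _ (h.trans (Nat.le_add_right _ _))]
    induction hr using Submodule.span_induction with
    | mem r hr =>
      obtain ⟨⟨i, j⟩, rfl⟩ := hr
      refine ⟨AdjoinRoot.of f (X ^ (i : ℕ)) *
        (AdjoinRoot.mk f s ^ (j : ℕ) * AdjoinRoot.of f d ^ (n - 1 - j)), ?_, ?_⟩
      · refine boxSpan_mono ?_ (of_X_pow_mul_mem_boxSpan (hc' j j.2))
        have := i.2
        omega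
      · intro x
        obtain ⟨h1, -, -, h4⟩ := hS x.1 x.2
        simp only [map_mul, map_pow, hpt_of, hpt_root, hpt_mk, eval_X]
        rw [← h4, mul_pow, mul_pow, ← pow_mul, mul_comm (i : ℕ), pow_mul, h1, ← pow_mul,
          ← pow_mul, mul_comm (j : ℕ)]
        have : (eval x.1.1 d) ^ (n - 1) = eval x.1.1 d ^ (j : ℕ) * eval x.1.1 d ^ (n - 1 - j) := by
          rw [← pow_add]
          congr 1
          have := j.2
          omega
        rw [this]
        ring
    | zero =>
      refine ⟨0, zero_mem _, fun x => ?_⟩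
      rw [map_zero, zero_pow (pow_pos (Fact.out : p.Prime).pos _).ne', mul_zero]
    | add r₁ r₂ _ _ h₁ h₂ =>
      obtain ⟨r₁', hr₁, h₁⟩ := h₁
      obtain ⟨r₂', hr₂, h₂⟩ := h₂
      refine ⟨r₁' + r₂', add_mem hr₁ hr₂, fun x => ?_⟩
      rw [map_add, add_pow_char_pow, mul_add, h₁, h₂, map_add]
    | smul a r _ h =>
      obtain ⟨r', hr', h⟩ := h
      refine ⟨a ^ p ^ e • r', Submodule.smul_mem _ _ hr', fun x => ?_⟩
      rw [map_smul, map_smul, smul_eq_mul, smul_eq_mul, mul_pow, ← h]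
      ring

end ChebotarevFG

namespace ChebotarevFG
open Module Polynomial

/-- Hensel's lemma for power series. -/
theorem exists_root_powerSeries {A : Type*} [CommRing A] (G : (PowerSeries A)[X]) (hG : G.Monic)
    (b : A) (hb : PowerSeries.constantCoeff (G.eval (PowerSeries.C b)) = 0)
    (hb' : IsUnit (PowerSeries.constantCoeff (G.derivative.eval (PowerSeries.C b)))) :
    ∃ y : PowerSeries A, G.eval y = 0 ∧ PowerSeries.constantCoeff y = b := by
  have hH : HenselianRing (PowerSeries A) (Ideal.span {PowerSeries.X}) := inferInstance
  obtain ⟨y, hy, hyb⟩ := hH.is_henselian G hG (PowerSeries.C b)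
    (Ideal.mem_span_singleton.2 (PowerSeries.X_dvd_iff.2 hb))
    ((PowerSeries.isUnit_iff_constantCoeff.2 hb').map _)
  refine ⟨y, hy, ?_⟩
  have := PowerSeries.X_dvd_iff.1 (Ideal.mem_span_singleton.1 hyb)
  rwa [map_sub, PowerSeries.constantCoeff_C, sub_eq_zero] at this

/-- Evaluation of a bivariate polynomial at a point of an extension ring. -/
noncomputable def biEval {A D : Type*} [CommRing A] [CommRing D] (ψ : A →+* D) (x y : D) :
    A[X][X] →+* D :=
  eval₂RingHom (eval₂RingHom ψ x) y

section BiEval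

variable {A D D' : Type*} [CommRing A] [CommRing D] [CommRing D']

theorem biEval_apply (ψ : A →+* D) (x y : D) (F : A[X][X]) :
    biEval ψ x y F = F.eval₂ (eval₂RingHom ψ x) y := rfl

@[simp] theorem biEval_X (ψ : A →+* D) (x y : D) : biEval ψ x y X = y := by
  simp [biEval]

@[simp] theorem biEval_C (ψ : A →+* D) (x y : D) (q : A[X]) :
    biEval ψ x y (C q) = q.eval₂ ψ x := by
  simp [biEval]

theorem map_biEval (g : D →+* D') (ψ : A →+* D) (x y : D) (F : A[X][X]) :
    g (biEval ψ x y F) = biEval (g.comp ψ) (g x) (g y) F := by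
  rw [biEval_apply, biEval_apply, hom_eval₂]
  congr 1
  apply Polynomial.ringHom_ext <;> simp

theorem biEval_map {A' : Type*} [CommRing A'] (ψ : A' →+* D) (χ : A →+* A') (x y : D)
    (F : A[X][X]) : biEval ψ x y (F.map (mapRingHom χ)) = biEval (ψ.comp χ) x y F := by
  rw [biEval_apply, biEval_apply, eval₂_map]
  congr 1
  apply Polynomial.ringHom_ext <;> simp

theorem biEval_id (x y : A) (F : A[X][X]) : biEval (RingHom.id A) x y F = F.evalEval x y := by
  rw [biEval_apply, ← eval₂_evalRingHom]
  rfl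

end BiEval

theorem coeff_coeff_swap {R : Type*} [CommRing R] (p : R[X][X]) (i j : ℕ) :
    ((Bivariate.swap p).coeff i).coeff j = (p.coeff j).coeff i := by
  induction p using Polynomial.induction_on' with
  | add p q hp hq => simp only [map_add, coeff_add, hp, hq]
  | monomial a q =>
    induction q using Polynomial.induction_on' with
    | add p q hp hq => simp only [map_add, coeff_add, hp, hq]
    | monomial b r =>
      rw [Bivariate.swap_monomial_monomial]
      simp only [coeff_monomial]
      split_ifs <;> simp_all [coeff_monomial]

/-- A divisor of a nonzero bivariate polynomial has no larger degree in the inner variable. -/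
theorem natDegree_coeff_le_of_dvd {k : Type*} [Field k] {f h : k[X][X]} (hf : f ≠ 0) (hdvd : h ∣ f)
    (j : ℕ) : (h.coeff j).natDegree ≤ (Bivariate.swap f).natDegree := by
  obtain ⟨q, rfl⟩ := hdvd
  have hh : Bivariate.swap h ≠ 0 := by
    rw [Ne, EmbeddingLike.map_eq_zero_iff]
    exact left_ne_zero_of_mul hf
  have hq : Bivariate.swap q ≠ 0 := by
    rw [Ne, EmbeddingLike.map_eq_zero_iff]
    exact right_ne_zero_of_mul hf
  rw [map_mul, natDegree_mul hh hq]
  refine le_trans ?_ (Nat.le_add_right _ _)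
  refine natDegree_le_iff_coeff_eq_zero.2 fun i hi => ?_
  rw [← coeff_coeff_swap, coeff_eq_zero_of_natDegree_lt hi, coeff_zero]

section Box

variable {k : Type*} [CommRing k]

/-- The bivariate polynomial with given coefficients in a box. -/
noncomputable def boxPoly {m n : ℕ} (c : Fin m × Fin n → k) : k[X][X] :=
  ∑ ij, monomial (ij.2 : ℕ) (monomial (ij.1 : ℕ) (c ij))

theorem coeff_coeff_boxPoly {m n : ℕ} (c : Fin m × Fin n → k) (ij : Fin m × Fin n) :
    ((boxPoly c).coeff ij.2).coeff ij.1 = c ij := by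
  rw [boxPoly, finsetSum_coeff, finsetSum_coeff, Finset.sum_eq_single ij]
  · simp
  · intro b _ hb
    rw [coeff_monomial]
    split_ifs with h
    · rw [coeff_monomial, if_neg]
      intro h'
      exact hb (Prod.ext (Fin.ext h') (Fin.ext h))
    · simp
  · simp

theorem natDegree_boxPoly_lt {m n : ℕ} (c : Fin m × Fin n → k) (hn : 0 < n) :
    (boxPoly c).natDegree < n := by
  refine lt_of_le_of_lt (natDegree_sum_le_of_forall_le _ _ (n := n - 1) fun ij _ => ?_) (by omega)
  exact (natDegree_monomial_le _).trans (by have := ij.2.2; omega)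

theorem eq_boxPoly {m n : ℕ} (h : k[X][X]) (hn : h.natDegree < n)
    (hm : ∀ j, (h.coeff j).natDegree < m) :
    h = boxPoly fun ij : Fin m × Fin n => (h.coeff ij.2).coeff ij.1 := by
  rw [boxPoly, Fintype.sum_prod_type_right]
  nth_rewrite 1 [as_sum_range' h n hn]
  rw [Finset.sum_range]
  apply Finset.sum_congr rfl
  intro j _
  dsimp only
  rw [← map_sum]
  congr 1
  nth_rewrite 1 [as_sum_range' (h.coeff j) m (hm j)]
  rw [Finset.sum_range]

theorem biEval_boxPoly {D : Type*} [CommRing D] (ψ : k →+* D) (x y : D) {m n : ℕ}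
    (c : Fin m × Fin n → k) :
    biEval ψ x y (boxPoly c) = ∑ ij, ψ (c ij) * (x ^ (ij.1 : ℕ) * y ^ (ij.2 : ℕ)) := by
  rw [boxPoly, map_sum]
  apply Finset.sum_congr rfl
  intro ij _
  rw [biEval_apply, eval₂_monomial, coe_eval₂RingHom, eval₂_monomial, mul_assoc]

end Box

section Lift

variable {k D : Type*} [Field k] [CommRing D] [IsDomain D] [Algebra k D] {f : k[X][X]}
  {x y : D}

theorem exists_monic_dvd_iff (hf : f.Monic) (hx : Transcendental k x)
    (hy : biEval (algebraMap k D) x y f = 0) :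
    ∃ h : k[X][X], h.Monic ∧ biEval (algebraMap k D) x y h = 0 ∧
      ∀ g, biEval (algebraMap k D) x y g = 0 → h ∣ g := by
  let _ : Algebra k[X] D := (aeval x : k[X] →ₐ[k] D).toAlgebra
  have hinj : Function.Injective (algebraMap k[X] D) := transcendental_iff_injective.1 hx
  have : FaithfulSMul k[X] D := (faithfulSMul_iff_algebraMap_injective _ _).2 hinj
  have hint : IsIntegral k[X] y := ⟨f, hf, hy⟩
  exact ⟨minpoly k[X] y, minpoly.monic hint, minpoly.aeval k[X] y,
    fun g hg => minpoly.isIntegrallyClosed_dvd hint hg⟩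

theorem dvd_of_irreducible (hf : f.Monic) (hirr : Irreducible f) (hx : Transcendental k x)
    (hy : biEval (algebraMap k D) x y f = 0) (g : k[X][X])
    (hg : biEval (algebraMap k D) x y g = 0) : f ∣ g := by
  obtain ⟨h, -, hh0, hh⟩ := exists_monic_dvd_iff hf hx hy
  obtain ⟨q, hq⟩ := hh f hy
  rcases hirr.isUnit_or_isUnit hq with h1 | h1
  · exact absurd (h1.map (biEval (algebraMap k D) x y)) (by rw [hh0]; exact not_isUnit_zero)
  · have h2 := (associated_mul_unit_right h q h1).symm.dvd
    rw [← hq] at h2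
    exact h2.trans (hh g hg)

theorem dvd_of_box (hf : f.Monic) (hx : Transcendental k x)
    (hy : biEval (algebraMap k D) x y f = 0) {m n : ℕ} (hm : (Bivariate.swap f).natDegree < m)
    (hn : f.natDegree = n)
    (hbox : ∀ c : Fin m × Fin n → k, biEval (algebraMap k D) x y (boxPoly c) = 0 → c = 0)
    (g : k[X][X]) (hg : biEval (algebraMap k D) x y g = 0) : f ∣ g := by
  obtain ⟨h, hmon, hh0, hh⟩ := exists_monic_dvd_iff hf hx hy
  have hdvd := hh f hy
  suffices f = h by rw [this]; exact hh g hg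
  refine (eq_of_monic_of_dvd_of_natDegree_le hmon hf hdvd ?_)
  by_contra! hlt
  have h1 := eq_boxPoly h (hlt.trans_eq hn)
    fun j => (natDegree_coeff_le_of_dvd hf.ne_zero hdvd j).trans_lt hm
  have h2 := hbox _ (by rw [← h1]; exact hh0)
  apply hmon.ne_zero
  rw [h1, h2]
  simp [boxPoly]

end Lift

theorem transcendental_C_add_X {k : Type*} [Field k] (a : k) :
    Transcendental k (PowerSeries.C a + PowerSeries.X : PowerSeries k) := by
  rw [transcendental_iff_injective]
  have h : ∀ q : k[X], aeval (PowerSeries.C a + PowerSeries.X : PowerSeries k) q =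
      ((q.comp (C a + X) : k[X]) : PowerSeries k) := by
    intro q
    rw [comp_eq_aeval]
    have := aeval_algHom_apply (coeToPowerSeries.algHom k) (C a + X : k[X]) q
    simpa using this
  intro q r hqr
  rw [h, h] at hqr
  have h2 := coe_injective k hqr
  have h3 : ∀ q : k[X], (q.comp (C a + X)).comp (X - C a) = q := by
    intro q
    rw [comp_assoc]
    simp
  rw [← h3 q, h2, h3]

/-- Finitely many coefficient functionals invert a linearly independent family of power series. -/
theorem exists_coeff_inverse {k ι : Type*} [Field k] [Fintype ι] [DecidableEq ι]
    (v : ι → PowerSeries k)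
    (hv : LinearIndependent k v) :
    ∃ c : ι → ℕ →₀ k, ∀ i l, (c i).sum (fun j a => a * PowerSeries.coeff j (v l)) =
      if i = l then 1 else 0 := by
  let w : ℕ → Module.Dual k (ι → k) := fun j =>
    (PowerSeries.coeff (R := k) j).comp (Fintype.linearCombination k v)
  have htop : Submodule.span k (Set.range w) = ⊤ := by
    have h1 : (Submodule.span k (Set.range w)).dualCoannihilator = ⊥ := by
      rw [eq_bot_iff]
      intro x hx
      rw [Submodule.mem_dualCoannihilator] at hx
      have h2 : Fintype.linearCombination k v x = 0 := by
        ext j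
        exact hx (w j) (Submodule.subset_span ⟨j, rfl⟩)
      rw [Fintype.linearCombination_apply] at h2
      exact (Submodule.mem_bot k).2 (funext (Fintype.linearIndependent_iff.1 hv x h2))
    rw [← Subspace.dualCoannihilator_dualAnnihilator_eq (W := Submodule.span k (Set.range w)), h1,
      Submodule.dualAnnihilator_bot]
  have hmem : ∀ i, ∃ c : ℕ →₀ k, Finsupp.linearCombination k w c = LinearMap.proj i := by
    intro i
    have : LinearMap.proj i ∈ Submodule.span k (Set.range w) := by rw [htop]; trivial
    exact (Finsupp.mem_span_range_iff_exists_finsupp).1 this |> fun ⟨c, hc⟩ => ⟨c, hc⟩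
  choose c hc using hmem
  refine ⟨c, fun i l => ?_⟩
  have h := LinearMap.congr_fun (hc i) (Pi.single l 1)
  rw [Finsupp.linearCombination_apply, Finsupp.sum, LinearMap.sum_apply, LinearMap.proj_apply,
    Pi.single_apply] at h
  rw [← h, Finsupp.sum]
  apply Finset.sum_congr rfl
  intro j _
  simp [w, Fintype.linearCombination_apply_single]

/-- **Bertini–Noether**: an irreducible plane curve with a smooth rational point stays
irreducible, and parametrized by power series, under all specializations of the coefficients
which are defined at finitely many given elements. -/
theorem exists_finset_injective_series {k₀ : Type} [Field k₀] (A : Subring k₀) (F : A[X][X])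
    (hF : F.Monic) (hn : 0 < F.natDegree)
    (hirr : Irreducible (F.map (mapRingHom A.subtype))) (a₀ b₀ : A)
    (h₀ : biEval (RingHom.id A) a₀ b₀ F = 0)
    (h₁ : IsUnit (biEval (RingHom.id A) a₀ b₀ F.derivative)) :
    ∃ J : Finset k₀, ∀ {Ω : Type} [Field Ω] (B : Subring k₀) (hAB : A ≤ B), (∀ x ∈ J, x ∈ B) →
      ∀ φ : B →+* Ω, ∃ θ : AdjoinRoot (F.map (mapRingHom (φ.comp (Subring.inclusion hAB)))) →ₐ[Ω]
        PowerSeries Ω, Function.Injective θ := by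
  classical
  obtain ⟨y, hy, -⟩ := exists_root_powerSeries
    (F.map (eval₂RingHom PowerSeries.C (PowerSeries.C a₀ + PowerSeries.X))) (hF.map _) b₀
    (by
      have h := map_biEval PowerSeries.constantCoeff PowerSeries.C
        (PowerSeries.C a₀ + PowerSeries.X) (PowerSeries.C b₀) F
      rw [biEval_apply, ← eval_map] at h
      rw [h, ← h₀]
      congr 2
      simp)
    (by
      have h := map_biEval PowerSeries.constantCoeff PowerSeries.C
        (PowerSeries.C a₀ + PowerSeries.X) (PowerSeries.C b₀) F.derivative
      rw [biEval_apply, ← eval_map] at h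
      rw [derivative_map, h]
      convert h₁ using 3
      · simp
      · simp
      · exact PowerSeries.constantCoeff_C _)
  replace hy : biEval PowerSeries.C (PowerSeries.C a₀ + PowerSeries.X) y F = 0 := by
    rw [biEval_apply, ← eval_map]
    exact hy
  set n := F.natDegree with hn_def
  set m := (Bivariate.swap F).natDegree + 1 with hm_def
  let v : Fin m × Fin n → PowerSeries A := fun ij =>
    (PowerSeries.C a₀ + PowerSeries.X) ^ (ij.1 : ℕ) * y ^ (ij.2 : ℕ)
  have hspec : ∀ {k : Type} [Field k] (χ : A →+* k),
      biEval (algebraMap k (PowerSeries k)) (PowerSeries.C (χ a₀) + PowerSeries.X)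
        (PowerSeries.map χ y) (F.map (mapRingHom χ)) = 0 := by
    intro k _ χ
    rw [biEval_map]
    have h := map_biEval (PowerSeries.map χ) PowerSeries.C
      (PowerSeries.C a₀ + PowerSeries.X) y F
    rw [hy, map_zero] at h
    rw [h]
    congr 2
    · ext; simp
    · simp
  have hvmap : ∀ {k : Type} [Field k] (χ : A →+* k) (c : Fin m × Fin n → k),
      biEval (algebraMap k (PowerSeries k)) (PowerSeries.C (χ a₀) + PowerSeries.X)
        (PowerSeries.map χ y) (boxPoly c) = ∑ ij, c ij • PowerSeries.map χ (v ij) := by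
    intro k _ χ c
    rw [biEval_boxPoly]
    apply Finset.sum_congr rfl
    intro ij _
    rw [Algebra.smul_def]
    simp [v]
  have hli : LinearIndependent k₀ fun ij => PowerSeries.map A.subtype (v ij) := by
    rw [Fintype.linearIndependent_iff]
    intro c hc
    have h1 := dvd_of_irreducible (hF.map _) hirr (transcendental_C_add_X _) (hspec A.subtype)
      (boxPoly c) (by rw [hvmap, hc])
    have h2 : boxPoly c = 0 := by
      refine eq_zero_of_dvd_of_natDegree_lt h1 ?_
      rw [hF.natDegree_map]
      exact natDegree_boxPoly_lt c hn
    intro i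
    rw [← coeff_coeff_boxPoly c i, h2, coeff_zero, coeff_zero]
  obtain ⟨c, hc⟩ := exists_coeff_inverse _ hli
  refine ⟨Finset.univ.biUnion fun i => (c i).support.image (c i), ?_⟩
  intro Ω _ B hAB hJ φ
  have hcB : ∀ i j, c i j ∈ B := by
    intro i j
    by_cases h : c i j = 0
    · rw [h]; exact zero_mem _
    · exact hJ _ (Finset.mem_biUnion.2 ⟨i, Finset.mem_univ _,
        Finset.mem_image.2 ⟨j, Finsupp.mem_support_iff.2 h, rfl⟩⟩)
  set χ : A →+* Ω := φ.comp (Subring.inclusion hAB) with hχ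
  have hB : ∀ i l, ∑ j ∈ (c i).support,
      φ ⟨c i j, hcB i j⟩ * χ (PowerSeries.coeff j (v l)) = if i = l then 1 else 0 := by
    intro i l
    have h1 : ∑ j ∈ (c i).support, (⟨c i j, hcB i j⟩ : B) *
        Subring.inclusion hAB (PowerSeries.coeff j (v l)) = if i = l then 1 else 0 := by
      apply Subtype.ext
      have h2 := hc i l
      rw [Finsupp.sum] at h2
      push_cast
      refine (Eq.trans (Finset.sum_congr rfl fun j _ => ?_) h2).trans ?_
      · simp [Subring.inclusion]
      · split_ifs <;> rfl
    have h2 := congrArg φ h1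
    rw [map_sum] at h2
    simp only [map_mul] at h2
    rw [hχ]
    refine h2.trans ?_
    split_ifs <;> simp
  have hdvd := dvd_of_box (D := PowerSeries Ω) (hF.map (mapRingHom χ))
    (transcendental_C_add_X (χ a₀)) (hspec χ) (m := m) (n := n) (by
      refine Nat.lt_succ_of_le (natDegree_le_iff_coeff_eq_zero.2 fun i hi => ?_)
      ext j
      rw [coeff_coeff_swap, coeff_map, coe_mapRingHom, coeff_map, ← coeff_coeff_swap,
        coeff_eq_zero_of_natDegree_lt hi]
      simp) (hF.natDegree_map _) (by
      intro d hd
      rw [hvmap] at hd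
      funext i
      have h1 : ∀ j, ∑ l, d l * χ (PowerSeries.coeff j (v l)) = 0 := by
        intro j
        have := congrArg (PowerSeries.coeff j) hd
        rw [map_sum, map_zero] at this
        rw [← this]
        apply Finset.sum_congr rfl
        intro l _
        simp
      have h2 : ∑ j ∈ (c i).support, φ ⟨c i j, hcB i j⟩ *
          ∑ l, d l * χ (PowerSeries.coeff j (v l)) = d i := by
        simp only [Finset.mul_sum]
        rw [Finset.sum_comm]
        have h3 : ∀ l, ∑ j ∈ (c i).support, φ ⟨c i j, hcB i j⟩ *
            (d l * χ (PowerSeries.coeff j (v l))) = d l * if i = l then 1 else 0 := by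
          intro l
          rw [← hB i l, Finset.mul_sum]
          apply Finset.sum_congr rfl
          intro j _
          ring
        simp only [h3]
        simp
      rw [← h2]
      simp [h1])
  let ι : Polynomial Ω →ₐ[Ω] PowerSeries Ω := aeval (PowerSeries.C (χ a₀) + PowerSeries.X)
  refine ⟨AdjoinRoot.liftAlgHom _ ι (PowerSeries.map χ y) (hspec χ), ?_⟩
  rw [injective_iff_map_eq_zero]
  intro g hg
  obtain ⟨g, rfl⟩ := AdjoinRoot.mk_surjective g
  exact AdjoinRoot.mk_eq_zero.2 (hdvd g hg)

end ChebotarevFG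

namespace ChebotarevFG
open Module Polynomial

theorem card_frobenius_fixed {Ω : Type*} [Field Ω] [IsAlgClosed Ω] (p : ℕ) [hp : Fact p.Prime]
    [CharP Ω p] {e : ℕ} (he : e ≠ 0) :
    ∃ Z : Finset Ω, Z.card = p ^ e ∧ ∀ a, a ∈ Z ↔ a ^ p ^ e = a := by
  classical
  have h1 : 1 < p ^ e := Nat.one_lt_pow he hp.out.one_lt
  have hne : (X ^ p ^ e - X : Polynomial Ω) ≠ 0 := FiniteField.X_pow_card_sub_X_ne_zero Ω h1
  have hsep : (X ^ p ^ e - X : Polynomial Ω).Separable :=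
    galois_poly_separable p _ (dvd_pow_self p he)
  refine ⟨(X ^ p ^ e - X : Polynomial Ω).roots.toFinset, ?_, fun a => ?_⟩
  · rw [Multiset.toFinset_card_of_nodup (nodup_roots hsep)]
    refine Eq.trans ?_ (FiniteField.X_pow_card_sub_X_natDegree_eq Ω h1)
    exact (IsAlgClosed.splits (X ^ p ^ e - X : Polynomial Ω)).natDegree_eq_card_roots.symm
  · rw [Multiset.mem_toFinset, mem_roots hne, IsRoot.def, eval_sub, eval_pow, eval_X, sub_eq_zero]

theorem card_nonexact_le {Ω : Type*} [Field Ω] [IsAlgClosed Ω] (p : ℕ) [hp : Fact p.Prime]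
    [CharP Ω p] (h : ℕ) (Z : Finset Ω) (hZ : ∀ a ∈ Z, ∃ j, 0 < j ∧ j ≤ h ∧ a ^ p ^ j = a) :
    Z.card ≤ p ^ (h + 1) := by
  classical
  have key : ∀ j : ℕ, ∃ W : Finset Ω, W.card ≤ p ^ j ∧ (0 < j → ∀ a, a ^ p ^ j = a → a ∈ W) := by
    intro j
    rcases Nat.eq_zero_or_pos j with rfl | hj
    · exact ⟨∅, by simp, by simp⟩
    · obtain ⟨W, hW, hW'⟩ := card_frobenius_fixed (Ω := Ω) p hj.ne'
      exact ⟨W, hW.le, fun _ a ha => (hW' a).2 ha⟩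
  choose W hW hW' using key
  have hsub : Z ⊆ (Finset.range (h + 1)).biUnion W := by
    intro a ha
    obtain ⟨j, hj, hjh, hja⟩ := hZ a ha
    exact Finset.mem_biUnion.2 ⟨j, Finset.mem_range.2 (by omega), hW' j hj a hja⟩
  calc Z.card ≤ _ := Finset.card_le_card hsub
    _ ≤ ∑ j ∈ Finset.range (h + 1), (W j).card := Finset.card_biUnion_le
    _ ≤ ∑ j ∈ Finset.range (h + 1), p ^ j := Finset.sum_le_sum fun j _ => hW j
    _ ≤ p ^ (h + 1) := (Nat.geomSum_lt hp.out.two_le (by simp)).le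

theorem exists_twisted_point {Ω : Type*} [Field Ω] [IsAlgClosed Ω] (p : ℕ) [hp : Fact p.Prime]
    [CharP Ω p] {f : Polynomial (Polynomial Ω)} (hf : f.Monic) (hn : 0 < f.natDegree)
    (θ : AdjoinRoot f →ₐ[Ω] PowerSeries Ω) (hθ : Function.Injective θ) {d : Polynomial Ω}
    (hd : d ≠ 0) {α β : Polynomial (Polynomial Ω)} (hαβ : α * f + β * f.derivative = C d)
    {ι : Type*} [Fintype ι] (hι : Fintype.card ι = f.natDegree)
    (s : ι → Polynomial (Polynomial Ω)) (i₀ : ι) :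
    ∃ E : ℕ, ∀ e ≥ E, ∃ a b, a ^ p ^ e = a ∧ (∀ j, 0 < j → 2 * j ≤ e → a ^ p ^ j ≠ a) ∧
      d.eval a ≠ 0 ∧ f.evalEval a b = 0 ∧
        ∀ i, d.eval a * b ^ p ^ e = (s i).evalEval a b → i = i₀ := by
  classical
  choose A B hAB using fun i => card_twisted_points_le p hf hn θ hθ d (s i)
  set n := f.natDegree with hn_def
  set c := n ^ 2 * (d.natDegree + p) + n * (∑ i, B i) + 1 with hc
  refine ⟨∑ i, A i + 2 * c + 2, fun e he => ?_⟩
  by_contra! hcon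
  set h := e / 2 with hh
  have hp1 := hp.out.one_lt
  obtain ⟨Z, hZc, hZ⟩ := card_frobenius_fixed (Ω := Ω) p (e := e) (by omega)
  set Z₁ := Z.filter fun a => ∃ j, 0 < j ∧ j ≤ h ∧ a ^ p ^ j = a with hZ₁
  set Z₂ := Z.filter fun a => d.eval a = 0 with hZ₂
  set W := (Z \ Z₁) \ Z₂ with hW
  have hZ₁c : Z₁.card ≤ p ^ (h + 1) :=
    card_nonexact_le p h Z₁ fun a ha => (Finset.mem_filter.1 ha).2
  have hZ₂c : Z₂.card ≤ d.natDegree := by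
    refine le_trans (Finset.card_le_card (t := d.roots.toFinset) fun a ha => ?_)
      ((Multiset.toFinset_card_le _).trans (card_roots' d))
    rw [Multiset.mem_toFinset, mem_roots hd]
    exact (Finset.mem_filter.1 ha).2
  have hWc : p ^ e ≤ W.card + p ^ (h + 1) + d.natDegree := by
    have h1 := Finset.le_card_sdiff Z₁ Z
    have h2 := Finset.le_card_sdiff Z₂ (Z \ Z₁)
    rw [← hW] at h2
    omega
  have hWmem : ∀ a ∈ W, a ^ p ^ e = a ∧ (∀ j, 0 < j → 2 * j ≤ e → a ^ p ^ j ≠ a) ∧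
      d.eval a ≠ 0 := by
    intro a ha
    simp only [hW, hZ₁, hZ₂, Finset.mem_sdiff, Finset.mem_filter, not_and, not_exists] at ha
    obtain ⟨⟨haZ, h1⟩, h2⟩ := ha
    exact ⟨(hZ a).1 haZ, fun j hj hje => h1 haZ j hj (by omega), h2 haZ⟩
  let fib : Ω → Polynomial Ω := fun a => f.map (evalRingHom a)
  have hfib : ∀ a b, (fib a).eval b = f.evalEval a b := fun a b => by
    rw [eval_map, eval₂_evalRingHom]
  have hfibc : ∀ a ∈ W, (fib a).roots.toFinset.card = n := by
    intro a ha
    have hsep : (fib a).Separable := by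
      have h1 := congrArg (Polynomial.map (evalRingHom a)) hαβ
      rw [Polynomial.map_add, Polynomial.map_mul, Polynomial.map_mul, ← derivative_map, map_C,
        coe_evalRingHom] at h1
      refine ⟨C (d.eval a)⁻¹ * α.map (evalRingHom a), C (d.eval a)⁻¹ * β.map (evalRingHom a), ?_⟩
      rw [mul_assoc, mul_assoc, ← mul_add, h1, ← C_mul, inv_mul_cancel₀ (hWmem a ha).2.2, C_1]
    rw [Multiset.toFinset_card_of_nodup (nodup_roots hsep),
      ← (IsAlgClosed.splits (fib a)).natDegree_eq_card_roots, hf.natDegree_map]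
  let S : Finset (Ω × Ω) := W.biUnion fun a => (fib a).roots.toFinset.image fun b => (a, b)
  have hS : ∀ x ∈ S, x.1 ∈ W ∧ f.evalEval x.1 x.2 = 0 := by
    intro x hx
    obtain ⟨a, ha, hx⟩ := Finset.mem_biUnion.1 hx
    obtain ⟨b, hb, rfl⟩ := Finset.mem_image.1 hx
    refine ⟨ha, ?_⟩
    rw [← hfib]
    exact (mem_roots'.1 (Multiset.mem_toFinset.1 hb)).2
  have hSc : S.card = W.card * n := by
    rw [Finset.card_biUnion]
    · rw [Finset.sum_congr rfl fun a ha => ?_, Finset.sum_const, smul_eq_mul]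
      rw [Finset.card_image_of_injective _ (Prod.mk_right_injective a), hfibc a ha]
    · intro a _ a' _ haa'
      rw [Function.onFun, Finset.disjoint_left]
      intro x hx hx'
      obtain ⟨b, -, rfl⟩ := Finset.mem_image.1 hx
      obtain ⟨b', -, h⟩ := Finset.mem_image.1 hx'
      exact haa' (Prod.ext_iff.1 h).1.symm
  let T : ι → Finset (Ω × Ω) := fun i =>
    S.filter fun x => d.eval x.1 * x.2 ^ p ^ e = (s i).evalEval x.1 x.2
  have hT : ∀ i, n * (T i).card ≤ (n + 1) * p ^ e + B i := by
    intro i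
    refine hAB i e ?_ (T i) fun x hx => ?_
    · have := Finset.single_le_sum (f := A) (fun _ _ => Nat.zero_le _) (Finset.mem_univ i)
      omega
    · obtain ⟨hx, hx'⟩ := Finset.mem_filter.1 hx
      have h1 := hWmem _ (hS x hx).1
      exact ⟨h1.1, (hS x hx).2, h1.2.2, hx'⟩
  have hST : S.card ≤ ∑ i ∈ Finset.univ.erase i₀, (T i).card := by
    have h1 : S ⊆ (Finset.univ.erase i₀).biUnion T := by
      intro x hx
      have h1 := hWmem _ (hS x hx).1
      obtain ⟨i, hi, hi₀⟩ := hcon x.1 x.2 h1.1 h1.2.1 h1.2.2 (hS x hx).2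
      exact Finset.mem_biUnion.2
        ⟨i, Finset.mem_erase.2 ⟨hi₀, Finset.mem_univ _⟩, Finset.mem_filter.2 ⟨hx, hi⟩⟩
    exact (Finset.card_le_card h1).trans Finset.card_biUnion_le
  have hfin : n * S.card ≤ (n - 1) * ((n + 1) * p ^ e) + ∑ i, B i := by
    calc n * S.card ≤ n * ∑ i ∈ Finset.univ.erase i₀, (T i).card := Nat.mul_le_mul_left _ hST
      _ = ∑ i ∈ Finset.univ.erase i₀, n * (T i).card := Finset.mul_sum _ _ _
      _ ≤ ∑ i ∈ Finset.univ.erase i₀, ((n + 1) * p ^ e + B i) :=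
        Finset.sum_le_sum fun i _ => hT i
      _ = (n - 1) * ((n + 1) * p ^ e) + ∑ i ∈ Finset.univ.erase i₀, B i := by
        rw [Finset.sum_add_distrib, Finset.sum_const, smul_eq_mul,
          Finset.card_erase_of_mem (Finset.mem_univ _), Finset.card_univ, hι]
      _ ≤ _ := Nat.add_le_add_left (Finset.sum_le_sum_of_subset (Finset.subset_univ _)) _
  rw [hSc] at hfin
  have hQ : p ^ h * p ^ h ≤ p ^ e := by
    rw [← pow_add]
    exact Nat.pow_le_pow_right hp1.le (by omega)
  have hch : c ≤ p ^ h := (show c ≤ h by omega).trans (Nat.lt_pow_self hp1).le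
  have hQ' : p ^ h * c ≤ p ^ e := (Nat.mul_le_mul_left _ hch).trans hQ
  have h1h : 1 ≤ p ^ h := Nat.one_le_pow _ _ hp.out.pos
  rw [pow_succ] at hWc
  generalize p ^ h = P at *
  generalize p ^ e = Q at *
  generalize ∑ i, B i = b at *
  generalize d.natDegree = δ at *
  generalize W.card = w at *
  obtain ⟨m, hm⟩ : ∃ m, n = m + 1 := ⟨n - 1, by omega⟩
  rw [hm] at hfin hc
  rw [hc] at hQ'
  simp only [Nat.add_sub_cancel] at hfin
  have h2 : (m + 1) ^ 2 * Q ≤ (m + 1) ^ 2 * (w + P * p + δ) := Nat.mul_le_mul_left _ hWc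
  have h3 : (m + 1) * b ≤ P * ((m + 1) * b) := Nat.le_mul_of_pos_left _ h1h
  have h4 : (m + 1) ^ 2 * δ ≤ P * ((m + 1) ^ 2 * δ) := Nat.le_mul_of_pos_left _ h1h
  nlinarith [Nat.zero_le (m * b)]

end ChebotarevFG

namespace ChebotarevFG
open Module Polynomial

/-- The field of Laurent series over `Ω`, as the fraction field of the ring of power series. -/
abbrev SeriesField (Ω : Type) [Field Ω] : Type := FractionRing (PowerSeries Ω)

section Frobenius

variable (Ω : Type) [Field Ω] (p : ℕ) [hp : Fact p.Prime] [CharP Ω p]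

/-- The `p ^ e`-Frobenius acting on the coefficients of power series. -/
noncomputable def frobSeries (e : ℕ) : PowerSeries Ω →+* PowerSeries Ω :=
  PowerSeries.map (iterateFrobenius Ω p e)

theorem coeff_frobSeries (e n : ℕ) (x : PowerSeries Ω) :
    PowerSeries.coeff n (frobSeries Ω p e x) = PowerSeries.coeff n x ^ p ^ e := by
  rw [frobSeries, PowerSeries.coeff_map, iterateFrobenius_def]

theorem constantCoeff_frobSeries (e : ℕ) (x : PowerSeries Ω) :
    PowerSeries.constantCoeff (frobSeries Ω p e x) = PowerSeries.constantCoeff x ^ p ^ e := by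
  simpa using coeff_frobSeries Ω p e 0 x

theorem frobSeries_injective (e : ℕ) : Function.Injective (frobSeries Ω p e) :=
  PowerSeries.map_injective _ (iterateFrobenius Ω p e).injective

theorem frobSeries_add (e e' : ℕ) (x : PowerSeries Ω) :
    frobSeries Ω p (e + e') x = frobSeries Ω p e (frobSeries Ω p e' x) := by
  ext n
  simp only [coeff_frobSeries]
  rw [← pow_mul, ← pow_add, add_comm]

/-- The `p ^ e`-Frobenius acting on the coefficients of Laurent series. -/
noncomputable def frobField (e : ℕ) : SeriesField Ω →+* SeriesField Ω :=
  IsFractionRing.map (frobSeries_injective Ω p e)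

@[simp] theorem frobField_algebraMap (e : ℕ) (x : PowerSeries Ω) :
    frobField Ω p e (algebraMap _ (SeriesField Ω) x) =
      algebraMap _ (SeriesField Ω) (frobSeries Ω p e x) := by
  rw [frobField, IsFractionRing.map, IsLocalization.map_eq]

theorem frobField_add (e e' : ℕ) (x : SeriesField Ω) :
    frobField Ω p (e + e') x = frobField Ω p e (frobField Ω p e' x) := by
  have : frobField Ω p (e + e') = (frobField Ω p e).comp (frobField Ω p e') :=
    IsFractionRing.ringHom_ext (A := PowerSeries Ω) fun x => by simp [frobSeries_add]
  rw [this, RingHom.comp_apply]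

theorem map_iterate_eq_frobField {k : Type*} [Semiring k] (τ : k → k) (Ψ : k →+* SeriesField Ω)
    (e : ℕ) (h : ∀ x, Ψ (τ x) = frobField Ω p e (Ψ x)) (m : ℕ) (x : k) :
    Ψ (τ^[m + 1] x) = frobField Ω p (e * (m + 1)) (Ψ x) := by
  induction m generalizing x with
  | zero => simp [h]
  | succ m ih =>
    rw [Function.iterate_succ_apply', h, ih, mul_add e (m + 1), mul_one, add_comm _ e,
      frobField_add]

end Frobenius

theorem exists_transcendental_series {Ω : Type} [Field Ω] {k : Type} [Field k] [Countable k]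
    (Ψ : k →+* SeriesField Ω) (a : Ω) :
    ∃ u : PowerSeries Ω, PowerSeries.constantCoeff u = a ∧ PowerSeries.coeff 1 u = 1 ∧
      (∀ n, n ≠ 0 → PowerSeries.coeff n u = 0 ∨ PowerSeries.coeff n u = 1) ∧
      ∀ q : k[X], q.eval₂ Ψ (algebraMap _ _ u) = 0 → q = 0 := by
  classical
  let _ : Algebra k (SeriesField Ω) := Ψ.toAlgebra
  let c : Set ℕ → PowerSeries Ω := fun S => PowerSeries.mk fun n =>
    if n = 0 then a else if n = 1 then 1 else if n ∈ S then 1 else 0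
  let g : Set ℕ → SeriesField Ω := fun S => algebraMap _ _ (c ((fun n => n + 2) '' S))
  have hg : Function.Injective g := by
    intro S T hST
    have h1 := IsFractionRing.injective (PowerSeries Ω) (SeriesField Ω) hST
    ext n
    have h2 := congrArg (PowerSeries.coeff (n + 2)) h1
    simp only [c, PowerSeries.coeff_mk] at h2
    by_cases hS : n ∈ S <;> by_cases hT : n ∈ T <;> simp_all
  have hunc : ∃ S, g S ∉ {x | IsAlgebraic k x} := by
    by_contra! hcon
    have h1 : (g ⁻¹' {x | IsAlgebraic k x}).Countable :=
      (Algebraic.countable k (SeriesField Ω)).preimage hg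
    rw [show g ⁻¹' {x | IsAlgebraic k x} = Set.univ from Set.eq_univ_of_forall hcon,
      Set.countable_univ_iff] at h1
    obtain ⟨f, hf⟩ := exists_surjective_nat (Set ℕ)
    exact Function.cantor_surjective f hf
  obtain ⟨S, hS⟩ := hunc
  refine ⟨c ((fun n => n + 2) '' S), ?_, ?_, ?_, ?_⟩
  · rw [← PowerSeries.coeff_zero_eq_constantCoeff_apply]; simp [c]
  · simp [c]
  · intro n hn
    simp only [c, PowerSeries.coeff_mk, if_neg hn]
    split_ifs <;> simp
  · intro q hq
    exact transcendental_iff.1 hS q hq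

theorem mem_lifts_subring {k : Type*} [CommRing k] (A : Subring k) (q : k[X])
    (h : ∀ x ∈ q.coeffs, x ∈ A) : q ∈ lifts A.subtype := by
  rw [lifts_iff_coeff_lifts]
  intro n
  by_cases hn : q.coeff n = 0
  · exact ⟨0, by simp [hn]⟩
  · exact ⟨⟨q.coeff n, h _ (coeff_mem_coeffs hn)⟩, rfl⟩

/-- The finite set of coefficients of a bivariate polynomial. -/
noncomputable def biCoeffs {k : Type*} [CommRing k] [DecidableEq k] (q : k[X][X]) : Finset k :=
  q.support.biUnion fun i => (q.coeff i).coeffs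

theorem mem_lifts_biCoeffs {k : Type*} [CommRing k] [DecidableEq k] (A : Subring k) (q : k[X][X])
    (h : ∀ x ∈ biCoeffs q, x ∈ A) : q ∈ lifts (mapRingHom A.subtype) := by
  rw [lifts_iff_coeff_lifts]
  intro n
  by_cases hn : q.coeff n = 0
  · exact ⟨0, by simp [hn]⟩
  · obtain ⟨r, hr⟩ := (mem_lifts _).1 (mem_lifts_subring A (q.coeff n) fun x hx =>
      h x (Finset.mem_biUnion.2 ⟨n, mem_support_iff.2 hn, hx⟩))
    exact ⟨r, hr⟩

theorem exists_series_restriction {Ω : Type} [Field Ω] {k : Type*} [Field k]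
    (Ψ : k →+* SeriesField Ω) : ∃ (B : Subring k) (Ψ' : B →+* PowerSeries Ω),
      (∀ x, Ψ x ∈ (algebraMap (PowerSeries Ω) (SeriesField Ω)).range → x ∈ B) ∧
      ∀ x : B, algebraMap _ (SeriesField Ω) (Ψ' x) = Ψ x := by
  set ι := algebraMap (PowerSeries Ω) (SeriesField Ω)
  have hι : Function.Injective ι := IsFractionRing.injective _ _
  let ε : PowerSeries Ω ≃+* ι.range := RingEquiv.ofBijective ι.rangeRestrict
    ⟨fun x y h => hι (congrArg Subtype.val h), ι.rangeRestrict_surjective⟩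
  refine ⟨ι.range.comap Ψ, ε.symm.toRingHom.comp
    ((Ψ.comp (ι.range.comap Ψ).subtype).codRestrict ι.range fun x => x.2), fun x hx => hx, ?_⟩
  intro x
  have := ε.apply_symm_apply
    (((Ψ.comp (ι.range.comap Ψ).subtype).codRestrict ι.range fun x => x.2) x)
  exact congrArg Subtype.val this

/-- **Chebotarev for a family of curves**: given an irreducible curve `F(u, y) = 0` over `k₀`, a
specialization of `k₀` compatible with `τ` extends to the function field of the curve in such a
way that the Frobenius of `y` is given by a prescribed root of the twist of `F` by `τ`. -/
theorem exists_curve_specialization {Ω : Type} [Field Ω] [IsAlgClosed Ω] (p : ℕ)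
    [hp : Fact p.Prime] [CharP Ω p] {k₀ : Type} [Field k₀] [Countable k₀] {F : k₀[X][X]}
    (hF : F.Monic) (hn : 0 < F.natDegree) (hirr : Irreducible F) (τ : k₀ →+* k₀) {r : ℕ}
    (hr : 0 < r) (hτ : ∀ x, τ^[r] x = x) {d : k₀[X]} (hd : d ≠ 0) {α β : k₀[X][X]}
    (hαβ : α * F + β * F.derivative = C d) {a₀ b₀ : k₀}
    (h₀ : F.evalEval a₀ b₀ = 0) (h₁ : F.derivative.evalEval a₀ b₀ ≠ 0)
    {ι : Type} [Fintype ι] (hι : Fintype.card ι = F.natDegree) (s : ι → k₀[X][X])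
    (hs : ∀ {D : Type} [CommRing D] [IsDomain D] (ψ : k₀ →+* D) (x y z : D), biEval ψ x y F = 0 →
      biEval (ψ.comp τ) x z F = 0 → ∃ i, d.eval₂ ψ x * z = biEval ψ x y (s i)) (i₀ : ι) :
    ∃ Y : Finset k₀, ∀ (Ψ : k₀ →+* SeriesField Ω) (e₀ : ℕ), 0 < e₀ →
      (∀ x, Ψ (τ x) = frobField Ω p e₀ (Ψ x)) →
      (∀ x ∈ Y, Ψ x ∈ (algebraMap (PowerSeries Ω) (SeriesField Ω)).range) →
      ∃ (e : ℕ) (u y : PowerSeries Ω), 0 < e ∧ (∀ x, Ψ (τ x) = frobField Ω p e (Ψ x)) ∧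
        (∀ q : k₀[X], q.eval₂ Ψ (algebraMap _ _ u) = 0 → q = 0) ∧
        biEval Ψ (algebraMap _ _ u) (algebraMap _ _ y) F = 0 ∧
        frobSeries Ω p e u = u ∧ PowerSeries.coeff 1 u = 1 ∧
        (∀ j, 0 < j → 2 * j ≤ e →
          PowerSeries.constantCoeff u ^ p ^ j ≠ PowerSeries.constantCoeff u) ∧
        (∃ z : PowerSeries Ω, algebraMap _ _ z * d.eval₂ Ψ (algebraMap _ _ u) = 1) ∧
        d.eval₂ Ψ (algebraMap _ _ u) * algebraMap _ _ (frobSeries Ω p e y) =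
          biEval Ψ (algebraMap _ _ u) (algebraMap _ _ y) (s i₀) := by
  classical
  set G : Finset k₀ := biCoeffs F ∪ biCoeffs α ∪ biCoeffs β ∪ d.coeffs ∪
    {a₀, b₀, (F.derivative.evalEval a₀ b₀)⁻¹, d.leadingCoeff⁻¹} ∪
    Finset.univ.biUnion fun i => biCoeffs (s i) with hG
  set A : Subring k₀ := Subring.closure (G : Set k₀) with hA
  have hGA : ∀ x ∈ G, x ∈ A := fun x hx => Subring.subset_closure (Finset.mem_coe.2 hx)
  have hinj₁ : Function.Injective (mapRingHom A.subtype) :=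
    Polynomial.map_injective _ Subtype.val_injective
  have hinj₂ : Function.Injective (mapRingHom (mapRingHom A.subtype)) :=
    Polynomial.map_injective _ hinj₁
  obtain ⟨F', hF', hF'd, hF'm⟩ := lifts_and_natDegree_eq_and_monic
    (mem_lifts_biCoeffs A F fun x hx => hGA x (by simp [hG, hx])) hF
  obtain ⟨α', hα'⟩ := (mem_lifts _).1
    (mem_lifts_biCoeffs A α fun x hx => hGA x (by simp [hG, hx]))
  obtain ⟨β', hβ'⟩ := (mem_lifts _).1
    (mem_lifts_biCoeffs A β fun x hx => hGA x (by simp [hG, hx]))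
  obtain ⟨d', hd'⟩ := (mem_lifts _).1
    (mem_lifts_subring A d fun x hx => hGA x (by simp [hG, hx]))
  have hs' : ∀ i, ∃ s' : A[X][X], s'.map (mapRingHom A.subtype) = s i := fun i => (mem_lifts _).1
    (mem_lifts_biCoeffs A (s i) fun x hx => hGA x (by
      simp only [hG, Finset.mem_union, Finset.mem_biUnion]
      exact Or.inr ⟨i, Finset.mem_univ _, hx⟩))
  choose s' hs' using hs'
  obtain ⟨a₁, ha₁⟩ : ∃ a₁ : A, (a₁ : k₀) = a₀ := ⟨⟨a₀, hGA _ (by simp [hG])⟩, rfl⟩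
  obtain ⟨b₁, hb₁⟩ : ∃ b₁ : A, (b₁ : k₀) = b₀ := ⟨⟨b₀, hGA _ (by simp [hG])⟩, rfl⟩
  obtain ⟨c₁, hc₁⟩ : ∃ c₁ : A, (c₁ : k₀) = (F.derivative.evalEval a₀ b₀)⁻¹ :=
    ⟨⟨_, hGA _ (by simp [hG])⟩, rfl⟩
  obtain ⟨l₁, hl₁⟩ : ∃ l₁ : A, (l₁ : k₀) = d.leadingCoeff⁻¹ := ⟨⟨_, hGA _ (by simp [hG])⟩, rfl⟩
  have hαβ' : α' * F' + β' * F'.derivative = C d' := by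
    apply hinj₂
    rw [map_add, map_mul, map_mul]
    simp only [coe_mapRingHom, ← derivative_map]
    rw [hα', hβ', hF', hαβ, map_C, coe_mapRingHom, hd']
  have hev : ∀ q : A[X][X], ((biEval (RingHom.id A) a₁ b₁ q : A) : k₀) =
      (q.map (mapRingHom A.subtype)).evalEval a₀ b₀ := by
    intro q
    rw [← biEval_id, biEval_map, ← ha₁, ← hb₁]
    exact map_biEval A.subtype _ _ _ q
  have h₀' : biEval (RingHom.id A) a₁ b₁ F' = 0 := Subtype.ext (by rw [hev, hF', h₀]; rfl)
  have h₁' : IsUnit (biEval (RingHom.id A) a₁ b₁ F'.derivative) := by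
    refine IsUnit.of_mul_eq_one c₁ (Subtype.ext ?_)
    rw [Subring.coe_mul, hev, hc₁, ← derivative_map, hF', mul_inv_cancel₀ h₁]
    rfl
  have hlead : d'.coeff d.natDegree * l₁ = 1 := by
    refine Subtype.ext ?_
    rw [Subring.coe_mul, hl₁]
    have : ((d'.coeff d.natDegree : A) : k₀) = d.leadingCoeff := by
      rw [leadingCoeff, ← hd', coeff_map, hd']
      rfl
    rw [this, mul_inv_cancel₀ (leadingCoeff_ne_zero.2 hd)]
    rfl
  obtain ⟨J, hJ⟩ := exists_finset_injective_series A F' hF'm (hF'd ▸ hn)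
    (by rwa [hF']) a₁ b₁ h₀' h₁'
  refine ⟨G ∪ J, fun Ψ e₀ he₀ hΨ hY => ?_⟩
  obtain ⟨B, Ψ', hB, hΨ'⟩ := exists_series_restriction Ψ
  have hAB : A ≤ B := Subring.closure_le.2 fun x hx =>
    hB x (hY x (Finset.mem_union_left _ hx))
  set ρ : A →+* PowerSeries Ω := Ψ'.comp (Subring.inclusion hAB) with hρ
  have hρΨ : (algebraMap _ (SeriesField Ω)).comp ρ = Ψ.comp A.subtype := by
    ext x
    exact hΨ' _
  set χ : A →+* Ω := (PowerSeries.constantCoeff.comp Ψ').comp (Subring.inclusion hAB) with hχ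
  have hχρ : PowerSeries.constantCoeff.comp ρ = χ := rfl
  set f := F'.map (mapRingHom χ) with hf
  obtain ⟨θ, hθ⟩ : ∃ θ : AdjoinRoot f →ₐ[Ω] PowerSeries Ω, Function.Injective θ :=
    hJ B hAB (fun x hx => hB x (hY x (Finset.mem_union_right _ hx)))
      (PowerSeries.constantCoeff.comp Ψ')
  have hfd : f.natDegree = F.natDegree := by rw [hf, hF'm.natDegree_map, hF'd]
  have hαβf : α'.map (mapRingHom χ) * f + β'.map (mapRingHom χ) * f.derivative =
      C (d'.map χ) := by
    have := congrArg (Polynomial.map (mapRingHom χ)) hαβ'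
    rwa [Polynomial.map_add, Polynomial.map_mul, Polynomial.map_mul, ← derivative_map, map_C,
      coe_mapRingHom] at this
  have hdf : d'.map χ ≠ 0 := by
    intro h
    have h2 := congrArg χ hlead
    rw [map_mul, ← coeff_map, h, coeff_zero, zero_mul, map_one] at h2
    exact zero_ne_one h2
  obtain ⟨E, hE⟩ := exists_twisted_point p (hF'm.map (mapRingHom χ)) (hfd ▸ hn) θ hθ hdf hαβf
    (hι.trans hfd.symm) (fun i => (s' i).map (mapRingHom χ)) i₀
  obtain ⟨a, b, haQ, hex, hda, hab, hi₀⟩ := hE (e₀ * (r * E + 1))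
    ((Nat.le_mul_of_pos_left E hr).trans
      ((Nat.le_succ _).trans (Nat.le_mul_of_pos_left _ he₀)))
  set e := e₀ * (r * E + 1) with he
  have hepos : 0 < e := Nat.mul_pos he₀ (Nat.succ_pos _)
  have hτe : ∀ x, Ψ (τ x) = frobField Ω p e (Ψ x) := by
    intro x
    rw [he, ← map_iterate_eq_frobField Ω p τ Ψ e₀ hΨ, Function.iterate_succ_apply']
    congr 2
    rw [Function.iterate_mul]
    exact (Function.iterate_fixed (hτ x) E).symm
  obtain ⟨u, hua, hu1, hu01, hutr⟩ := exists_transcendental_series Ψ a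
  have hfrobu : frobSeries Ω p e u = u := by
    ext n
    rw [coeff_frobSeries]
    rcases eq_or_ne n 0 with rfl | hn
    · rw [PowerSeries.coeff_zero_eq_constantCoeff_apply, hua, haQ]
    · rcases hu01 n hn with h | h <;> simp [h, hp.out.ne_zero]
  have hbar : ∀ (y : PowerSeries Ω) (q : A[X][X]), PowerSeries.constantCoeff (biEval ρ u y q) =
      (q.map (mapRingHom χ)).evalEval a (PowerSeries.constantCoeff y) := by
    intro y q
    rw [map_biEval, hχρ, hua, ← biEval_id, biEval_map]
    rfl
  obtain ⟨y, hy, hyb⟩ := exists_root_powerSeries (F'.map (eval₂RingHom ρ u)) (hF'm.map _) b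
    (by
      rw [eval_map, ← biEval_apply, hbar, PowerSeries.constantCoeff_C]
      exact hab)
    (by
      rw [derivative_map, eval_map, ← biEval_apply, hbar, PowerSeries.constantCoeff_C,
        ← derivative_map, ← hf, isUnit_iff_ne_zero]
      intro h
      have h2 := congrArg (evalEval a b) hαβf
      rw [evalEval_add, evalEval_mul, evalEval_mul, hab, h, evalEval_C] at h2
      apply hda
      rw [← h2]
      ring)
  rw [eval_map, ← biEval_apply] at hy
  have hlift : ∀ q : A[X][X], algebraMap _ (SeriesField Ω) (biEval ρ u y q) =
      biEval Ψ (algebraMap _ _ u) (algebraMap _ _ y) (q.map (mapRingHom A.subtype)) := by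
    intro q
    rw [map_biEval, biEval_map, hρΨ]
  have hliftd : algebraMap _ (SeriesField Ω) (d'.eval₂ ρ u) = d.eval₂ Ψ (algebraMap _ _ u) := by
    have := hlift (C d')
    rwa [map_C, coe_mapRingHom, hd', biEval_C, biEval_C] at this
  have hyF : biEval Ψ (algebraMap _ (SeriesField Ω) u) (algebraMap _ _ y) F = 0 := by
    rw [← hF', ← hlift, hy, map_zero]
  obtain ⟨i, hi⟩ := hs Ψ (algebraMap _ (SeriesField Ω) u) (algebraMap _ _ y)
    (algebraMap _ _ (frobSeries Ω p e y)) hyF (by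
      have h := map_biEval (frobField Ω p e) Ψ (algebraMap _ (SeriesField Ω) u)
        (algebraMap _ (SeriesField Ω) y) F
      rw [hyF, map_zero, frobField_algebraMap, frobField_algebraMap, hfrobu] at h
      rw [h]
      congr 2
      ext x
      exact hτe x)
  have hi' : d'.eval₂ ρ u * frobSeries Ω p e y = biEval ρ u y (s' i) := by
    apply IsFractionRing.injective (PowerSeries Ω) (SeriesField Ω)
    rw [map_mul, hliftd, hlift, hs', hi]
  have hdbar : PowerSeries.constantCoeff (d'.eval₂ ρ u) = (d'.map χ).eval a := by
    have := hbar y (C d')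
    rwa [biEval_C, map_C, evalEval_C, coe_mapRingHom] at this
  obtain rfl : i = i₀ := by
    apply hi₀
    have h := congrArg PowerSeries.constantCoeff hi'
    rwa [map_mul, hdbar, hbar, constantCoeff_frobSeries, hyb] at h
  obtain ⟨z, hz⟩ := (PowerSeries.isUnit_iff_constantCoeff.2
    (by rw [hdbar]; exact isUnit_iff_ne_zero.2 hda)).exists_left_inv
  refine ⟨e, u, y, hepos, hτe, hutr, hyF, hfrobu, hu1, ?_, ⟨z, ?_⟩, hi⟩
  · rw [hua]
    exact hex
  · rw [← hliftd, ← map_mul, hz, map_one]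

end ChebotarevFG

namespace ChebotarevFG
open Module Polynomial

theorem exists_eq_of_prod_eq {k 𝔽 : Type} [Field k] [Field 𝔽] {F : k[X][X]} (ψ₀ : k →+* 𝔽)
    (u y : 𝔽) (hmin : ∀ g, biEval ψ₀ u y g = 0 → F ∣ g) (τ : k →+* k) (d : k[X]) {ι : Type*}
    [Fintype ι] (s : ι → k[X][X])
    (hprod : ∏ i, (C (d.eval₂ ψ₀ u) * X - C (biEval ψ₀ u y (s i))) =
      C (d.eval₂ ψ₀ u) ^ Fintype.card ι * F.map (eval₂RingHom (ψ₀.comp τ) u))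
    {D : Type} [CommRing D] [IsDomain D] (ψ : k →+* D) (x y' z : D) (hy' : biEval ψ x y' F = 0)
    (hz : biEval (ψ.comp τ) x z F = 0) : ∃ i, d.eval₂ ψ x * z = biEval ψ x y' (s i) := by
  set W : k[X][X][X] := ∏ i, (C (C d) * X - C (s i)) -
    C (C d) ^ Fintype.card ι * F.map ((C : k[X] →+* k[X][X]).comp (mapRingHom τ)) with hW
  have hWmap : ∀ {D : Type} [CommRing D] (ψ : k →+* D) (x y : D), W.map (biEval ψ x y) =
      ∏ i, (C (d.eval₂ ψ x) * X - C (biEval ψ x y (s i))) -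
        C (d.eval₂ ψ x) ^ Fintype.card ι * F.map (eval₂RingHom (ψ.comp τ) x) := by
    intro D _ ψ x y
    have h1 : (biEval ψ x y).comp ((C : k[X] →+* k[X][X]).comp (mapRingHom τ)) =
        eval₂RingHom (ψ.comp τ) x := by
      apply Polynomial.ringHom_ext <;> simp
    rw [hW, Polynomial.map_sub, Polynomial.map_prod, Polynomial.map_mul, Polynomial.map_pow,
      map_C, biEval_C, Polynomial.map_map, h1]
    simp
  have h0 : W.map (biEval ψ₀ u y) = 0 := by rw [hWmap, hprod, sub_self]
  have h1 : W.map (biEval ψ x y') = 0 := by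
    ext n
    rw [coeff_map, coeff_zero]
    have h2 : biEval ψ₀ u y (W.coeff n) = 0 := by rw [← coeff_map, h0, coeff_zero]
    obtain ⟨q, hq⟩ := hmin _ h2
    rw [hq, map_mul, hy', zero_mul]
  rw [hWmap, sub_eq_zero] at h1
  have h2 := congrArg (eval z) h1
  rw [eval_mul, eval_map, ← biEval_apply, hz, mul_zero, eval_prod, Finset.prod_eq_zero_iff] at h2
  obtain ⟨i, -, hi⟩ := h2
  refine ⟨i, sub_eq_zero.1 ?_⟩
  simpa using hi

section Primitive

variable (A E N : Type*) [CommRing A] [IsDomain A] [Field E] [Field N] [Algebra A E]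
  [IsFractionRing A E] [Algebra E N] [Algebra A N] [IsScalarTower A E N]

theorem exists_integral_primitive_element [IsIntegrallyClosed A] [FiniteDimensional E N]
    [IsGalois E N] :
    ∃ (y : N) (f : A[X]), Algebra.adjoin E {y} = ⊤ ∧ f.Monic ∧ aeval y f = 0 ∧
      (f.map (algebraMap A N)).Splits ∧
      ∃ (α β : A[X]) (d : A), d ≠ 0 ∧ α * f + β * f.derivative = C d := by
  obtain ⟨y₀, hy₀⟩ := Field.exists_primitive_element E N
  have halg : IsAlgebraic A y₀ := (IsFractionRing.isAlgebraic_iff A E N).2 (.of_finite E y₀)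
  obtain ⟨c, hc, hint⟩ := halg.exists_integral_multiple
  set y := c • y₀ with hy
  have hc' : algebraMap A E c ≠ 0 := by
    rwa [Ne, IsFractionRing.to_map_eq_zero_iff]
  have htop : Algebra.adjoin E {y} = ⊤ := by
    have h1 : Algebra.adjoin E {y₀} = ⊤ := by
      rw [← IntermediateField.adjoin_simple_toSubalgebra_of_isAlgebraic (.of_finite E y₀), hy₀]
      rfl
    rw [eq_top_iff, ← h1, Algebra.adjoin_le_iff, Set.singleton_subset_iff]
    have h2 : y₀ = (algebraMap A E c)⁻¹ • y := by
      rw [hy, ← algebraMap_smul E c y₀, smul_smul, inv_mul_cancel₀ hc', one_smul]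
    rw [h2]
    exact Subalgebra.smul_mem _ (Algebra.self_mem_adjoin_singleton E y) _
  have hinj : Function.Injective (algebraMap A N) := by
    rw [IsScalarTower.algebraMap_eq A E N]
    exact (algebraMap E N).injective.comp (IsFractionRing.injective A E)
  have hmin : minpoly E y = (minpoly A y).map (algebraMap A E) :=
    minpoly.isIntegrallyClosed_eq_field_fractions' E hint
  refine ⟨y, minpoly A y, htop, minpoly.monic hint, minpoly.aeval A y, ?_, ?_⟩
  · rw [IsScalarTower.algebraMap_eq A E N, ← Polynomial.map_map, ← hmin]
    exact Normal.splits inferInstance y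
  · have hsep : (minpoly E y).Separable := Algebra.IsSeparable.isSeparable E y
    obtain ⟨a, b, hab⟩ := hsep
    obtain ⟨r, hr, har⟩ := IsLocalization.integerNormalization_spec (nonZeroDivisors A) a
    obtain ⟨r', hr', hbr'⟩ := IsLocalization.integerNormalization_spec (nonZeroDivisors A) b
    refine ⟨C r' * IsLocalization.integerNormalization (nonZeroDivisors A) a,
      C r * IsLocalization.integerNormalization (nonZeroDivisors A) b, r * r',
      mul_ne_zero (nonZeroDivisors.ne_zero hr) (nonZeroDivisors.ne_zero hr'), ?_⟩
    apply Polynomial.map_injective _ (IsFractionRing.injective A E)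
    simp only [Polynomial.map_add, Polynomial.map_mul, map_C, har, hbr', ← derivative_map]
    rw [← hmin, ← algebraMap_smul E r, ← algebraMap_smul E r', smul_eq_C_mul, smul_eq_C_mul]
    calc _ = C (algebraMap A E r) * C (algebraMap A E r') *
          (a * minpoly E y + b * derivative (minpoly E y)) := by ring
      _ = _ := by rw [hab, mul_one, map_mul (algebraMap A E), C_mul]

variable {A E N} in
theorem exists_common_denominator {y : N} (hy : Algebra.adjoin E {y} = ⊤) (X : Finset N) :
    ∃ h : A, h ≠ 0 ∧ ∀ x ∈ X, ∃ q : A[X], algebraMap A N h * x = aeval y q := by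
  classical
  have h1 : ∀ x : N, ∃ h : A, h ≠ 0 ∧ ∃ q : A[X], algebraMap A N h * x = aeval y q := by
    intro x
    have hx : x ∈ Algebra.adjoin E {y} := by rw [hy]; trivial
    rw [Algebra.adjoin_singleton_eq_range_aeval] at hx
    obtain ⟨q, rfl⟩ := hx
    obtain ⟨r, hr, hq⟩ := IsLocalization.integerNormalization_spec (nonZeroDivisors A) q
    refine ⟨r, nonZeroDivisors.ne_zero hr,
      IsLocalization.integerNormalization (nonZeroDivisors A) q, ?_⟩
    have h2 := congrArg (aeval y) hq
    rw [aeval_map_algebraMap] at h2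
    rw [h2, ← algebraMap_smul E r q, map_smul, Algebra.smul_def,
      ← IsScalarTower.algebraMap_apply]
    rfl
  choose h hh q hq using h1
  refine ⟨∏ x ∈ X, h x, Finset.prod_ne_zero_iff.2 fun x _ => hh x, fun x hx => ?_⟩
  refine ⟨C (∏ z ∈ X.erase x, h z) * q x, ?_⟩
  rw [← Finset.mul_prod_erase _ _ hx, map_mul, map_mul, aeval_C, ← hq]
  ring

end Primitive

theorem exists_galois_of_separable {M 𝔽 : Type*} [Field M] [Field 𝔽] [Algebra M 𝔽] [Normal M 𝔽]
    (S : Finset 𝔽) (hS : ∀ x ∈ S, IsSeparable M x) :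
    ∃ k : IntermediateField M 𝔽, FiniteDimensional M k ∧ IsGalois M k ∧ ∀ x ∈ S, x ∈ k := by
  let T : Set (separableClosure M 𝔽) := Subtype.val ⁻¹' (S : Set 𝔽)
  have hT : T.Finite := S.finite_toSet.preimage Subtype.val_injective.injOn
  have : Finite T := hT
  have hfd : FiniteDimensional M (IntermediateField.adjoin M T) :=
    IntermediateField.finiteDimensional_adjoin fun x _ => Algebra.IsIntegral.isIntegral x
  let k₁ := IntermediateField.normalClosure M (IntermediateField.adjoin M T) (separableClosure M 𝔽)
  have hk₁ : FiniteDimensional M k₁ := inferInstance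
  have hk₁' : IsGalois M k₁ := IsGalois.normalClosure _ _ _
  let ε := IntermediateField.liftAlgEquiv k₁
  refine ⟨IntermediateField.lift k₁, ε.toLinearEquiv.finiteDimensional, IsGalois.of_algEquiv ε,
    fun x hx => ?_⟩
  have h1 : (⟨x, mem_separableClosure_iff.2 (hS x hx)⟩ : separableClosure M 𝔽) ∈ k₁ :=
    IntermediateField.le_normalClosure _ (IntermediateField.subset_adjoin _ _ hx)
  exact (IntermediateField.mem_lift (⟨x, _⟩ : separableClosure M 𝔽)).2 h1

/-- A finite Galois extension of the constant field over which a curve has a fiber consisting of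
rational points. -/
theorem exists_galois_rational_fiber {M 𝔽 : Type*} [Field M] [Field 𝔽] [Algebra M 𝔽]
    [Normal M 𝔽] [IsAlgClosed 𝔽] (p : ℕ) [hp : Fact p.Prime] [CharP M p] {f : M[X][X]}
    (hf : f.Monic) {α β : M[X][X]} {d : M[X]} (hd : d ≠ 0)
    (hαβ : α * f + β * f.derivative = C d) :
    ∃ (k : IntermediateField M 𝔽) (a : 𝔽), FiniteDimensional M k ∧ IsGalois M k ∧ a ∈ k ∧
      aeval a d ≠ 0 ∧ ∀ b, biEval (algebraMap M 𝔽) a b f = 0 → b ∈ k := by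
  classical
  have : CharP 𝔽 p := charP_of_injective_algebraMap (algebraMap M 𝔽).injective p
  obtain ⟨Z, hZ, hZ'⟩ := card_frobenius_fixed (Ω := 𝔽) p (e := d.natDegree + 1) (by omega)
  obtain ⟨a, haZ, had⟩ : ∃ a ∈ Z, aeval a d ≠ 0 := by
    by_contra! hcon
    have h1 : Z ⊆ (d.map (algebraMap M 𝔽)).roots.toFinset := by
      intro a ha
      rw [Multiset.mem_toFinset, mem_roots (Polynomial.map_ne_zero hd), IsRoot.def,
        eval_map_algebraMap]
      exact hcon a ha
    have h2 := (Finset.card_le_card h1).trans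
      ((Multiset.toFinset_card_le _).trans (card_roots' _))
    rw [hZ, natDegree_map] at h2
    have := Nat.lt_pow_self hp.out.one_lt (n := d.natDegree + 1)
    omega
  have hasep : IsSeparable M a := by
    refine (galois_poly_separable (K := M) p (p ^ (d.natDegree + 1))
      (dvd_pow_self p (by omega))).of_dvd (minpoly.dvd M a ?_)
    simp [(hZ' a).1 haZ]
  set S' := separableClosure M 𝔽
  let a' : S' := ⟨a, mem_separableClosure_iff.2 hasep⟩
  have hev : ∀ g : M[X][X], ∀ b, aeval b (g.map (eval₂RingHom (algebraMap M S') a')) =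
      biEval (algebraMap M 𝔽) a b g := by
    intro g b
    rw [aeval_def, eval₂_map, biEval_apply]
    congr 1
    apply Polynomial.ringHom_ext
    · intro m
      simp only [RingHom.comp_apply, coe_eval₂RingHom, eval₂_C]
      exact (IsScalarTower.algebraMap_apply M S' 𝔽 m).symm
    · simp [a']
  have hd' : eval₂RingHom (algebraMap M S') a' d ≠ 0 := by
    intro h
    have h1 := hev (C d) 0
    rw [map_C, h, C_0, map_zero, biEval_C] at h1
    exact had h1.symm
  set f' := f.map (eval₂RingHom (algebraMap M S') a') with hf'
  have hf'm : f'.Monic := hf.map _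
  have hsep : f'.Separable := by
    have h1 := congrArg (Polynomial.map (eval₂RingHom (algebraMap M S') a')) hαβ
    rw [Polynomial.map_add, Polynomial.map_mul, Polynomial.map_mul, ← derivative_map, map_C] at h1
    refine ⟨C (eval₂RingHom (algebraMap M S') a' d)⁻¹ * α.map (eval₂RingHom (algebraMap M S') a'),
      C (eval₂RingHom (algebraMap M S') a' d)⁻¹ * β.map (eval₂RingHom (algebraMap M S') a'), ?_⟩
    rw [mul_assoc, mul_assoc, ← mul_add, h1, ← C_mul, inv_mul_cancel₀ hd', C_1]
  have hroot : ∀ b, biEval (algebraMap M 𝔽) a b f = 0 → IsSeparable M b := by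
    intro b hb
    have h1 : IsSeparable S' b := hsep.of_dvd (minpoly.dvd S' b (by rw [hf', hev, hb]))
    exact IsSeparable.of_algebra_isSeparable_of_isSeparable M h1
  obtain ⟨k, hk1, hk2, hk3⟩ := exists_galois_of_separable (M := M)
    (insert a (f'.map (algebraMap S' 𝔽)).roots.toFinset) (by
      intro x hx
      rcases Finset.mem_insert.1 hx with rfl | hx
      · exact hasep
      · have h1 := (mem_roots'.1 (Multiset.mem_toFinset.1 hx)).2
        rw [IsRoot.def, eval_map_algebraMap, hf', hev] at h1
        exact hroot x h1)
  refine ⟨k, a, hk1, hk2, hk3 a (Finset.mem_insert_self _ _), had, fun b hb => hk3 b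
    (Finset.mem_insert_of_mem ?_)⟩
  rw [Multiset.mem_toFinset, mem_roots (hf'm.map _).ne_zero, IsRoot.def, eval_map_algebraMap, hf',
    hev, hb]

end ChebotarevFG

namespace ChebotarevFG
open Module Polynomial

theorem biEval_mem {A D : Type*} [CommRing A] [CommRing D] (B : Subring D) (ψ : A →+* D)
    (hψ : ∀ a, ψ a ∈ B) {x y : D} (hx : x ∈ B) (hy : y ∈ B) (g : A[X][X]) :
    biEval ψ x y g ∈ B := by
  have h := map_biEval B.subtype (ψ.codRestrict B hψ) ⟨x, hx⟩ ⟨y, hy⟩ g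
  exact h ▸ (biEval (ψ.codRestrict B hψ) ⟨x, hx⟩ ⟨y, hy⟩ g).2

theorem exists_ringHom_of_ker_eq {R N 𝔽 S : Type*} [CommRing R] [Field N] [Field 𝔽] [Field S]
    (g₁ : R →+* 𝔽) (g₂ : R →+* S) (hk : ∀ r, g₁ r = 0 ↔ g₂ r = 0) (i : N →+* 𝔽)
    (hN : ∀ x, ∃ r t, g₁ t ≠ 0 ∧ g₁ t * i x = g₁ r) :
    ∃ Φ : N →+* S, ∀ x r t, g₁ t * i x = g₁ r → g₂ t * Φ x = g₂ r := by
  choose r t ht hr using hN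
  have ht₂ : ∀ x, g₂ (t x) ≠ 0 := fun x h => ht x ((hk _).2 h)
  have key : ∀ x r' t', g₁ t' * i x = g₁ r' → g₂ t' * (g₂ (r x) / g₂ (t x)) = g₂ r' := by
    intro x r' t' h
    have h1 : g₁ (t' * r x - t x * r') = 0 := by
      rw [map_sub, map_mul, map_mul, ← hr, ← h]
      ring
    have h2 := (hk _).1 h1
    rw [map_sub, map_mul, map_mul, sub_eq_zero] at h2
    rw [← mul_div_assoc, h2, mul_div_cancel_left₀ _ (ht₂ x)]
  refine ⟨{ toFun := fun x => g₂ (r x) / g₂ (t x), map_one' := ?_, map_mul' := ?_,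
            map_zero' := ?_, map_add' := ?_ }, key⟩
  · simpa using key 1 1 1 (by simp)
  · intro x y
    have h := key (x * y) (r x * r y) (t x * t y) (by
      rw [map_mul, map_mul, map_mul, ← hr, ← hr]; ring)
    rw [map_mul, map_mul] at h
    have h1 := ht₂ x
    have h2 := ht₂ y
    rw [div_mul_div_comm, ← h, mul_div_cancel_left₀ _ (mul_ne_zero h1 h2)]
  · simpa using key 0 0 1 (by simp)
  · intro x y
    have h := key (x + y) (r x * t y + r y * t x) (t x * t y) (by
      rw [map_add, map_add, map_mul, map_mul, map_mul, ← hr, ← hr]; ring)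
    rw [map_mul, map_add, map_mul, map_mul] at h
    have h1 := ht₂ x
    have h2 := ht₂ y
    rw [div_add_div _ _ h1 h2, mul_comm (g₂ (t x)) (g₂ (r y)), ← h,
      mul_div_cancel_left₀ _ (mul_ne_zero h1 h2)]

theorem exists_eq_prod_X_sub_C {𝔽 : Type*} [Field 𝔽] [IsAlgClosed 𝔽] {P : 𝔽[X]} (hP : P.Monic) :
    ∃ (ι : Type) (_ : Fintype ι) (z : ι → 𝔽), Fintype.card ι = P.natDegree ∧
      P = ∏ i, (X - C (z i)) := by
  refine ⟨Fin P.roots.toList.length, inferInstance, fun i => P.roots.toList[i], ?_, ?_⟩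
  · rw [Fintype.card_fin, Multiset.length_toList]
    exact (IsAlgClosed.splits P).natDegree_eq_card_roots.symm
  · conv_lhs => rw [(IsAlgClosed.splits P).eq_prod_roots_of_monic hP]
    have := Fin.prod_univ_fun_getElem P.roots.toList (fun a => X - C a)
    refine Eq.trans ?_ this.symm
    conv_lhs => rw [← Multiset.coe_toList P.roots]
    simp

theorem exists_constant_extension {M N : Type} [Field M] [Field N] [Algebra M N] (p : ℕ)
    [Fact p.Prime] [CharP M p] (σ : N ≃ₐ[M] N) {f : M[X][X]} (hf : f.Monic) {α β : M[X][X]}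
    {d : M[X]} (hd : d ≠ 0) (hαβ : α * f + β * f.derivative = C d) :
    ∃ (k : Type) (_ : Field k) (_ : Algebra M k) (τ : k ≃ₐ[M] k)
      (j : k →ₐ[M] AlgebraicClosure N) (ρ : AlgebraicClosure N ≃+* AlgebraicClosure N) (a : k),
      FiniteDimensional M k ∧ IsGalois M k ∧ (∀ x, j (τ x) = ρ (j x)) ∧
      (∀ x : N, ρ (algebraMap N (AlgebraicClosure N) x) =
        algebraMap N (AlgebraicClosure N) (σ x)) ∧
      aeval a d ≠ 0 ∧ ∀ F : k[X][X], F.Monic → 0 < F.natDegree →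
        F ∣ f.map (mapRingHom (algebraMap M k)) → ∃ b, F.evalEval a b = 0 := by
  obtain ⟨k, a, hk1, hk2, ha, had, hk⟩ :=
    exists_galois_rational_fiber (𝔽 := AlgebraicClosure M) p hf hd hαβ
  let j : k →ₐ[M] AlgebraicClosure N :=
    (IsAlgClosed.lift : AlgebraicClosure M →ₐ[M] AlgebraicClosure N).comp k.val
  let ρ : AlgebraicClosure N ≃+* AlgebraicClosure N :=
    IsAlgClosure.equivOfEquiv (AlgebraicClosure N) (AlgebraicClosure N) (σ : N ≃+* N)
  have hρ : ∀ x : N, ρ (algebraMap N (AlgebraicClosure N) x) =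
      algebraMap N (AlgebraicClosure N) (σ x) := fun x =>
    IsAlgClosure.equivOfEquiv_algebraMap _ _ _ x
  let ρ' : AlgebraicClosure N ≃ₐ[M] AlgebraicClosure N := AlgEquiv.ofRingEquiv (f := ρ) (by
    intro m
    rw [IsScalarTower.algebraMap_apply M N (AlgebraicClosure N), hρ, σ.commutes])
  let _ : Algebra k (AlgebraicClosure N) := j.toRingHom.toAlgebra
  have : IsScalarTower M k (AlgebraicClosure N) :=
    IsScalarTower.of_algebraMap_eq' j.comp_algebraMap.symm
  refine ⟨k, inferInstance, inferInstance, ρ'.restrictNormal k, j, ρ, ⟨a, ha⟩, hk1, hk2,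
    fun x => ρ'.restrictNormal_commutes k x, hρ, ?_, ?_⟩
  · intro h
    apply had
    have := congrArg (algebraMap k (AlgebraicClosure M)) h
    rwa [map_zero, ← aeval_algebraMap_apply] at this
  · intro F hF hF0 hFf
    have key : ∀ g : k[X][X], ∀ b : AlgebraicClosure M,
        eval b (g.map (eval₂RingHom (algebraMap k (AlgebraicClosure M)) a)) =
          biEval (algebraMap k (AlgebraicClosure M)) a b g := by
      intro g b
      rw [eval_map, biEval_apply]
    obtain ⟨b, hb⟩ := IsAlgClosed.exists_root
      (F.map (eval₂RingHom (algebraMap k (AlgebraicClosure M)) a)) (by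
        rw [hF.degree_map]
        exact (natDegree_pos_iff_degree_pos.1 hF0).ne')
    rw [IsRoot.def, key] at hb
    have hb' : biEval (algebraMap M (AlgebraicClosure M)) a b f = 0 := by
      obtain ⟨q, hq⟩ := hFf
      have := biEval_map (algebraMap k (AlgebraicClosure M)) (algebraMap M k) a b f
      rw [hq, map_mul, hb, zero_mul] at this
      exact this.symm
    refine ⟨⟨b, hk b hb'⟩, ?_⟩
    apply (algebraMap k (AlgebraicClosure M)).injective
    rw [← biEval_id, map_biEval, map_zero]
    exact hb

/-- Every finite Galois extension of `M` with an automorphism embeds into `Frac Ω⟦t⟧` so that the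
automorphism becomes a power of Frobenius on coefficients and given elements become integral. -/
def HasFrobLift (Ω : Type) [Field Ω] (p : ℕ) [Fact p.Prime] [CharP Ω p] (M : Type) [Field M] :
    Prop :=
  ∀ (N : Type) [Field N] [Algebra M N] [FiniteDimensional M N] [IsGalois M N] (σ : N ≃ₐ[M] N)
    (X : Finset N), ∃ (e : ℕ) (Ψ : N →+* SeriesField Ω), 0 < e ∧
      (∀ x, Ψ (σ x) = frobField Ω p e (Ψ x)) ∧
      ∀ x ∈ X, Ψ x ∈ (algebraMap (PowerSeries Ω) (SeriesField Ω)).range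

theorem exists_frobLift_step (Ω : Type) [Field Ω] [IsAlgClosed Ω] (p : ℕ) [Fact p.Prime]
    [CharP Ω p] {M E N : Type} [Field M] [Countable M] [CharP M p] (hM : HasFrobLift Ω p M)
    [Field E] [Algebra M[X] E] [IsFractionRing M[X] E] [Field N] [Algebra E N] [Algebra M[X] N]
    [IsScalarTower M[X] E N] [Algebra M N] [IsScalarTower M M[X] N] [FiniteDimensional E N]
    [IsGalois E N] (σ : N ≃ₐ[E] N) (S : Finset N) :
    ∃ (e : ℕ) (Φ : N →+* SeriesField Ω) (u : PowerSeries Ω), 0 < e ∧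
      (∀ x, Φ (σ x) = frobField Ω p e (Φ x)) ∧
      (∀ x ∈ S, Φ x ∈ (algebraMap (PowerSeries Ω) (SeriesField Ω)).range) ∧
      Φ (algebraMap M[X] N X) = algebraMap _ _ u ∧ frobSeries Ω p e u = u ∧
      PowerSeries.coeff 1 u = 1 ∧ ∀ j, 0 < j → 2 * j ≤ e →
        PowerSeries.constantCoeff u ^ p ^ j ≠ PowerSeries.constantCoeff u := by
  classical
  obtain ⟨y, f, hytop, hf, hfy, hfs, α, β, d₁, hd₁, hαβ⟩ :=
    exists_integral_primitive_element M[X] E N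
  have hσM : ∀ q : M[X], σ (algebraMap M[X] N q) = algebraMap M[X] N q := by
    intro q
    rw [IsScalarTower.algebraMap_apply M[X] E N, σ.commutes]
  let σM : N ≃ₐ[M] N := AlgEquiv.ofRingEquiv (f := (σ : N ≃+* N)) (by
    intro m
    rw [IsScalarTower.algebraMap_apply M M[X] N]
    exact hσM _)
  obtain ⟨k, _, _, τ, j, ρ, a, hfd, hgal, hjτ, hρ, had, hroot⟩ :=
    exists_constant_extension p σM hf hd₁ hαβ
  set 𝔽 := AlgebraicClosure N
  set u := algebraMap M[X] N X with hu
  set κ := algebraMap N 𝔽 with hκ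
  have hjM : ∀ m : M, j (algebraMap M k m) = κ (algebraMap M N m) := by
    intro m
    rw [j.commutes, IsScalarTower.algebraMap_apply M N 𝔽]
  have hcompM : (j : k →+* 𝔽).comp (algebraMap M k) = κ.comp (algebraMap M N) :=
    RingHom.ext hjM
  have hbase : ∀ q : M[X], κ (algebraMap M[X] N q) = (q.map (algebraMap M k)).eval₂ j (κ u) := by
    intro q
    rw [eval₂_map, hcompM, ← hom_eval₂]
    congr 1
    induction q using Polynomial.induction_on' with
    | add p q hp hq => rw [map_add, eval₂_add, hp, hq]
    | monomial n c =>
      rw [eval₂_monomial, hu, ← map_pow, IsScalarTower.algebraMap_apply M M[X] N, ← map_mul,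
        ← C_mul_X_pow_eq_monomial]
      rfl
  have hbi : ∀ q : M[X][X], biEval (j : k →+* 𝔽) (κ u) (κ y) (q.map (mapRingHom (algebraMap M k))) =
      κ (aeval y q) := by
    intro q
    rw [biEval_map, biEval_apply, aeval_def, hom_eval₂]
    congr 1
    refine RingHom.ext fun c => ?_
    rw [RingHom.comp_apply, hbase c, coe_eval₂RingHom, eval₂_map]
  have hinjA : Function.Injective (algebraMap M[X] N) := by
    rw [IsScalarTower.algebraMap_eq M[X] E N]
    exact (algebraMap E N).injective.comp (IsFractionRing.injective M[X] E)
  let _ : Algebra k 𝔽 := (j : k →+* 𝔽).toAlgebra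
  have hjalg : algebraMap k 𝔽 = (j : k →+* 𝔽) := rfl
  have : IsScalarTower M k 𝔽 := IsScalarTower.of_algebraMap_eq' j.comp_algebraMap.symm
  have hutr : Transcendental k (κ u) := by
    intro halg
    have h1 : IsAlgebraic M (κ u) := halg.restrictScalars M
    obtain ⟨q, hq0, hq⟩ := h1
    apply hq0
    apply hinjA
    apply κ.injective
    rw [map_zero, map_zero, hbase, eval₂_map, ← hq, aeval_def]
    congr 1
  have hfk : biEval (j : k →+* 𝔽) (κ u) (κ y) (f.map (mapRingHom (algebraMap M k))) = 0 := by
    rw [hbi, hfy, map_zero]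
  obtain ⟨F, hF, hFy, hFdvd⟩ := exists_monic_dvd_iff (hf.map (mapRingHom (algebraMap M k)))
    hutr (y := κ y) hfk
  rw [hjalg] at hFy hFdvd
  have hFn : 0 < F.natDegree := by
    by_contra h0
    rw [hF.natDegree_eq_zero.1 (by omega), map_one] at hFy
    exact one_ne_zero hFy
  have hFirr : Irreducible F := by
    refine Prime.irreducible ⟨hF.ne_zero, fun h => ?_, fun a b hab => ?_⟩
    · exact not_isUnit_zero (hFy ▸ h.map (biEval (j : k →+* 𝔽) (κ u) (κ y)))
    · obtain ⟨c, hc⟩ := hab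
      have h1 : biEval (j : k →+* 𝔽) (κ u) (κ y) a * biEval (j : k →+* 𝔽) (κ u) (κ y) b = 0 := by
        rw [← map_mul, hc, map_mul, hFy, zero_mul]
      exact (mul_eq_zero.1 h1).imp (hFdvd a) (hFdvd b)
  obtain ⟨q, hq⟩ := hFdvd _ hfk
  obtain ⟨b, hb⟩ := hroot F hF hFn ⟨q, hq⟩
  have hbez : (α.map (mapRingHom (algebraMap M k)) * q +
      β.map (mapRingHom (algebraMap M k)) * q.derivative) * F +
      (β.map (mapRingHom (algebraMap M k)) * q) * F.derivative =
        C (d₁.map (algebraMap M k)) := by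
    have h1 := congrArg (Polynomial.map (mapRingHom (algebraMap M k))) hαβ
    rw [Polynomial.map_add, Polynomial.map_mul, Polynomial.map_mul, ← derivative_map, map_C, hq,
      derivative_mul] at h1
    rw [coe_mapRingHom] at h1
    rw [← h1]
    ring
  have hb' : F.derivative.evalEval a b ≠ 0 := by
    intro h
    have h1 := congrArg (evalEval a b) hbez
    rw [evalEval_add, evalEval_mul, evalEval_mul, hb, h, mul_zero, mul_zero, add_zero,
      evalEval_C, eval_map_algebraMap] at h1
    exact had h1.symm
  set P := F.map (eval₂RingHom (j : k →+* 𝔽) (κ u)) with hP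
  have hPm : P.Monic := hF.map _
  obtain ⟨ι, _, z, hcard, hz⟩ := exists_eq_prod_X_sub_C hPm
  have hPf : P ∣ (f.map (algebraMap M[X] N)).map κ := by
    have h1 := congrArg (Polynomial.map (eval₂RingHom (j : k →+* 𝔽) (κ u))) hq
    rw [Polynomial.map_map, Polynomial.map_mul] at h1
    refine ⟨_, Eq.trans ?_ h1⟩
    rw [Polynomial.map_map]
    congr 1
    refine RingHom.ext fun c => ?_
    exact hbase c
  have hzN : ∀ i, ∃ z' : N, κ z' = z i := by
    intro i
    have h1 : IsRoot P (z i) := by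
      rw [IsRoot.def, hz, eval_prod]
      exact Finset.prod_eq_zero (Finset.mem_univ i) (by simp)
    exact hfs.mem_range_of_isRoot (hf.map _).ne_zero (h1.dvd hPf)
  choose z' hz' using hzN
  obtain ⟨i₀, hi₀⟩ : ∃ i, z i = κ y := by
    have h1 : P.eval (κ y) = 0 := by rw [hP, eval_map, ← biEval_apply, hFy]
    rw [hz, eval_prod, Finset.prod_eq_zero_iff] at h1
    obtain ⟨i, -, hi⟩ := h1
    rw [eval_sub, eval_X, eval_C, sub_eq_zero] at hi
    exact ⟨i, hi.symm⟩
  obtain ⟨h, hh0, hh⟩ := exists_common_denominator (A := M[X]) hytop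
    (S ∪ Finset.univ.image fun i => σ (z' i))
  have hden : ∀ x ∈ S ∪ Finset.univ.image fun i => σ (z' i), ∃ s : k[X][X],
      ((d₁ * h).map (algebraMap M k)).eval₂ (j : k →+* 𝔽) (κ u) * κ x =
        biEval (j : k →+* 𝔽) (κ u) (κ y) s := by
    intro x hx
    obtain ⟨s, hs⟩ := hh x hx
    refine ⟨(C d₁ * s).map (mapRingHom (algebraMap M k)), ?_⟩
    rw [hbi, ← hbase, map_mul, map_mul, mul_assoc, ← map_mul κ, hs, map_mul (aeval y), aeval_C,
      map_mul]
  have hσz : ∀ i, σ (z' i) ∈ S ∪ Finset.univ.image fun i => σ (z' i) := fun i =>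
    Finset.mem_union_right _ (Finset.mem_image_of_mem _ (Finset.mem_univ i))
  choose! s hs using hden
  set d : k[X] := (d₁ * h).map (algebraMap M k) with hd
  have hd0 : d ≠ 0 := Polynomial.map_ne_zero (mul_ne_zero hd₁ hh0)
  have hprod : ∏ i, (C (d.eval₂ (j : k →+* 𝔽) (κ u)) * X -
        C (biEval (j : k →+* 𝔽) (κ u) (κ y) (s (σ (z' i))))) =
      C (d.eval₂ (j : k →+* 𝔽) (κ u)) ^ Fintype.card ι *
        F.map (eval₂RingHom ((j : k →+* 𝔽).comp (τ : k →+* k)) (κ u)) := by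
    have h1 : F.map (eval₂RingHom ((j : k →+* 𝔽).comp (τ : k →+* k)) (κ u)) =
        ∏ i, (X - C (κ (σ (z' i)))) := by
      have h2 := congrArg (Polynomial.map (ρ : 𝔽 →+* 𝔽)) hz
      rw [hP, Polynomial.map_map, Polynomial.map_prod] at h2
      have h3 : ρ (κ u) = κ u := (hρ u).trans (congrArg κ (hσM X))
      have h4 : eval₂RingHom ((j : k →+* 𝔽).comp (τ : k →+* k)) (κ u) =
          (ρ : 𝔽 →+* 𝔽).comp (eval₂RingHom (j : k →+* 𝔽) (κ u)) := by
        apply Polynomial.ringHom_ext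
        · intro x
          simpa using hjτ x
        · simp [h3]
      rw [h4, h2]
      refine Finset.prod_congr rfl fun i _ => ?_
      have h5 : ρ (κ (z' i)) = κ (σ (z' i)) := hρ _
      rw [Polynomial.map_sub, map_X, map_C, ← hz' i, RingHom.coe_coe, h5]
    rw [h1, ← Finset.card_univ, ← Finset.prod_const, ← Finset.prod_mul_distrib]
    refine Finset.prod_congr rfl fun i _ => ?_
    rw [← hs _ (hσz i), C_mul]
    ring
  have hcount : Countable k := (Module.finBasis M k).equivFun.toEquiv.countable_iff.2 inferInstance
  have hτr : ∀ x, (τ : k →+* k)^[orderOf τ] x = x := by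
    intro x
    have h1 : (τ ^ orderOf τ) x = x := by rw [pow_orderOf_eq_one]; rfl
    rwa [AlgEquiv.coe_pow] at h1
  have hbez' : (C (h.map (algebraMap M k)) * (α.map (mapRingHom (algebraMap M k)) * q +
      β.map (mapRingHom (algebraMap M k)) * q.derivative)) * F +
      (C (h.map (algebraMap M k)) * (β.map (mapRingHom (algebraMap M k)) * q)) * F.derivative =
        C d := by
    rw [hd, Polynomial.map_mul, C_mul, ← hbez]
    ring
  obtain ⟨Y, hY⟩ := exists_curve_specialization (Ω := Ω) p hF hFn hFirr (τ : k →+* k)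
    (orderOf_pos τ) hτr hd0 hbez' hb hb' (hcard.trans (hF.natDegree_map _))
    (fun i => s (σ (z' i))) (exists_eq_of_prod_eq (j : k →+* 𝔽) (κ u) (κ y) hFdvd (τ : k →+* k) d
      (fun i => s (σ (z' i))) hprod) i₀
  obtain ⟨e₀, Ψ, he₀, hΨτ, hΨX⟩ := hM k τ (Y ∪ S.biUnion fun x => biCoeffs (s x))
  obtain ⟨e, u', y', he, hΨe, hu'tr, hFu', hu'fix, hu'c, hu'ex, ⟨w, hw⟩, hfroby⟩ :=
    hY Ψ e₀ he₀ hΨτ fun x hx => hΨX x (Finset.mem_union_left _ hx)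
  set O := algebraMap (PowerSeries Ω) (SeriesField Ω) with hO
  have hker : ∀ g, biEval (j : k →+* 𝔽) (κ u) (κ y) g = 0 ↔ biEval Ψ (O u') (O y') g = 0 := by
    intro g
    constructor
    · intro hg
      obtain ⟨c, hc⟩ := hFdvd g hg
      rw [hc, map_mul, hFu', zero_mul]
    · intro hg
      let _ : Algebra k (SeriesField Ω) := Ψ.toAlgebra
      have htr : Transcendental k (O u') := by
        rintro ⟨c, hc0, hc⟩
        exact hc0 (hu'tr c hc)
      obtain ⟨c, hc⟩ := dvd_of_irreducible hF hFirr htr hFu' g hg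
      rw [hc, map_mul, hFy, zero_mul]
  have hrep : ∀ x : N, ∃ (t : M[X]) (r : M[X][X]), t ≠ 0 ∧ algebraMap M[X] N t * x = aeval y r := by
    intro x
    obtain ⟨t, ht, ht'⟩ := exists_common_denominator (A := M[X]) hytop {x}
    obtain ⟨r, hr⟩ := ht' x (Finset.mem_singleton_self x)
    exact ⟨t, r, ht, hr⟩
  obtain ⟨Φ, hΦ⟩ := exists_ringHom_of_ker_eq (biEval (j : k →+* 𝔽) (κ u) (κ y))
    (biEval Ψ (O u') (O y')) hker κ (by
      intro x
      obtain ⟨t, r, ht, hr⟩ := hrep x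
      refine ⟨r.map (mapRingHom (algebraMap M k)), C (t.map (algebraMap M k)), ?_, ?_⟩
      · rw [biEval_C, ← hbase, Ne, map_eq_zero, map_eq_zero_iff _ hinjA]
        exact ht
      · rw [biEval_C, ← hbase, hbi, ← hr, map_mul])
  have hΦu : Φ u = O u' := by
    simpa using hΦ u (C X) 1 (by simp)
  have hΦy : Φ y = O y' := by
    simpa using hΦ y X 1 (by simp)
  have hΦM : ∀ m : M, Φ (algebraMap M N m) = Ψ (algebraMap M k m) := by
    intro m
    simpa using hΦ (algebraMap M N m) (C (C (algebraMap M k m))) 1 (by simp [hjM])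
  have hdne : d.eval₂ Ψ (O u') ≠ 0 := right_ne_zero_of_mul (hw ▸ one_ne_zero)
  have hΦσy : Φ (σ y) = frobField Ω p e (Φ y) := by
    have hy0 : z' i₀ = y := κ.injective ((hz' i₀).trans hi₀)
    have h1 := hΦ (σ y) (s (σ (z' i₀))) (C d) (by
      rw [biEval_C, ← hs _ (hσz i₀), hy0])
    rw [biEval_C, ← hfroby] at h1
    rw [mul_left_cancel₀ hdne h1, hΦy, frobField_algebraMap]
  have hΦbase : (Φ.comp (σ : N →+* N)).comp (algebraMap M[X] N) =
      ((frobField Ω p e).comp Φ).comp (algebraMap M[X] N) := by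
    apply Polynomial.ringHom_ext
    · intro m
      have h1 : algebraMap M[X] N (C m) = algebraMap M N m :=
        (IsScalarTower.algebraMap_apply M M[X] N m).symm
      have h2 := hΨe (algebraMap M k m)
      have h3 : σ (algebraMap M N m) = algebraMap M N m := by rw [← h1, hσM]
      simp only [RingHom.comp_apply, RingHom.coe_coe, h1, h3, hΦM]
      rw [← h2]
      simp
    · simp only [RingHom.comp_apply, RingHom.coe_coe, hσM]
      rw [← hu, hΦu, frobField_algebraMap, hu'fix]
  refine ⟨e, Φ, u', he, ?_, ?_, hΦu, hu'fix, hu'c, hu'ex⟩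
  · intro x
    obtain ⟨t, r, ht, hr⟩ := hrep x
    have h1 : ∀ r : M[X][X], Φ (σ (aeval y r)) = frobField Ω p e (Φ (aeval y r)) := by
      intro r
      have h2 : ((Φ.comp (σ : N →+* N)).comp (aeval y : M[X][X] →ₐ[M[X]] N).toRingHom) =
          (((frobField Ω p e).comp Φ).comp (aeval y : M[X][X] →ₐ[M[X]] N).toRingHom) := by
        apply Polynomial.ringHom_ext
        · intro c
          simpa using RingHom.congr_fun hΦbase c
        · simpa using hΦσy
      exact RingHom.congr_fun h2 r
    have h3 := h1 r
    rw [← hr, map_mul, map_mul, map_mul, map_mul] at h3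
    have h4 := RingHom.congr_fun hΦbase t
    simp only [RingHom.comp_apply, RingHom.coe_coe] at h4
    rw [h4] at h3
    refine mul_left_cancel₀ ?_ h3
    rw [Ne, map_eq_zero, map_eq_zero, map_eq_zero_iff _ hinjA]
    exact ht
  · intro x hx
    have h1 := hΦ x (s x) (C d) (by rw [biEval_C, hs _ (Finset.mem_union_left _ hx)])
    rw [biEval_C] at h1
    have h2 : Φ x = O w * biEval Ψ (O u') (O y') (s x) := by
      rw [← h1, ← mul_assoc, hw, one_mul]
    rw [h2]
    refine mul_mem ⟨w, rfl⟩ ?_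
    obtain ⟨g, hg⟩ := (mem_lifts _).1 (mem_lifts_biCoeffs (O.range.comap Ψ) (s x) fun c hc =>
      hΨX c (Finset.mem_union_right _ (Finset.mem_biUnion.2 ⟨x, hx, hc⟩)))
    rw [← hg, biEval_map]
    exact biEval_mem O.range _ (fun c => c.2) ⟨u', rfl⟩ ⟨y', rfl⟩ g
end ChebotarevFG

namespace ChebotarevFG
open Module Polynomial

theorem hasFrobLift_of_finite (Ω : Type) [Field Ω] [IsAlgClosed Ω] (p : ℕ) [Fact p.Prime]
    [CharP Ω p] (M : Type) [Field M] [Finite M] [CharP M p] : HasFrobLift Ω p M := by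
  intro N _ _ _ _ σ X
  have : Fintype M := Fintype.ofFinite M
  have : Finite N := Module.finite_of_finite M
  obtain ⟨m, -, hm⟩ := FiniteField.card M p
  obtain ⟨⟨n, hn⟩, hσ⟩ := (FiniteField.bijective_frobeniusAlgEquivOfAlgebraic_pow M N).2 σ
  have hd : 0 < finrank M N := Module.finrank_pos
  have hσ' : σ = FiniteField.frobeniusAlgEquivOfAlgebraic M N ^ (n + finrank M N) := by
    rw [pow_add, ← FiniteField.orderOf_frobeniusAlgEquivOfAlgebraic M N, pow_orderOf_eq_one,
      mul_one]
    exact hσ.symm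
  have hσx : ∀ x, σ x = x ^ p ^ (m * (n + finrank M N) : ℕ) := by
    intro x
    rw [hσ', AlgEquiv.coe_pow, FiniteField.coe_frobeniusAlgEquivOfAlgebraic_iterate, hm, pow_mul]
  have : CharP N p := charP_of_injective_algebraMap (algebraMap M N).injective p
  let _ : Algebra (ZMod p) N := ZMod.algebra N p
  let _ : Algebra (ZMod p) Ω := ZMod.algebra Ω p
  let ι : N →ₐ[ZMod p] Ω := IsAlgClosed.lift
  refine ⟨m * (n + finrank M N), (algebraMap (PowerSeries Ω) (SeriesField Ω)).comp
    ((PowerSeries.C : Ω →+* PowerSeries Ω).comp ι.toRingHom), by positivity, ?_, ?_⟩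
  · intro x
    rw [hσx]
    simp only [RingHom.comp_apply, frobField_algebraMap]
    congr 1
    ext k
    rw [coeff_frobSeries, AlgHom.toRingHom_eq_coe, RingHom.coe_coe, map_pow, PowerSeries.coeff_C,
      PowerSeries.coeff_C]
    split_ifs
    · rfl
    · exact (zero_pow (pow_ne_zero _ (Fact.out : p.Prime).ne_zero)).symm
  · intro x _
    exact ⟨_, rfl⟩

theorem exists_frobLift_simple (Ω : Type) [Field Ω] [IsAlgClosed Ω] (p : ℕ) [Fact p.Prime]
    [CharP Ω p] {M E N : Type} [Field M] [Countable M] [CharP M p] (hM : HasFrobLift Ω p M)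
    [Field E] [Algebra M E] (t : E) (ht : Transcendental M t)
    (htop : IntermediateField.adjoin M {t} = ⊤) [Field N] [Algebra E N]
    [FiniteDimensional E N] [IsGalois E N] (σ : N ≃ₐ[E] N) (S : Finset N) :
    ∃ (e : ℕ) (Φ : N →+* SeriesField Ω) (u : PowerSeries Ω), 0 < e ∧
      (∀ x, Φ (σ x) = frobField Ω p e (Φ x)) ∧
      (∀ x ∈ S, Φ x ∈ (algebraMap (PowerSeries Ω) (SeriesField Ω)).range) ∧
      Φ (algebraMap E N t) = algebraMap _ _ u ∧ frobSeries Ω p e u = u ∧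
      PowerSeries.coeff 1 u = 1 ∧
      ∀ j, 0 < j → 2 * j ≤ e →
        PowerSeries.constantCoeff u ^ p ^ j ≠ PowerSeries.constantCoeff u := by
  let _ : Algebra M[X] E := (aeval t : M[X] →ₐ[M] E).toRingHom.toAlgebra
  have hA : ∀ g : M[X], algebraMap M[X] E g = aeval t g := fun _ ↦ rfl
  have : FaithfulSMul M[X] E := (faithfulSMul_iff_algebraMap_injective _ _).2
    (transcendental_iff_injective.1 ht)
  have : IsFractionRing M[X] E := IsFractionRing.of_field M[X] E fun z ↦ by
    have hz : z ∈ IntermediateField.adjoin M {t} := htop ▸ IntermediateField.mem_top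
    obtain ⟨r, s, hz⟩ := IntermediateField.mem_adjoin_simple_iff M z |>.1 hz
    exact ⟨r, s, hz⟩
  let _ : Algebra M[X] N := ((algebraMap E N).comp (algebraMap M[X] E)).toAlgebra
  have : IsScalarTower M[X] E N := .of_algebraMap_eq fun _ ↦ rfl
  let _ : Algebra M N := ((algebraMap M[X] N).comp C).toAlgebra
  have : IsScalarTower M M[X] N := .of_algebraMap_eq fun _ ↦ rfl
  obtain ⟨e, Φ, u, h1, h2, h3, h4, h5⟩ := exists_frobLift_step Ω p hM σ S
  refine ⟨e, Φ, u, h1, h2, h3, ?_, h5⟩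
  rwa [IsScalarTower.algebraMap_apply M[X] E N, hA, aeval_X] at h4

theorem countable_adjoin {F K : Type*} [Field F] [Countable F] [Field K] [Algebra F K]
    (T : Set K) (hT : T.Countable) : Countable (IntermediateField.adjoin F T) := by
  have := hT.to_subtype
  have h : Countable (Subfield.closure (Set.range (algebraMap F K) ∪ T)) := by
    rw [← Cardinal.mk_le_aleph0_iff]
    refine (Subfield.cardinalMk_closure_le_max _).trans (max_le ?_ le_rfl)
    exact Cardinal.mk_le_aleph0_iff.2 ((Set.countable_range _).union hT).to_subtype
  exact h

theorem transcendental_adjoin_of_insert {F K : Type*} [Field F] [Field K] [Algebra F K]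
    {t : K} {T : Set K} (ht : t ∉ T) (h : AlgebraicIndepOn F id (insert t T)) :
    Transcendental (IntermediateField.adjoin F T) t := by
  have h2 := ((AlgebraicIndepOn.insert_iff ht).1 h).2
  rw [Set.image_id] at h2
  intro h3
  exact h2 (IntermediateField.isAlgebraic_adjoin_iff.1 h3)

theorem adjoin_simple_eq_top_of_insert {F K : Type*} [Field F] [Field K] [Algebra F K]
    (t : K) (T : Set K) [Algebra (IntermediateField.adjoin F T)
      (IntermediateField.adjoin F (insert t T))]
    (h : ∀ x, ((algebraMap (IntermediateField.adjoin F T)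
      (IntermediateField.adjoin F (insert t T)) x : IntermediateField.adjoin F (insert t T)) : K)
      = x) :
    IntermediateField.adjoin (IntermediateField.adjoin F T)
      {(⟨t, IntermediateField.subset_adjoin F _ (Set.mem_insert _ _)⟩ :
        IntermediateField.adjoin F (insert t T))} = ⊤ := by
  rw [eq_top_iff]
  rintro ⟨x, hx⟩ -
  set A := IntermediateField.adjoin (IntermediateField.adjoin F T)
      {(⟨t, IntermediateField.subset_adjoin F _ (Set.mem_insert _ _)⟩ :
        IntermediateField.adjoin F (insert t T))} with hA
  have hM : ∀ y (hy : y ∈ IntermediateField.adjoin F T) hy',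
      (⟨y, hy'⟩ : IntermediateField.adjoin F (insert t T)) ∈ A := fun y hy hy' ↦ by
    have := A.algebraMap_mem ⟨y, hy⟩
    convert this
    rw [h]
  induction hx using IntermediateField.adjoin_induction with
  | mem y hy =>
    rcases hy with rfl | hy
    · exact IntermediateField.subset_adjoin _ _ rfl
    · exact hM _ (IntermediateField.subset_adjoin F _ hy) _
  | algebraMap y => exact hM _ (IntermediateField.algebraMap_mem _ y) _
  | add y z hy hz h1 h2 => exact A.add_mem h1 h2
  | inv y hy h1 => exact A.inv_mem h1
  | mul y z hy hz h1 h2 => exact A.mul_mem h1 h2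

theorem exists_frobLift_insert (Ω : Type) [Field Ω] [IsAlgClosed Ω] (p : ℕ) [Fact p.Prime]
    [CharP Ω p] {K : Type} [Field K] [Algebra (ZMod p) K] {t : K} {T : Set K} (ht : t ∉ T)
    (hT : T.Countable) (hi : AlgebraicIndepOn (ZMod p) id (insert t T))
    (hM : HasFrobLift Ω p (IntermediateField.adjoin (ZMod p) T)) {N : Type} [Field N]
    [Algebra (IntermediateField.adjoin (ZMod p) (insert t T)) N]
    [FiniteDimensional (IntermediateField.adjoin (ZMod p) (insert t T)) N]
    [IsGalois (IntermediateField.adjoin (ZMod p) (insert t T)) N]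
    (σ : N ≃ₐ[IntermediateField.adjoin (ZMod p) (insert t T)] N) (S : Finset N) :
    ∃ (e : ℕ) (Φ : N →+* SeriesField Ω) (u : PowerSeries Ω), 0 < e ∧
      (∀ x, Φ (σ x) = frobField Ω p e (Φ x)) ∧
      (∀ x ∈ S, Φ x ∈ (algebraMap (PowerSeries Ω) (SeriesField Ω)).range) ∧
      Φ (algebraMap (IntermediateField.adjoin (ZMod p) (insert t T)) N
        ⟨t, IntermediateField.subset_adjoin _ _ (Set.mem_insert _ _)⟩) = algebraMap _ _ u ∧
      frobSeries Ω p e u = u ∧ PowerSeries.coeff 1 u = 1 ∧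
      ∀ j, 0 < j → 2 * j ≤ e →
        PowerSeries.constantCoeff u ^ p ^ j ≠ PowerSeries.constantCoeff u := by
  have hle : IntermediateField.adjoin (ZMod p) T ≤ IntermediateField.adjoin (ZMod p) (insert t T) :=
    IntermediateField.adjoin.mono _ _ _ (Set.subset_insert t T)
  let _ : Algebra (IntermediateField.adjoin (ZMod p) T)
    (IntermediateField.adjoin (ZMod p) (insert t T)) :=
    (IntermediateField.inclusion hle).toRingHom.toAlgebra
  have : IsScalarTower (IntermediateField.adjoin (ZMod p) T)
    (IntermediateField.adjoin (ZMod p) (insert t T)) K := .of_algebraMap_eq fun _ ↦ rfl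
  have : Countable (IntermediateField.adjoin (ZMod p) T) := countable_adjoin T hT
  have : CharP (IntermediateField.adjoin (ZMod p) T) p :=
    charP_of_injective_algebraMap
      (algebraMap (ZMod p) (IntermediateField.adjoin (ZMod p) T)).injective p
  refine exists_frobLift_simple Ω p hM _ ?_ (adjoin_simple_eq_top_of_insert t T fun _ ↦ rfl) σ S
  have h := transcendental_adjoin_of_insert ht hi
  exact (transcendental_algebraMap_iff
    (algebraMap (IntermediateField.adjoin (ZMod p) (insert t T)) K).injective).1 h

theorem hasFrobLift_adjoin (Ω : Type) [Field Ω] [IsAlgClosed Ω] (p : ℕ) [Fact p.Prime]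
    [CharP Ω p] {K : Type} [Field K] [Algebra (ZMod p) K] (T : Set K) (hT : T.Finite)
    (hi : AlgebraicIndepOn (ZMod p) id T) :
    HasFrobLift Ω p (IntermediateField.adjoin (ZMod p) T) := by
  induction T, hT using Set.Finite.induction_on with
  | empty =>
    have : CharP (IntermediateField.adjoin (ZMod p) (∅ : Set K)) p :=
      charP_of_injective_algebraMap (algebraMap (ZMod p) _).injective p
    have : Finite (IntermediateField.adjoin (ZMod p) (∅ : Set K)) := by
      rw [IntermediateField.adjoin_empty]
      exact Finite.of_equiv _ (IntermediateField.botEquiv (ZMod p) K).symm.toEquiv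
    exact hasFrobLift_of_finite Ω p _
  | insert ht hfin ih =>
    intro N _ _ _ _ σ S
    obtain ⟨e, Φ, u, h1, h2, h3, -⟩ := exists_frobLift_insert Ω p ht hfin.countable hi
      (ih (hi.mono (Set.subset_insert _ _))) σ S
    exact ⟨e, Φ, h1, h2, h3⟩

end ChebotarevFG

namespace ChebotarevFG
open Module Polynomial

theorem essFiniteType_zmod {K : Type*} [Field K] (p : ℕ) [Fact p.Prime] [Algebra (ZMod p) K]
    (h : ∃ s : Finset K, Subfield.closure (s : Set K) = ⊤) :
    Algebra.EssFiniteType (ZMod p) K := by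
  obtain ⟨s, hs⟩ := h
  refine IntermediateField.fg_top_iff.1 ⟨s, ?_⟩
  rw [eq_top_iff]
  intro x _
  have hx : x ∈ Subfield.closure (s : Set K) := hs ▸ Subfield.mem_top x
  exact (Subfield.closure_le (t := (IntermediateField.adjoin (ZMod p) (s : Set K)).toSubfield)).2
    (IntermediateField.subset_adjoin _ _) hx

theorem exists_galois_extension_lift {E L : Type} [Field E] [Field L] [Algebra E L]
    [FiniteDimensional E L] [Algebra.IsSeparable E L] (σ : L ≃ₐ[E] L) :
    ∃ (N : Type) (_ : Field N) (_ : Algebra E N) (_ : Algebra L N) (_ : IsScalarTower E L N)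
      (_ : FiniteDimensional E N) (_ : IsGalois E N) (τ : N ≃ₐ[E] N),
      ∀ x, τ (algebraMap L N x) = algebraMap L N (σ x) := by
  have : Normal E (AlgebraicClosure L) :=
    have : IsAlgClosure E (AlgebraicClosure L) := ⟨inferInstance, .trans E L _⟩
    IsAlgClosure.normal E _
  have : Algebra.IsSeparable E (IntermediateField.normalClosure E L (AlgebraicClosure L)) := by
    have (f : L →ₐ[E] AlgebraicClosure L) : Algebra.IsSeparable E f.fieldRange :=
      .of_algHom _ _ (AlgEquiv.ofInjectiveField f).symm.toAlgHom
    exact IntermediateField.isSeparable_iSup _ _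
  refine ⟨IntermediateField.normalClosure E L (AlgebraicClosure L), inferInstance, inferInstance,
    inferInstance, inferInstance, inferInstance, ⟨⟩,
    σ.liftNormal _, fun x ↦ σ.liftNormal_commutes _ x⟩

theorem exists_frobLift_of_separable (Ω : Type) [Field Ω] [IsAlgClosed Ω] (p : ℕ) [Fact p.Prime]
    [CharP Ω p] {K L : Type} [Field K] [Field L] [Algebra K L] [Algebra (ZMod p) K] {t : K}
    {T : Set K} (ht : t ∉ T) (hT : T.Finite) (hi : AlgebraicIndepOn (ZMod p) id (insert t T))
    [FiniteDimensional (IntermediateField.adjoin (ZMod p) (insert t T)) K]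
    [Algebra.IsSeparable (IntermediateField.adjoin (ZMod p) (insert t T)) K]
    [FiniteDimensional K L] [IsGalois K L] (σ : L ≃ₐ[K] L) (S : Finset L) :
    ∃ (e : ℕ) (Φ : L →+* SeriesField Ω) (u : PowerSeries Ω), 0 < e ∧
      (∀ x, Φ (σ x) = frobField Ω p e (Φ x)) ∧
      (∀ x ∈ S, Φ x ∈ (algebraMap (PowerSeries Ω) (SeriesField Ω)).range) ∧
      Φ (algebraMap K L t) = algebraMap _ _ u ∧
      frobSeries Ω p e u = u ∧ PowerSeries.coeff 1 u = 1 ∧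
      ∀ j, 0 < j → 2 * j ≤ e →
        PowerSeries.constantCoeff u ^ p ^ j ≠ PowerSeries.constantCoeff u := by
  classical
  set E := IntermediateField.adjoin (ZMod p) (insert t T)
  have : FiniteDimensional E L := .trans E K L
  have : Algebra.IsSeparable E L := .trans E K L
  obtain ⟨N, _, _, _, _, _, _, τ, hτ⟩ := exists_galois_extension_lift (σ.restrictScalars E)
  obtain ⟨e, Φ, u, h1, h2, h3, h4, h5⟩ := exists_frobLift_insert Ω p ht hT.countable hi
    (hasFrobLift_adjoin Ω p T hT (hi.mono (Set.subset_insert _ _))) τ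
    (S.image (algebraMap L N))
  refine ⟨e, Φ.comp (algebraMap L N), u, h1, fun x ↦ ?_, fun x hx ↦ ?_, ?_, h5⟩
  · rw [RingHom.comp_apply, RingHom.comp_apply, ← h2, hτ]
    rfl
  · exact h3 _ (Finset.mem_image_of_mem _ hx)
  · rw [← h4, RingHom.comp_apply, IsScalarTower.algebraMap_apply E L N]
    rfl

theorem exists_frobLift (Ω : Type) [Field Ω] [IsAlgClosed Ω] (p : ℕ) [Fact p.Prime]
    [CharP Ω p] {K L : Type} [Field K] [Field L] [Algebra K L] [Infinite K] [CharP K p]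
    (hK : ∃ s : Finset K, Subfield.closure (s : Set K) = ⊤)
    [FiniteDimensional K L] [IsGalois K L] (σ : L ≃ₐ[K] L) (S : Finset L) :
    ∃ (e : ℕ) (Φ : L →+* SeriesField Ω) (u : PowerSeries Ω) (t : K), 0 < e ∧
      (∀ x, Φ (σ x) = frobField Ω p e (Φ x)) ∧
      (∀ x ∈ S, Φ x ∈ (algebraMap (PowerSeries Ω) (SeriesField Ω)).range) ∧
      Φ (algebraMap K L t) = algebraMap _ _ u ∧
      frobSeries Ω p e u = u ∧ PowerSeries.coeff 1 u = 1 ∧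
      ∀ j, 0 < j → 2 * j ≤ e →
        PowerSeries.constantCoeff u ^ p ^ j ≠ PowerSeries.constantCoeff u := by
  let _ : Algebra (ZMod p) K := ZMod.algebra K p
  have := essFiniteType_zmod p hK
  obtain ⟨s, hs, hsep⟩ := exists_isTranscendenceBasis_and_isSeparable_of_perfectField (ZMod p) K
  have halg : Algebra.IsAlgebraic (IntermediateField.adjoin (ZMod p) (s : Set K)) K :=
    hsep.isAlgebraic
  have : Algebra.EssFiniteType (IntermediateField.adjoin (ZMod p) (s : Set K)) K :=
    .of_comp (ZMod p) _ K
  have hfin : FiniteDimensional (IntermediateField.adjoin (ZMod p) (s : Set K)) K :=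
    Algebra.finite_of_essFiniteType_of_isAlgebraic
  have hne : s.Nonempty := by
    by_contra hs'
    rw [Finset.not_nonempty_iff_eq_empty] at hs'
    subst hs'
    have : Finite (IntermediateField.adjoin (ZMod p) ((∅ : Finset K) : Set K)) := by
      rw [Finset.coe_empty, IntermediateField.adjoin_empty]
      exact Finite.of_equiv _ (IntermediateField.botEquiv (ZMod p) K).symm.toEquiv
    have : Finite K := Module.finite_of_finite
      (IntermediateField.adjoin (ZMod p) ((∅ : Finset K) : Set K))
    exact not_finite K
  obtain ⟨t, ht⟩ := hne
  have hins : insert t ((s : Set K) \ {t}) = s := Set.insert_sdiff_self_of_mem ht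
  have hi : AlgebraicIndepOn (ZMod p) id (s : Set K) := hs.1
  rw [← hins] at hi hfin hsep
  obtain ⟨e, Φ, u, h⟩ := exists_frobLift_of_separable Ω p
    (Set.notMem_sdiff_of_mem (Set.mem_singleton t))
    (s.finite_toSet.subset Set.sdiff_subset) hi σ S
  exact ⟨e, Φ, u, t, h⟩

end ChebotarevFG

namespace ChebotarevFG
open Module

/-- The ring of power series over `Ω` as a valuation subring of its fraction field. -/
noncomputable def seriesValuation (Ω : Type) [Field Ω] : ValuationSubring (SeriesField Ω) where
  toSubring := (algebraMap (PowerSeries Ω) (SeriesField Ω)).range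
  mem_or_inv_mem' x := ValuationRing.isInteger_or_isInteger (PowerSeries Ω) x

theorem mem_comap_seriesValuation {Ω L : Type} [Field Ω] [Field L] (Φ : L →+* SeriesField Ω)
    {x : L} : x ∈ (seriesValuation Ω).comap Φ ↔
      ∃ f, algebraMap (PowerSeries Ω) (SeriesField Ω) f = Φ x := Iff.rfl

theorem valuation_comap_lt_one_iff {Ω L : Type} [Field Ω] [Field L] (Φ : L →+* SeriesField Ω)
    {x : L} {f : PowerSeries Ω} (h : algebraMap (PowerSeries Ω) (SeriesField Ω) f = Φ x) :
    ((seriesValuation Ω).comap Φ).valuation x < 1 ↔ PowerSeries.constantCoeff f = 0 := by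
  constructor
  · intro hx
    by_contra hf
    have hx0 : x ≠ 0 := by
      rintro rfl
      rw [map_zero, map_eq_zero_iff _ (IsFractionRing.injective _ _)] at h
      exact hf (h ▸ map_zero _)
    have hmem : x⁻¹ ∈ (seriesValuation Ω).comap Φ := by
      refine (mem_comap_seriesValuation Φ).2 ⟨f⁻¹, ?_⟩
      rw [map_inv₀, ← h]
      refine eq_inv_of_mul_eq_one_left ?_
      rw [← map_mul, PowerSeries.inv_mul_cancel f hf, map_one]
    rw [← ValuationSubring.valuation_le_one_iff, map_inv₀] at hmem
    exact absurd hmem (not_le.2 ((one_lt_inv₀ (zero_lt_iff.2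
      ((Valuation.ne_zero_iff _).2 hx0))).2 hx))
  · intro hf
    by_contra hx
    have hx0 : x ≠ 0 := by rintro rfl; simp at hx
    have hmem : x⁻¹ ∈ (seriesValuation Ω).comap Φ := by
      rw [← ValuationSubring.valuation_le_one_iff, map_inv₀]
      exact inv_le_one_of_one_le₀ (not_lt.1 hx)
    obtain ⟨g, hg⟩ := (mem_comap_seriesValuation Φ).1 hmem
    have h1 : g * f = 1 := by
      apply IsFractionRing.injective (PowerSeries Ω) (SeriesField Ω)
      rw [map_mul, hg, h, map_inv₀, map_one, inv_mul_cancel₀ ((map_ne_zero Φ).2 hx0)]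
    have h2 := congrArg PowerSeries.constantCoeff h1
    rw [map_mul, hf, mul_zero, map_one] at h2
    exact zero_ne_one h2

theorem exists_residueHom {Ω L : Type} [Field Ω] [Field L] (Φ : L →+* SeriesField Ω) :
    ∃ ρ : IsLocalRing.ResidueField ((seriesValuation Ω).comap Φ) →+* Ω,
      ∀ (x : (seriesValuation Ω).comap Φ) (f : PowerSeries Ω),
        algebraMap (PowerSeries Ω) (SeriesField Ω) f = Φ x →
          ρ (IsLocalRing.residue _ x) = PowerSeries.constantCoeff f := by
  let i := algebraMap (PowerSeries Ω) (SeriesField Ω)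
  have hi : Function.Injective i := IsFractionRing.injective _ _
  have hx : ∀ x : (seriesValuation Ω).comap Φ, ∃ f, i f = Φ x := fun x ↦ x.2
  choose r hr using hx
  let ρ : (seriesValuation Ω).comap Φ →+* PowerSeries Ω :=
    { toFun := r
      map_one' := hi (by rw [hr, map_one]; exact map_one Φ)
      map_zero' := hi (by rw [hr, map_zero]; exact map_zero Φ)
      map_mul' := fun x y ↦ hi (by rw [hr, map_mul, hr, hr]; exact map_mul Φ _ _)
      map_add' := fun x y ↦ hi (by rw [hr, map_add, hr, hr]; exact map_add Φ _ _) }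
  let ρ₀ : (seriesValuation Ω).comap Φ →+* Ω := PowerSeries.constantCoeff.comp ρ
  have : IsLocalHom ρ₀ := by
    constructor
    intro x hx
    have h1 : ¬ ((seriesValuation Ω).comap Φ).valuation x < 1 := by
      rw [valuation_comap_lt_one_iff Φ (hr x)]
      exact hx.ne_zero
    exact ((ValuationSubring.valuation_eq_one_iff _ _).2
      (le_antisymm (ValuationSubring.valuation_le_one _ x) (not_lt.1 h1)))
  refine ⟨IsLocalRing.ResidueField.lift ρ₀, fun x f hf ↦ ?_⟩
  rw [IsLocalRing.ResidueField.lift_residue_apply]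
  change PowerSeries.constantCoeff (r x) = _
  rw [hi ((hr x).trans hf.symm)]

end ChebotarevFG

namespace ChebotarevFG
open Module

theorem irreducible_of_coeff_one_ne_zero {Ω : Type} [Field Ω] {g : PowerSeries Ω}
    (h0 : PowerSeries.constantCoeff g = 0) (h1 : PowerSeries.coeff 1 g ≠ 0) : Irreducible g := by
  obtain ⟨h, rfl⟩ := PowerSeries.X_dvd_iff.2 h0
  have hu : IsUnit h := by
    rw [PowerSeries.isUnit_iff_constantCoeff, isUnit_iff_ne_zero]
    simpa [PowerSeries.coeff_succ_X_mul 0 h] using h1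
  exact (associated_mul_unit_right _ _ hu).irreducible PowerSeries.X_irreducible

theorem valuation_eq_pow_mul {Ω L : Type} [Field Ω] [Field L] (Φ : L →+* SeriesField Ω)
    {π : L} {g : PowerSeries Ω} (hg : Irreducible g)
    (hπ : Φ π = algebraMap (PowerSeries Ω) (SeriesField Ω) g) {x : L} (hx : x ≠ 0) :
    ∃ m n : ℕ, ((seriesValuation Ω).comap Φ).valuation x *
      ((seriesValuation Ω).comap Φ).valuation π ^ n =
        ((seriesValuation Ω).comap Φ).valuation π ^ m := by
  obtain ⟨a, b, hb, hab⟩ := IsFractionRing.div_surjective (A := PowerSeries Ω) (Φ x)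
  have hi := IsFractionRing.injective (PowerSeries Ω) (SeriesField Ω)
  have hb0 : b ≠ 0 := nonZeroDivisors.ne_zero hb
  have ha0 : a ≠ 0 := by
    rintro rfl
    rw [map_zero, zero_div, eq_comm, map_eq_zero] at hab
    exact hx hab
  obtain ⟨m, u, hm⟩ := IsDiscreteValuationRing.associated_pow_irreducible ha0 hg
  obtain ⟨n, u', hn⟩ := IsDiscreteValuationRing.associated_pow_irreducible hb0 hg
  have hg0 : algebraMap (PowerSeries Ω) (SeriesField Ω) g ≠ 0 := fun h ↦
    hg.ne_zero (hi (h.trans (map_zero _).symm))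
  have hπ0 : π ≠ 0 := by rintro rfl; exact hg0 (hπ ▸ map_zero Φ)
  have hb0' : algebraMap (PowerSeries Ω) (SeriesField Ω) b ≠ 0 := fun h ↦
    hb0 (hi (h.trans (map_zero _).symm))
  have hu : algebraMap (PowerSeries Ω) (SeriesField Ω) u ≠ 0 := fun h ↦
    u.ne_zero (hi (h.trans (map_zero _).symm))
  have key : algebraMap (PowerSeries Ω) (SeriesField Ω) (u' * ↑(u⁻¹) : PowerSeries Ω) =
      Φ (x * π ^ n / π ^ m) := by
    rw [map_div₀, map_mul Φ, map_pow Φ, map_pow Φ, hπ, ← map_pow, ← map_pow, ← hm, ← hn, ← hab,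
      map_mul, map_mul, map_mul]
    have ha0' : algebraMap (PowerSeries Ω) (SeriesField Ω) a ≠ 0 := fun h ↦
      ha0 (hi (h.trans (map_zero _).symm))
    have : algebraMap (PowerSeries Ω) (SeriesField Ω) u *
        algebraMap (PowerSeries Ω) (SeriesField Ω) ↑(u⁻¹) = 1 := by
      rw [← map_mul, Units.mul_inv, map_one]
    rw [eq_div_iff (mul_ne_zero ha0' hu)]
    field_simp
    linear_combination this
  refine ⟨m, n, ?_⟩
  have h1 : ((seriesValuation Ω).comap Φ).valuation (x * π ^ n / π ^ m) = 1 := by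
    refine le_antisymm ((ValuationSubring.valuation_le_one_iff _ _).2 ⟨_, key⟩) (not_lt.1 ?_)
    rw [valuation_comap_lt_one_iff Φ key]
    exact ((u' * u⁻¹).isUnit.map PowerSeries.constantCoeff).ne_zero
  rw [map_div₀, map_mul, map_pow, map_pow] at h1
  exact (div_eq_one_iff_eq (pow_ne_zero _ ((Valuation.ne_zero_iff _).2 hπ0))).1 h1

theorem isDiscreteValuationRing_of_valuation_eq_pow_mul {K : Type*} [Field K]
    (v : ValuationSubring K) {π : K} (hπ0 : π ≠ 0) (hπ : v.valuation π < 1)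
    (h : ∀ x : K, x ≠ 0 → ∃ m n : ℕ, v.valuation x * v.valuation π ^ n = v.valuation π ^ m) :
    IsDiscreteValuationRing v := by
  have hv0 : v.valuation π ≠ 0 := (Valuation.ne_zero_iff _).2 hπ0
  have hpos : 0 < v.valuation π := zero_lt_iff.2 hv0
  let ϖ : v := ⟨π, (v.valuation_le_one_iff π).1 hπ.le⟩
  have hval : ∀ x : v, x ≠ 0 → ∃ n : ℕ, v.valuation x = v.valuation π ^ n := by
    intro x hx
    obtain ⟨m, n, hmn⟩ := h x (fun h ↦ hx (Subtype.ext h))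
    have hx1 : v.valuation (x : K) ≤ 1 := v.valuation_le_one x
    have hnm : n ≤ m := by
      by_contra! hlt
      have : v.valuation π ^ m ≤ v.valuation π ^ n := by
        rw [← hmn]; exact mul_le_of_le_one_left' hx1
      exact absurd (pow_lt_pow_right_of_lt_one₀ hpos hπ hlt) (not_lt.2 this)
    refine ⟨m - n, mul_right_cancel₀ (pow_ne_zero n hv0) ?_⟩
    rw [hmn, ← pow_add, Nat.sub_add_cancel hnm]
  refine IsDiscreteValuationRing.ofHasUnitMulPowIrreducibleFactorization ⟨ϖ, ⟨?_, ?_⟩, ?_⟩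
  · intro hu
    exact hπ.ne ((v.valuation_eq_one_iff ϖ).1 hu)
  · intro a b hab
    have hϖ0 : ϖ ≠ 0 := fun h ↦ hπ0 (congrArg Subtype.val h)
    obtain ⟨i, hi⟩ := hval a (left_ne_zero_of_mul (hab ▸ hϖ0))
    obtain ⟨j, hj⟩ := hval b (right_ne_zero_of_mul (hab ▸ hϖ0))
    have h1 : v.valuation π ^ 1 = v.valuation π ^ (i + j) := by
      rw [pow_one, pow_add, ← hi, ← hj, ← map_mul]
      exact congrArg (fun z : v ↦ v.valuation (z : K)) hab
    have h2 : 1 = i + j := (pow_right_strictAnti₀ hpos hπ).injective h1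
    rcases Nat.eq_zero_or_pos i with rfl | hi0
    · exact .inl ((v.valuation_eq_one_iff a).2 (by rw [hi, pow_zero]))
    · obtain rfl : j = 0 := by omega
      exact .inr ((v.valuation_eq_one_iff b).2 (by rw [hj, pow_zero]))
  · intro x hx
    obtain ⟨n, hn⟩ := hval x hx
    refine ⟨n, ?_⟩
    rw [← map_pow] at hn
    obtain ⟨a, ha⟩ := (v.valuation_eq_iff _ _).1 hn
    refine ⟨a, Subtype.ext ?_⟩
    rw [← ha]
    simp [ϖ, mul_comm]

end ChebotarevFG

namespace ChebotarevFG
open Module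

theorem natCard_eq_of_injective_ringHom {Ω κ : Type} [Field Ω] [Field κ] (p : ℕ) [Fact p.Prime]
    [CharP Ω p] [IsAlgClosed Ω] (ρ : κ →+* Ω) {e : ℕ} (he : 0 < e)
    (hρ : ∀ x, ρ x ^ p ^ e = ρ x) (c : κ)
    (hc : ∀ j, 0 < j → 2 * j ≤ e → ρ c ^ p ^ j ≠ ρ c) : Finite κ ∧ Nat.card κ = p ^ e := by
  obtain ⟨Z, hZ, hmem⟩ := card_frobenius_fixed (Ω := Ω) p he.ne'
  have hinj : Function.Injective (fun x : κ ↦ (⟨ρ x, (hmem _).2 (hρ x)⟩ : Z)) := fun x y h ↦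
    ρ.injective (congrArg Subtype.val h)
  have hfin : Finite κ := Finite.of_injective _ hinj
  refine ⟨hfin, ?_⟩
  have : Fintype κ := Fintype.ofFinite κ
  have : CharP κ p := ρ.charP ρ.injective p
  obtain ⟨j, -, hj⟩ := FiniteField.card κ p
  have hp := (Fact.out : p.Prime)
  have hje : (j : ℕ) ≤ e := by
    rw [← Nat.pow_le_pow_iff_right hp.one_lt, ← hj, ← hZ, ← Fintype.card_coe Z]
    exact Fintype.card_le_of_injective _ hinj
  have hper : ∀ i, ρ c ^ p ^ i = ρ c ↔ Function.IsPeriodicPt (fun x : Ω ↦ x ^ p) i (ρ c) := by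
    intro i
    rw [Function.IsPeriodicPt, Function.IsFixedPt, pow_iterate]
  have h1 := (hper e).1 (hρ c)
  have h2 := (hper j).1 (by rw [← map_pow, ← hj, FiniteField.pow_card])
  have h3 := (hper _).2 (h1.gcd h2)
  have hd : 0 < e.gcd j := Nat.gcd_pos_of_pos_left _ he
  have h4 : ¬ 2 * e.gcd j ≤ e := fun h ↦ hc _ hd h h3
  obtain ⟨k, hk⟩ := Nat.gcd_dvd_left e j
  have hk1 : k = 1 := by
    by_contra hk1
    have : k ≠ 0 := by rintro rfl; omega
    have : 2 ≤ k := by omega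
    apply h4
    calc 2 * e.gcd j ≤ k * e.gcd j := Nat.mul_le_mul_right _ this
      _ = e := by rw [mul_comm, ← hk]
  have h5 : e ∣ j := by
    have := Nat.gcd_dvd_right e j
    rwa [show e.gcd j = e by rw [hk1, mul_one] at hk; exact hk.symm] at this
  have h6 : (j : ℕ) = e := le_antisymm hje (Nat.le_of_dvd j.pos h5)
  rw [Nat.card_eq_fintype_card, hj, h6]

theorem residueField_card {Ω K : Type} [Field Ω] [IsAlgClosed Ω] (p : ℕ) [Fact p.Prime]
    [CharP Ω p] [Field K] (Ψ : K →+* SeriesField Ω) {e : ℕ} (he : 0 < e)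
    (hΨ : ∀ x, frobField Ω p e (Ψ x) = Ψ x) {t : K} {u : PowerSeries Ω}
    (ht : Ψ t = algebraMap _ _ u)
    (hu : ∀ j, 0 < j → 2 * j ≤ e →
        PowerSeries.constantCoeff u ^ p ^ j ≠ PowerSeries.constantCoeff u) :
    Finite (IsLocalRing.ResidueField ((seriesValuation Ω).comap Ψ)) ∧
      Nat.card (IsLocalRing.ResidueField ((seriesValuation Ω).comap Ψ)) = p ^ e := by
  obtain ⟨ρ, hρ⟩ := exists_residueHom Ψ
  refine natCard_eq_of_injective_ringHom p ρ he (fun x ↦ ?_)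
    (IsLocalRing.residue _ ⟨t, (mem_comap_seriesValuation Ψ).2 ⟨u, ht.symm⟩⟩) ?_
  · obtain ⟨x, rfl⟩ := IsLocalRing.residue_surjective x
    obtain ⟨f, hf⟩ := (mem_comap_seriesValuation Ψ).1 x.2
    have h1 : frobSeries Ω p e f = f := by
      apply IsFractionRing.injective (PowerSeries Ω) (SeriesField Ω)
      rw [← frobField_algebraMap, hf, hΨ]
    rw [hρ _ _ hf]
    conv_rhs => rw [← h1, constantCoeff_frobSeries]
  · rw [hρ _ _ ht.symm]
    exact hu

theorem isFrobeniusAt_comap {Ω K L : Type} [Field Ω] (p : ℕ) [Fact p.Prime]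
    [CharP Ω p] [Field K] [Field L] [Algebra K L] [FiniteDimensional K L]
    (Φ : L →+* SeriesField Ω) {e : ℕ} (σ : L ≃ₐ[K] L)
    (hσ : ∀ x, Φ (σ x) = frobField Ω p e (Φ x)) (v : ValuationSubring K)
    (hcard : Nat.card (IsLocalRing.ResidueField v) = p ^ e) :
    ValuationSubring.IsFrobeniusAt v ((seriesValuation Ω).comap Φ) σ := by
  have h1 : ∀ x, x ∈ (seriesValuation Ω).comap Φ → σ x ∈ (seriesValuation Ω).comap Φ := by
    rintro x ⟨f, hf⟩
    exact ⟨frobSeries Ω p e f, by rw [hσ, ← frobField_algebraMap, hf]⟩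
  refine ⟨fun x ↦ ⟨h1 x, fun hx ↦ ?_⟩, fun x hx ↦ ?_⟩
  · have h2 : ∀ n : ℕ, (σ ^ n) (σ x) ∈ (seriesValuation Ω).comap Φ := by
      intro n
      induction n with
      | zero => exact hx
      | succ n ih => rw [pow_succ', AlgEquiv.mul_apply]; exact h1 _ ih
    have h3 := h2 (orderOf σ - 1)
    rwa [← AlgEquiv.mul_apply, pow_sub_one_mul (orderOf_pos σ).ne', pow_orderOf_eq_one] at h3
  · obtain ⟨f, hf⟩ := hx
    rw [hcard]
    have : algebraMap (PowerSeries Ω) (SeriesField Ω) (frobSeries Ω p e f - f ^ p ^ e) =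
        Φ (σ x - x ^ p ^ e) := by
      rw [map_sub, map_sub, map_pow, map_pow, hσ, ← frobField_algebraMap, hf]
    rw [valuation_comap_lt_one_iff Φ this, map_sub, map_pow, constantCoeff_frobSeries, sub_self]

end ChebotarevFG

namespace ChebotarevFG
open Module

theorem valuation_lt_one_iff_inv {L : Type*} [Field L] (w : ValuationSubring L) {x : L} :
    w.valuation x < 1 ↔ x = 0 ∨ x⁻¹ ∉ w := by
  rcases eq_or_ne x 0 with rfl | hx
  · simp
  · have h : 0 < w.valuation x := zero_lt_iff.2 ((Valuation.ne_zero_iff _).2 hx)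
    rw [← w.valuation_le_one_iff, map_inv₀, not_le, one_lt_inv₀ h]
    simp [hx]

theorem integralClosure_mem {K L : Type*} [Field K] [Field L] [Algebra K L]
    {v : ValuationSubring K} {w : ValuationSubring L} (h : w.comap (algebraMap K L) = v)
    (b : integralClosure v L) : (b : L) ∈ w := by
  have hb : (algebraMap v L).IsIntegralElem (b : L) := b.2
  have h1 : algebraMap v L = (algebraMap w L).comp (ValuationSubring.extensionHom v w h) := rfl
  rw [h1] at hb
  obtain ⟨y, hy⟩ := IsIntegrallyClosed.isIntegral_iff.1 (hb.of_comp)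
  exact hy ▸ y.2

/-- The prime of the integral closure of `v` below the maximal ideal of `w`. -/
def centre {K L : Type*} [Field K] [Field L] [Algebra K L]
    {v : ValuationSubring K} {w : ValuationSubring L} (h : w.comap (algebraMap K L) = v) :
    Ideal (integralClosure v L) :=
  (IsLocalRing.maximalIdeal w).comap
    ((integralClosure v L).val.toRingHom.codRestrict w.toSubring (integralClosure_mem h))

theorem mem_centre {K L : Type*} [Field K] [Field L] [Algebra K L]
    {v : ValuationSubring K} {w : ValuationSubring L} (h : w.comap (algebraMap K L) = v)
    {b : integralClosure v L} : b ∈ centre h ↔ w.valuation (b : L) < 1 :=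
  w.valuation_lt_one_iff ⟨b, integralClosure_mem h b⟩

instance centre_isPrime {K L : Type*} [Field K] [Field L] [Algebra K L]
    {v : ValuationSubring K} {w : ValuationSubring L} (h : w.comap (algebraMap K L) = v) :
    (centre h).IsPrime :=
  inferInstanceAs (Ideal.comap _ _).IsPrime

theorem mem_under_centre {K L : Type*} [Field K] [Field L] [Algebra K L]
    {v : ValuationSubring K} {w : ValuationSubring L} (h : w.comap (algebraMap K L) = v)
    {a : v} : a ∈ (centre h).under v ↔ v.valuation (a : K) < 1 := by
  rw [Ideal.under_def, Ideal.mem_comap, mem_centre, valuation_lt_one_iff_inv,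
    valuation_lt_one_iff_inv]
  have h1 : ((algebraMap v (integralClosure v L) a : integralClosure v L) : L) =
    algebraMap K L a := rfl
  rw [h1, ← map_inv₀, map_eq_zero]
  subst h
  rfl

theorem mem_iff_exists_centre {K L : Type*} [Field K] [Field L] [Algebra K L]
    [FiniteDimensional K L] [Algebra.IsSeparable K L]
    {v : ValuationSubring K} {w : ValuationSubring L} (h : w.comap (algebraMap K L) = v)
    [IsDiscreteValuationRing v] {x : L} :
    x ∈ w ↔ ∃ b c : integralClosure v L, c ∉ centre h ∧ x * c = b := by
  have : IsDedekindDomain (integralClosure v L) := integralClosure.isDedekindDomain v K L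
  have : IsFractionRing (integralClosure v L) L :=
    integralClosure.isFractionRing_of_finite_extension K L
  constructor
  · intro hx
    have hP : centre h ≠ ⊥ := by
      obtain ⟨a, ha, ha0⟩ := Submodule.exists_mem_ne_zero_of_ne_bot
        (IsDiscreteValuationRing.not_a_field v)
      intro hbot
      have h1 : a ∈ (centre h).under v := (mem_under_centre h).2 ((v.valuation_lt_one_iff a).1 ha)
      rw [hbot, Ideal.under_def, Ideal.mem_comap, Ideal.mem_bot] at h1
      have h2 : algebraMap K L a = 0 := congrArg Subtype.val h1
      exact ha0 (Subtype.ext ((map_eq_zero _).1 h2))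
    let D := Localization.AtPrime (centre h)
    have : IsDiscreteValuationRing D :=
      IsLocalization.AtPrime.isDiscreteValuationRing_of_dedekind_domain _ hP D
    have hdt : ∀ y z : D, y ∣ z ∨ z ∣ y := fun y z ↦
      ValuationRing.dvd_total (h := (inferInstance : ValuationRing D).toPreValuationRing) y z
    have hD : Function.Injective (algebraMap (integralClosure v L) D) :=
      IsLocalization.injective D (centre h).primeCompl_le_nonZeroDivisors
    have key : ∀ b c : integralClosure v L, algebraMap _ D c ∣ algebraMap _ D b →
        ∃ r s, s ∉ centre h ∧ b * s = c * r := by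
      rintro b c ⟨d, hd⟩
      obtain ⟨r, s, rfl⟩ := IsLocalization.exists_mk'_eq (centre h).primeCompl d
      refine ⟨r, s, s.2, hD ?_⟩
      rw [map_mul, hd, map_mul, mul_assoc, IsLocalization.mk'_spec]
    obtain ⟨b, c, hc, rfl⟩ := IsFractionRing.div_surjective (A := integralClosure v L) x
    have hc0 : (algebraMap (integralClosure v L) L c) ≠ 0 := fun h0 ↦
      nonZeroDivisors.ne_zero hc (IsFractionRing.injective _ L (h0.trans (map_zero _).symm))
    rcases hdt (algebraMap _ D c) (algebraMap _ D b) with hdvd | hdvd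
    · obtain ⟨r, s, hs, hrs⟩ := key b c hdvd
      refine ⟨r, s, hs, ?_⟩
      have := congrArg (algebraMap (integralClosure v L) L) hrs
      rw [map_mul, map_mul] at this
      change _ * algebraMap (integralClosure v L) L s = algebraMap (integralClosure v L) L r
      field_simp
      exact this
    · obtain ⟨r, s, hs, hrs⟩ := key c b hdvd
      have h1 := congrArg (algebraMap (integralClosure v L) L) hrs
      rw [map_mul, map_mul] at h1
      have hs1 : w.valuation (algebraMap (integralClosure v L) L s) = 1 :=
        le_antisymm ((w.valuation_le_one_iff _).2 (integralClosure_mem h s))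
          (not_lt.1 (mt (mem_centre h).2 hs))
      have h3 : (algebraMap (integralClosure v L) L b / algebraMap (integralClosure v L) L c) *
          algebraMap (integralClosure v L) L r = algebraMap (integralClosure v L) L s := by
        field_simp
        rw [← h1, mul_comm]
      refine ⟨s, r, fun hr ↦ ?_, h3⟩
      have h4 := congrArg w.valuation h3
      rw [map_mul, hs1] at h4
      have h5 := mul_lt_one_of_nonneg_of_lt_one_right ((w.valuation_le_one_iff _).2 hx) zero_le
        ((mem_centre h).1 hr)
      exact h5.ne h4
  · rintro ⟨b, c, hc, hx⟩
    have hc1 : w.valuation (c : L) = 1 :=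
      le_antisymm ((w.valuation_le_one_iff _).2 (integralClosure_mem h c))
        (not_lt.1 (mt (mem_centre h).2 hc))
    have := congrArg w.valuation hx
    rw [map_mul, hc1, mul_one] at this
    rw [← w.valuation_le_one_iff, this, w.valuation_le_one_iff]
    exact integralClosure_mem h b

open Pointwise in
theorem exists_comap_eq_of_comap_eq {K L : Type*} [Field K] [Field L] [Algebra K L]
    [FiniteDimensional K L] [IsGalois K L]
    {v : ValuationSubring K} {w w' : ValuationSubring L} (h : w.comap (algebraMap K L) = v)
    (h' : w'.comap (algebraMap K L) = v) [IsDiscreteValuationRing v] :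
    ∃ g : L ≃ₐ[K] L, ∀ x, x ∈ w' ↔ g x ∈ w := by
  have : Algebra.IsInvariant v (integralClosure v L) (L ≃ₐ[K] L) := by
    refine ⟨fun b hb ↦ ?_⟩
    obtain ⟨a, ha⟩ := (IsGalois.mem_bot_iff_fixed (F := K) (b : L)).2
      fun g ↦ congrArg Subtype.val (hb g)
    have ha' : algebraMap K L a = b := ha
    have h1 : a ∈ v := by
      rw [← h, ValuationSubring.mem_comap, ha']
      exact integralClosure_mem h b
    exact ⟨⟨a, h1⟩, Subtype.ext ha'⟩
  obtain ⟨g, hg⟩ := Algebra.IsInvariant.exists_smul_of_under_eq v (integralClosure v L)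
    (L ≃ₐ[K] L) (centre h) (centre h')
    (by ext a; rw [mem_under_centre, mem_under_centre])
  have hgc : ∀ b, b ∈ centre h' ↔ g⁻¹ • b ∈ centre h := fun b ↦ by
    rw [hg]; exact Ideal.mem_pointwise_smul_iff_inv_smul_mem
  refine ⟨g⁻¹, fun x ↦ ?_⟩
  rw [mem_iff_exists_centre h', mem_iff_exists_centre h]
  constructor
  · rintro ⟨b, c, hc, hx⟩
    refine ⟨g⁻¹ • b, g⁻¹ • c, (hgc c).not.1 hc, ?_⟩
    exact (map_mul (g⁻¹) x (c : L)).symm.trans (congrArg (g⁻¹ : L ≃ₐ[K] L) hx)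
  · rintro ⟨b, c, hc, hx⟩
    refine ⟨g • b, g • c, (hgc _).not.2 (by rwa [inv_smul_smul]), ?_⟩
    apply (g⁻¹).injective
    rw [map_mul]
    have e : ∀ d : integralClosure v L, (g⁻¹) ((g • d : integralClosure v L) : L) = d :=
      fun d ↦ congrArg Subtype.val (inv_smul_smul g d)
    rw [e, e]
    exact hx

end ChebotarevFG

namespace ChebotarevFG
open Module

theorem isUnramifiedExtension_comap {Ω K L : Type} [Field Ω] (p : ℕ) [Fact p.Prime]
    [Algebra (ZMod p) Ω] [Algebra.IsAlgebraic (ZMod p) Ω] [Field K] [Field L] [Algebra K L]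
    (Φ : L →+* SeriesField Ω) {π : K} {g : PowerSeries Ω} (hg : Irreducible g)
    (hπ : Φ (algebraMap K L π) = algebraMap _ _ g) (v : ValuationSubring K)
    (h : ((seriesValuation Ω).comap Φ).comap (algebraMap K L) = v)
    [Finite (IsLocalRing.ResidueField v)] :
    ValuationSubring.IsUnramifiedExtension v ((seriesValuation Ω).comap Φ) h := by
  have hπ0 : π ≠ 0 := by
    rintro rfl
    rw [map_zero, map_zero, eq_comm,
      map_eq_zero_iff _ (IsFractionRing.injective (PowerSeries Ω) (SeriesField Ω))] at hπ
    exact hg.ne_zero hπ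
  refine ⟨fun x hx ↦ ?_, ?_⟩
  · obtain ⟨m, n, hmn⟩ := valuation_eq_pow_mul Φ hg hπ hx
    refine ⟨π ^ m / π ^ n, div_ne_zero (pow_ne_zero _ hπ0) (pow_ne_zero _ hπ0), ?_⟩
    rw [map_div₀, map_div₀, map_pow, map_pow, map_pow, map_pow, eq_div_iff, hmn]
    exact pow_ne_zero _ ((Valuation.ne_zero_iff _).2 ((map_ne_zero _).2 hπ0))
  · let _ := (IsLocalRing.ResidueField.map (ValuationSubring.extensionHom v _ h)).toAlgebra
    change Algebra.IsSeparable (IsLocalRing.ResidueField v)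
      (IsLocalRing.ResidueField ((seriesValuation Ω).comap Φ))
    obtain ⟨ρ, -⟩ := exists_residueHom Φ
    have : CharP Ω p := charP_of_injective_algebraMap (algebraMap (ZMod p) Ω).injective p
    have : CharP (IsLocalRing.ResidueField ((seriesValuation Ω).comap Φ)) p :=
      ρ.charP ρ.injective p
    have : CharP (IsLocalRing.ResidueField v) p :=
      (algebraMap (IsLocalRing.ResidueField v)
        (IsLocalRing.ResidueField ((seriesValuation Ω).comap Φ))).charP
        (RingHom.injective _) p
    let _ : Algebra (ZMod p) (IsLocalRing.ResidueField v) := ZMod.algebra _ p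
    let _ : Algebra (ZMod p) (IsLocalRing.ResidueField ((seriesValuation Ω).comap Φ)) :=
      ZMod.algebra _ p
    have : IsScalarTower (ZMod p) (IsLocalRing.ResidueField v)
        (IsLocalRing.ResidueField ((seriesValuation Ω).comap Φ)) :=
      .of_algebraMap_eq' (Subsingleton.elim _ _)
    have hρ (r : ZMod p) : ρ (algebraMap (ZMod p) _ r) = algebraMap (ZMod p) Ω r :=
      RingHom.congr_fun
        (Subsingleton.elim (ρ.comp (algebraMap (ZMod p) _)) (algebraMap (ZMod p) Ω)) r
    let ρ' : IsLocalRing.ResidueField ((seriesValuation Ω).comap Φ) →ₐ[ZMod p] Ω :=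
      { ρ with commutes' := hρ }
    have : Algebra.IsAlgebraic (ZMod p)
        (IsLocalRing.ResidueField ((seriesValuation Ω).comap Φ)) :=
      .of_injective ρ' ρ'.toRingHom.injective
    have : Algebra.IsAlgebraic (IsLocalRing.ResidueField v)
        (IsLocalRing.ResidueField ((seriesValuation Ω).comap Φ)) := .tower_top (K := ZMod p) _
    infer_instance

theorem coeff_one_pow_char_pow {Ω : Type} [Field Ω] (p : ℕ) [CharP Ω p] {e : ℕ} (he : 0 < e)
    (u : PowerSeries Ω) : PowerSeries.coeff 1 (u ^ p ^ e) = 0 := by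
  have h1 := PowerSeries.coeff_derivative (u ^ p ^ e) 0
  have h2 : PowerSeries.derivative Ω (u ^ p ^ e) = 0 := by
    rw [Derivation.leibniz_pow, ← Nat.cast_smul_eq_nsmul Ω, Nat.cast_pow, CharP.cast_eq_zero,
      zero_pow he.ne', zero_smul]
  rw [h2] at h1
  simpa using h1.symm

theorem exists_valuationSubring {K L : Type} [Field K] [Field L] [Algebra K L] [Infinite K]
    (p : ℕ) [Fact p.Prime] [CharP K p]
    (hK : ∃ s : Finset K, Subfield.closure (s : Set K) = ⊤)
    [FiniteDimensional K L] [IsGalois K L] (σ : L ≃ₐ[K] L) (Y : Finset K) :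
    ∃ v : ValuationSubring K, (∀ y ∈ Y, y ∈ v) ∧ v ≠ ⊤ ∧ IsDiscreteValuationRing v ∧
      Finite (IsLocalRing.ResidueField v) ∧
      ∀ (w : ValuationSubring L) (hw : w.comap (algebraMap K L) = v),
        ValuationSubring.IsUnramifiedExtension v w hw ∧
        ∃ τ, IsConj σ τ ∧ ValuationSubring.IsFrobeniusAt v w τ := by
  classical
  let Ω := AlgebraicClosure (ZMod p)
  have : CharP Ω p := charP_of_injective_algebraMap (algebraMap (ZMod p) Ω).injective p
  obtain ⟨e, Φ, u, t, he, hσ, hY, ht, hfu, hu1, hu⟩ :=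
    exists_frobLift Ω p hK σ (Y.image (algebraMap K L))
  let Ψ : K →+* SeriesField Ω := Φ.comp (algebraMap K L)
  have hΨ : ∀ x, frobField Ω p e (Ψ x) = Ψ x := fun x ↦ by
    rw [RingHom.comp_apply, ← hσ, AlgEquiv.commutes]
  have hg0 : PowerSeries.constantCoeff (u ^ p ^ e - u) = 0 := by
    have := constantCoeff_frobSeries Ω p e u
    rw [map_sub, map_pow, ← this, hfu, sub_self]
  have hg : Irreducible (u ^ p ^ e - u) := by
    refine irreducible_of_coeff_one_ne_zero hg0 ?_
    rw [map_sub, coeff_one_pow_char_pow p he, hu1, zero_sub]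
    exact neg_ne_zero.2 one_ne_zero
  have hπ : Ψ (t ^ p ^ e - t) = algebraMap _ _ (u ^ p ^ e - u) := by
    rw [map_sub, map_pow, map_sub, map_pow]
    exact congrArg₂ (fun a b : SeriesField Ω ↦ a ^ p ^ e - b) ht ht
  have hπ0 : t ^ p ^ e - t ≠ 0 := by
    intro h0
    rw [h0, map_zero, eq_comm,
      map_eq_zero_iff _ (IsFractionRing.injective (PowerSeries Ω) (SeriesField Ω))] at hπ
    exact hg.ne_zero hπ
  have hval := (valuation_comap_lt_one_iff Ψ hπ.symm).2 hg0
  obtain ⟨hfin, hcard⟩ := residueField_card p Ψ he hΨ ht hu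
  have hdvr : IsDiscreteValuationRing ((seriesValuation Ω).comap Ψ) :=
    isDiscreteValuationRing_of_valuation_eq_pow_mul _ hπ0 hval
      fun x hx ↦ valuation_eq_pow_mul Ψ hg hπ hx
  refine ⟨(seriesValuation Ω).comap Ψ, fun y hy ↦ hY _ (Finset.mem_image_of_mem _ hy),
    fun htop ↦ ?_, hdvr, hfin, fun w hw ↦ ?_⟩
  · rcases (valuation_lt_one_iff_inv _).1 hval with h | h
    · exact hπ0 h
    · exact h (htop ▸ ValuationSubring.mem_top _)
  · obtain ⟨g, hgw⟩ := exists_comap_eq_of_comap_eq (w := (seriesValuation Ω).comap Φ)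
      (v := (seriesValuation Ω).comap Ψ) rfl hw
    let Φ' : L →+* SeriesField Ω := Φ.comp (g : L →+* L)
    obtain rfl : w = (seriesValuation Ω).comap Φ' := by
      ext x
      exact hgw x
    refine ⟨isUnramifiedExtension_comap p Φ' hg (π := t ^ p ^ e - t) ?_ _ hw, g⁻¹ * σ * g,
      isConj_iff.2 ⟨g⁻¹, by rw [inv_inv]⟩, isFrobeniusAt_comap p Φ' _ (fun x ↦ ?_) _ hcard⟩
    · rw [← hπ]
      exact congrArg Φ (g.commutes _)
    · rw [RingHom.comp_apply, RingHom.comp_apply]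
      change Φ (g (g⁻¹ (σ (g x)))) = frobField Ω p e (Φ (g x))
      rw [← hσ]
      congr 1
      exact g.apply_symm_apply _

end ChebotarevFG

/-- **Infinitely many inequivalent valuations** (Prasad–Rapinchuk, Remark 4.2). Let `K` be an
infinite finitely generated field of characteristic `p > 0`, `R ⊆ K` a finitely generated
subring, `L/K` a finite Galois extension and `𝒞` a conjugacy class of `Gal(L/K)`. Then there
are infinitely many pairwise inequivalent (i.e. with pairwise distinct valuation rings)
nontrivial discrete valuations `v` of `K` whose completions are locally compact (equivalently:
`v` is discrete with finite residue field), whose valuation rings contain `R`, and such that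
every extension `w` of `v` to `L` is unramified with Frobenius automorphism in `𝒞`. -/
theorem chebotarev_finitely_generated_positive_char_infinitely_many
    {K L : Type} [Field K] [Field L] [Algebra K L] [Infinite K]
    (p : ℕ) (hp : p.Prime) [CharP K p]
    (hKfg : ∃ s : Finset K, Subfield.closure (s : Set K) = ⊤)
    (R : Subring K) (hRfg : ∃ s : Finset K, Subring.closure (s : Set K) = R)
    [FiniteDimensional K L] [IsGalois K L]
    (𝒞 : ConjClasses (L ≃ₐ[K] L)) :
    ∃ V : Set (ValuationSubring K), V.Infinite ∧
      ∀ v ∈ V, v ≠ ⊤ ∧ IsDiscreteValuationRing ↥v ∧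
        Finite (IsLocalRing.ResidueField ↥v) ∧
        (∀ x ∈ R, x ∈ v) ∧
        ∀ (w : ValuationSubring L) (hw : w.comap (algebraMap K L) = v),
          ValuationSubring.IsUnramifiedExtension v w hw ∧
          ∃ σ ∈ 𝒞.carrier, ValuationSubring.IsFrobeniusAt v w σ := by
  classical
  have : Fact p.Prime := ⟨hp⟩
  obtain ⟨s, rfl⟩ := hRfg
  obtain ⟨σ, rfl⟩ := 𝒞.exists_rep
  refine ⟨{v | _}, fun hfin ↦ ?_, fun v hv ↦ hv⟩
  have hmem (v : ValuationSubring K) : ∃ x, v ≠ ⊤ → x ∉ v := by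
    by_cases h : v = ⊤
    · exact ⟨0, fun h' ↦ absurd h h'⟩
    · by_contra! hc
      exact h (eq_top_iff.2 fun z _ ↦ (hc z).2)
  choose x hx using hmem
  obtain ⟨v, hY, htop, hdvr, hκ, hw⟩ :=
    ChebotarevFG.exists_valuationSubring p hKfg σ (s ∪ hfin.toFinset.image x)
  refine hx v htop (hY _ (Finset.mem_union_right _ (Finset.mem_image_of_mem _ ?_)))
  rw [Set.Finite.mem_toFinset]
  refine ⟨htop, hdvr, hκ, fun y hy ↦ ?_, fun w h ↦ ⟨(hw w h).1, ?_⟩⟩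
  · exact (Subring.closure_le (t := v.toSubring)).2
      (fun z hz ↦ hY z (Finset.mem_union_left _ hz)) hy
  · obtain ⟨τ, hτ, hfrob⟩ := (hw w h).2
    exact ⟨τ, ConjClasses.mem_carrier_iff_mk_eq.2 (ConjClasses.mk_eq_mk_iff_isConj.2 hτ.symm),
      hfrob⟩
end

section
/- Let K be an infinite finitely generated field of characteristic p > 0 and let R ⊆ K be a finitely generated subring. Then there exists a nontrivial discrete valuation v on K such that the completion K_v is locally compact and R is contained in the valuation ring 𝒪_v of v. -/
/-- A discrete valuation ring with finite residue field restricts along any embedding of an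
infinite field into its fraction field to a discrete valuation ring with finite residue field. -/
theorem exists_valuationSubring_comap {K B L : Type*} [Field K] [Infinite K] [CommRing B]
    [IsDomain B] [IsDiscreteValuationRing B] [Finite (IsLocalRing.ResidueField B)] [Field L]
    [Algebra B L] [IsFractionRing B L] (φ : K →+* L) :
    ∃ v : ValuationSubring K, IsDiscreteValuationRing v ∧
      Finite (IsLocalRing.ResidueField v) ∧ ∀ x, x ∈ v ↔ φ x ∈ (algebraMap B L).range := by
  let v : ValuationSubring K := (ValuationRing.valuation B L).valuationSubring.comap φ
  have hv (x : K) : x ∈ v ↔ φ x ∈ (algebraMap B L).range :=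
    ValuationRing.mem_integer_iff B L (φ x)
  have hinj : Function.Injective (algebraMap B L) := IsFractionRing.injective B L
  choose f hf using fun x : v ↦ (hv x).1 x.2
  let ψ : v →+* B :=
    { toFun := f
      map_one' := hinj <| by simp [hf]
      map_zero' := hinj <| by simp [hf]
      map_add' := fun x y ↦ hinj <| by simp [hf]
      map_mul' := fun x y ↦ hinj <| by simp [hf] }
  have hψ (x : v) : algebraMap B L (ψ x) = φ x := hf x
  have hψinj : Function.Injective ψ := fun x y h ↦ by
    apply Subtype.ext
    apply φ.injective
    rw [← hψ, ← hψ, h]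
  have hdvd (x y : v) (h : ψ x ∣ ψ y) : x ∣ y := by
    obtain ⟨c, hc⟩ := h
    by_cases hx : x = 0
    · subst hx
      have : ψ y = ψ 0 := by rw [hc, map_zero, zero_mul]
      rw [hψinj this]
    have hx' : (x : K) ≠ 0 := fun h ↦ hx (Subtype.ext h)
    have hq : (y : K) / x ∈ v := by
      rw [hv]
      refine ⟨c, ?_⟩
      have h0 : φ (x : K) ≠ 0 := (map_ne_zero φ).2 hx'
      rw [map_div₀, eq_div_iff h0, ← hψ, ← hψ, hc, map_mul, mul_comm]
    exact ⟨⟨_, hq⟩, Subtype.ext (by simp [mul_div_cancel₀ _ hx'])⟩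
  have hloc : IsLocalHom ψ := ⟨fun a ha ↦ isUnit_of_dvd_one (hdvd _ _ (by simpa using ha.dvd))⟩
  have hfin : Finite (IsLocalRing.ResidueField v) :=
    Finite.of_injective _ (IsLocalRing.ResidueField.map ψ).injective
  refine ⟨v, ?_, hfin, hv⟩
  have hpir : IsPrincipalIdealRing v := by
    refine ⟨fun I ↦ ?_⟩
    have hne : (I : Set v).Nonempty := ⟨0, I.zero_mem⟩
    let a := Function.argminOn (fun x ↦ IsDiscreteValuationRing.addVal B (ψ x)) (I : Set v) hne
    have ha : a ∈ I := Function.argminOn_mem _ (I : Set v) hne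
    refine ⟨a, le_antisymm (fun y hy ↦ ?_) ?_⟩
    · refine Ideal.mem_span_singleton.2 (hdvd _ _ ?_)
      rw [← IsDiscreteValuationRing.addVal_le_iff_dvd]
      exact Function.argminOn_le (fun x ↦ IsDiscreteValuationRing.addVal B (ψ x)) (I : Set v) hy
    · exact (Ideal.span_singleton_le_iff_mem I).2 ha
  refine { hpir with not_a_field' := fun hbot ↦ ?_ }
  have : Finite v := by
    refine Finite.of_injective (IsLocalRing.residue v) ?_
    rw [RingHom.injective_iff_ker_eq_bot, IsLocalRing.ker_residue, hbot]
  have hu : (Set.univ : Set K) ⊆ (v : Set K) ∪ (v : Set K)⁻¹ := fun x _ ↦ by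
    simpa using v.mem_or_inv_mem x
  have hvf : (v : Set K).Finite := Set.toFinite _
  exact Set.infinite_univ ((hvf.union hvf.inv).subset hu)

/-- Let `L / K` be a finite separable extension of the fraction field `K` of a discrete valuation
ring `A` with finite residue field. An infinite field embedding into `L` carries a discrete
valuation with finite residue field which is nonnegative at all elements integral over `A`. -/
theorem exists_valuationSubring_of_isSeparable {M A K L : Type*} [Field M] [Infinite M]
    [CommRing A] [IsDomain A] [IsDiscreteValuationRing A] [Finite (IsLocalRing.ResidueField A)]
    [Field K] [Algebra A K] [IsFractionRing A K] [Field L] [Algebra K L] [Algebra A L]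
    [IsScalarTower A K L] [FiniteDimensional K L] [Algebra.IsSeparable K L] (φ : M →+* L) :
    ∃ v : ValuationSubring M, IsDiscreteValuationRing v ∧
      Finite (IsLocalRing.ResidueField v) ∧ ∀ x, IsIntegral A (φ x) → x ∈ v := by
  have : IsDedekindDomain (integralClosure A L) := integralClosure.isDedekindDomain A K L
  have : Module.Finite A (integralClosure A L) := IsIntegralClosure.finite A K L _
  have : IsFractionRing (integralClosure A L) L :=
    integralClosure.isFractionRing_of_finite_extension K L
  have : FaithfulSMul A L := by
    rw [faithfulSMul_iff_algebraMap_injective, IsScalarTower.algebraMap_eq A K L]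
    exact (algebraMap K L).injective.comp (IsFractionRing.injective A K)
  obtain ⟨P, hPm, hP⟩ := Ideal.exists_maximal_ideal_liesOver_of_isIntegral
    (S := integralClosure A L) (IsLocalRing.maximalIdeal A)
  have hP0 : P ≠ ⊥ :=
    Ideal.ne_bot_of_liesOver_of_ne_bot (IsDiscreteValuationRing.not_a_field A) P
  let B := Localization.AtPrime P
  have : IsDiscreteValuationRing B :=
    IsLocalization.AtPrime.isDiscreteValuationRing_of_dedekind_domain _ hP0 _
  have : Finite (A ⧸ IsLocalRing.maximalIdeal A) :=
    inferInstanceAs (Finite (IsLocalRing.ResidueField A))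
  have : Module.Finite (A ⧸ IsLocalRing.maximalIdeal A) (integralClosure A L ⧸ P) :=
    Module.Finite.of_restrictScalars_finite A _ _
  have : Finite (integralClosure A L ⧸ P) :=
    Module.finite_of_finite (A ⧸ IsLocalRing.maximalIdeal A)
  have : Finite (IsLocalRing.ResidueField B) :=
    Finite.of_equiv _ (IsLocalization.AtPrime.equivQuotMaximalIdeal P B).toEquiv
  let : Algebra B L := IsLocalization.localizationAlgebraOfSubmonoidLe B L P.primeCompl
    (nonZeroDivisors (integralClosure A L)) P.primeCompl_le_nonZeroDivisors
  have : IsScalarTower (integralClosure A L) B L :=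
    IsLocalization.localization_isScalarTower_of_submonoid_le B L P.primeCompl
      (nonZeroDivisors (integralClosure A L)) P.primeCompl_le_nonZeroDivisors
  have : IsFractionRing B L :=
    IsFractionRing.isFractionRing_of_isDomain_of_isLocalization P.primeCompl B L
  obtain ⟨v, h1, h2, h3⟩ := exists_valuationSubring_comap (B := B) φ
  refine ⟨v, h1, h2, fun x hx ↦ (h3 x).2 ⟨algebraMap (integralClosure A L) B ⟨φ x, hx⟩, ?_⟩⟩
  rw [← IsScalarTower.algebraMap_apply]
  rfl

/-- Over a countable field there are arbitrarily many algebraically independent power series. -/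
theorem PowerSeries.exists_mvPolynomial_algHom_injective (k : Type) [Field k] [Countable k]
    (n : ℕ) : ∃ f : MvPolynomial (Fin n) k →ₐ[k] PowerSeries k, Function.Injective f := by
  obtain ⟨s, hs⟩ := exists_isTranscendenceBasis k (PowerSeries k)
  have hinf : s.Infinite := by
    intro hfin
    have := hfin.to_subtype
    have halg := hs.isAlgebraic
    have hcard := Algebra.IsAlgebraic.cardinalMk_le_max
      (Algebra.adjoin k (Set.range ((↑) : s → PowerSeries k))) (PowerSeries k)
    have hadj : Cardinal.mk (Algebra.adjoin k (Set.range ((↑) : s → PowerSeries k))) ≤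
        Cardinal.aleph0 := by
      refine (Algebra.cardinalMk_adjoin_le k _).trans ?_
      simp only [sup_le_iff, Cardinal.mk_le_aleph0_iff, Subtype.range_coe_subtype, le_refl,
        and_true]
      exact ⟨inferInstance, inferInstanceAs (Countable s)⟩
    rw [max_eq_right hadj, Cardinal.mk_le_aleph0_iff] at hcard
    obtain ⟨i, hi⟩ := exists_injective_nat (PowerSeries k)
    refine Function.cantor_injective
      (fun u : Set ℕ ↦ i (PowerSeries.mk (u.indicator fun _ ↦ (1 : k)))) fun u u' h ↦ ?_
    have hmk := hi h
    ext m
    have hm := congr_arg (PowerSeries.coeff m) hmk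
    rw [PowerSeries.coeff_mk, PowerSeries.coeff_mk] at hm
    by_cases h1 : m ∈ u <;> by_cases h2 : m ∈ u' <;> simp [h1, h2] at hm ⊢
  have := hinf.to_subtype
  obtain ⟨e⟩ : Nonempty (Fin n ↪ s) := ⟨(Fin.valEmbedding).trans (Infinite.natEmbedding s)⟩
  exact ⟨_, hs.1.comp e e.injective⟩

/-- The fraction field of a polynomial ring over a finite field, if infinite, carries a discrete
valuation with finite residue field which is nonnegative on all polynomials. -/
theorem exists_valuationSubring_of_mvPolynomial (k : Type) [Field k] [Finite k] (n : ℕ)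
    (F : Type*) [Field F] [Infinite F] [Algebra (MvPolynomial (Fin n) k) F]
    [IsFractionRing (MvPolynomial (Fin n) k) F] :
    ∃ v : ValuationSubring F, IsDiscreteValuationRing v ∧
      Finite (IsLocalRing.ResidueField v) ∧
      ∀ x, algebraMap (MvPolynomial (Fin n) k) F x ∈ v := by
  obtain ⟨f, hf⟩ := PowerSeries.exists_mvPolynomial_algHom_injective k n
  let g : MvPolynomial (Fin n) k →+* LaurentSeries k :=
    (algebraMap (PowerSeries k) (LaurentSeries k)).comp f.toRingHom
  have hg : Function.Injective g := (IsFractionRing.injective (PowerSeries k) _).comp hf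
  have : Finite (IsLocalRing.ResidueField (PowerSeries k)) :=
    Finite.of_equiv k PowerSeries.residueFieldOfPowerSeries.symm.toEquiv
  obtain ⟨v, h1, h2, h3⟩ := exists_valuationSubring_comap (B := PowerSeries k)
    (IsFractionRing.lift hg : F →+* LaurentSeries k)
  refine ⟨v, h1, h2, fun x ↦ (h3 _).2 ⟨f x, ?_⟩⟩
  rw [IsFractionRing.lift_algebraMap]
  rfl

/-- Let `K` be an infinite finitely generated field of characteristic `p > 0` and let `R ⊆ K`
be a finitely generated subring. Then there is a nontrivial discrete valuation `v` of `K`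
whose completion is locally compact (equivalently: `v` is a discrete valuation with finite
residue field) and whose valuation ring contains `R`. -/
theorem exists_discrete_valuation_locally_compact_completion
    {K : Type} [Field K] [Infinite K]
    (p : ℕ) (hp : p.Prime) [CharP K p]
    (hKfg : ∃ s : Finset K, Subfield.closure (s : Set K) = ⊤)
    (R : Subring K) (hRfg : ∃ s : Finset K, Subring.closure (s : Set K) = R) :
    ∃ v : ValuationSubring K, v ≠ ⊤ ∧ IsDiscreteValuationRing ↥v ∧
      Finite (IsLocalRing.ResidueField ↥v) ∧ ∀ x ∈ R, x ∈ v := by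
  classical
  obtain ⟨s, hs⟩ := hKfg
  obtain ⟨t, rfl⟩ := hRfg
  have : Fact p.Prime := ⟨hp⟩
  let : Algebra (ZMod p) K := ZMod.algebra K p
  let A : Subalgebra (ZMod p) K := Algebra.adjoin (ZMod p) ((s ∪ t : Finset K) : Set K)
  have hA : Algebra.FiniteType (ZMod p) A :=
    A.fg_iff_finiteType.1 ⟨s ∪ t, rfl⟩
  have hsub (x : K) (hx : x ∈ s ∪ t) : x ∈ A := Algebra.subset_adjoin hx
  obtain ⟨n, g, hg, hgint⟩ := exists_integral_inj_algHom_of_fg (ZMod p) A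
  let S := MvPolynomial (Fin n) (ZMod p)
  let : Algebra S K := (A.val.comp g).toRingHom.toAlgebra
  have hSinj : Function.Injective (algebraMap S K) := Subtype.val_injective.comp hg
  have : FaithfulSMul S K := (faithfulSMul_iff_algebraMap_injective S K).2 hSinj
  have hint (x : K) (hx : x ∈ A) : IsIntegral S x := by
    obtain ⟨q, hq, hq0⟩ := hgint ⟨x, hx⟩
    refine ⟨q, hq, ?_⟩
    have := congr_arg A.val.toRingHom hq0
    rwa [Polynomial.hom_eval₂, map_zero] at this
  let F := FractionRing S
  let : Algebra F K := FractionRing.liftAlgebra S K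
  have : IsScalarTower S F K := FractionRing.isScalarTower_liftAlgebra S K
  have hadj : IntermediateField.adjoin F (s : Set K) = ⊤ := by
    rw [eq_top_iff]
    intro x _
    have hx : x ∈ Subfield.closure (s : Set K) := hs ▸ Subfield.mem_top x
    exact (Subfield.closure_le (t := (IntermediateField.adjoin F (s : Set K)).toSubfield)).2
      (IntermediateField.subset_adjoin F _) hx
  have hfin : FiniteDimensional F K := by
    have : FiniteDimensional F (IntermediateField.adjoin F (s : Set K)) :=
      IntermediateField.finiteDimensional_adjoin fun x hx ↦
        (hint x (hsub x (Finset.mem_union_left _ hx))).tower_top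
    rw [hadj] at this
    exact Module.Finite.equiv (IntermediateField.topEquiv (F := F) (E := K)).toLinearEquiv
  have : Infinite F := by
    by_contra h
    rw [not_infinite_iff_finite] at h
    have : Finite K := Module.finite_of_finite F
    exact not_finite K
  obtain ⟨w, hw1, hw2, hw3⟩ := exists_valuationSubring_of_mvPolynomial (ZMod p) n F
  have : CharP F p := (algebraMap F K).charP (algebraMap F K).injective p
  let E := separableClosure F K
  let φ : K →+* E := IsPurelyInseparable.iterateFrobenius E K p le_rfl
  have hφ (x : K) : algebraMap E K (φ x) = x ^ p ^ _ :=
    IsPurelyInseparable.algebraMap_iterateFrobenius E p le_rfl x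
  obtain ⟨v, hv1, hv2, hv3⟩ := exists_valuationSubring_of_isSeparable (A := w) (K := F) φ
  refine ⟨v, ?_, hv1, hv2, ?_⟩
  · rintro rfl
    refine IsDiscreteValuationRing.not_isField (⊤ : ValuationSubring K) ?_
    exact MulEquiv.isField (Field.toIsField K) (Subring.topEquiv (R := K)).toMulEquiv
  · suffices Subring.closure (t : Set K) ≤ v.toSubring from this
    rw [Subring.closure_le]
    intro x hx
    apply hv3
    have h1 : IsIntegral S x := hint x (hsub x (Finset.mem_union_right _ hx))
    have : IsScalarTower w E K := .of_algebraMap_eq fun _ ↦ rfl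
    rw [← isIntegral_algebraMap_iff (algebraMap E K).injective, hφ]
    refine IsIntegral.pow ?_ _
    let j : S →+* w := (algebraMap S F).codRestrict w.toSubring hw3
    exact h1.map_of_comp_eq j (RingHom.id K)
      (RingHom.ext fun y ↦ (IsScalarTower.algebraMap_apply S F K y).symm)
end
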